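/- arXiv:2407.15521 — 2 statements merged into one kernel-verified Lean document; each statement's English description precedes it below -/
import Mathlib

section
/- Assume (H), let g : ℝ^d → ℂ be a nonzero Schwartz function and let 1 ≤ p < ∞. Then there exists a constant C > 0 such that for every t > 0, sup_{ξ∈ℝ^d} ( ∫_{ℝ^d} |V_g F_{tμ}(x,ξ)|^p dx )^{1/p} ≤ C · max{ t^{-d/(mp)}, t^{-2d/(mp)} }. (That is, ‖e^{2πitμ}‖_{M^{p,∞}} ≲ max{t^{-d/(mp)}, t^{-2d/(mp)}}.) -/
open MeasureTheory Real Complex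
open scoped ENNReal RealInnerProductSpace

noncomputable section

set_option linter.unusedSectionVars false

namespace Fresnel
open scoped FourierTransform ContDiff Nat
open Module

variable {E : Type} [NormedAddCommGroup E] [InnerProductSpace ℝ E] [FiniteDimensional ℝ E]
  [MeasurableSpace E] [BorelSpace E]

/-- `ee x = e^{2 π i x}` -/
def ee (x : ℝ) : ℂ := Complex.exp (((2 * Real.pi * x : ℝ) : ℂ) * Complex.I)

lemma norm_ee (x : ℝ) : ‖ee x‖ = 1 := by
  unfold ee; exact Complex.norm_exp_ofReal_mul_I _

lemma ee_add (x y : ℝ) : ee (x + y) = ee x * ee y := by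
  unfold ee; rw [← Complex.exp_add]; congr 1; push_cast; ring

lemma ee_zero : ee 0 = 1 := by simp [ee]

lemma contDiff_ee : ContDiff ℝ ∞ ee := by
  unfold ee
  have h : ContDiff ℝ ∞ (fun x : ℝ => (((2 * Real.pi * x : ℝ) : ℂ))) :=
    Complex.ofRealCLM.contDiff.comp (contDiff_const.mul contDiff_id)
  exact (h.mul contDiff_const).cexp

lemma continuous_ee : Continuous ee := contDiff_ee.continuous

lemma conj_ee (x : ℝ) : (starRingEnd ℂ) (ee x) = ee (-x) := by
  unfold ee
  rw [← Complex.exp_conj]; congr 1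
  rw [map_mul, Complex.conj_ofReal, Complex.conj_I]; push_cast; ring

lemma fourier_eq (f : E → ℂ) (w : E) : 𝓕 f w = ∫ v, ee (-⟪v, w⟫) * f v := by
  rw [Real.fourier_eq']
  congr 1; ext v; simp only [ee, smul_eq_mul]; congr 3; push_cast; ring

lemma fourierInv_eq (f : E → ℂ) (w : E) : 𝓕⁻ f w = ∫ v, ee (⟪v, w⟫) * f v := by
  rw [Real.fourierInv_eq']
  congr 1

/-- Quantitative decay of Fourier transforms. -/
lemma ft_decay (n : ℕ) : ∃ C : ℝ, 0 ≤ C ∧ ∀ (f : E → ℂ) (B H : ℝ), 1 ≤ H → ContDiff ℝ ∞ f →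
    tsupport f ⊆ Metric.closedBall 0 1 →
    (∀ k ≤ n, ∀ y, ‖y‖ ≤ 1 → ‖iteratedFDeriv ℝ k f y‖ ≤ B * H ^ k) →
    ∀ w, (1 + ‖w‖ / H) ^ n * ‖𝓕 f w‖ ≤ C * B := by
  set vol := (volume (Metric.closedBall (0:E) 1)).toReal with hvol
  have hvol0 : 0 ≤ vol := ENNReal.toReal_nonneg
  refine ⟨2 ^ (n-1) * (vol + 2 ^ n * ((n+1) * vol)), by positivity, ?_⟩
  intro f B H hH hf hsupp hb w
  have hH0 : 0 < H := by linarith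
  have hcs : HasCompactSupport f :=
    HasCompactSupport.of_support_subset_isCompact (isCompact_closedBall (0:E) 1)
      ((subset_tsupport f).trans hsupp)
  have hcont : ∀ k : ℕ, Continuous (iteratedFDeriv ℝ k f) := fun k =>
    hf.continuous_iteratedFDeriv (by exact_mod_cast le_top)
  have hintg : ∀ k : ℕ, Integrable (iteratedFDeriv ℝ k f) := fun k =>
    (hcont k).integrable_of_hasCompactSupport (hcs.iteratedFDeriv k)
  have hbi : ∀ k ≤ n, ∫ v, ‖iteratedFDeriv ℝ k f v‖ ≤ B * H ^ k * vol := by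
    intro k hk
    have hz : ∀ v, v ∉ Metric.closedBall (0:E) 1 → ‖iteratedFDeriv ℝ k f v‖ = 0 := by
      intro v hv
      rw [norm_eq_zero]
      by_contra h
      exact hv (hsupp (support_iteratedFDeriv_subset k (Function.mem_support.2 h)))
    rw [← setIntegral_eq_integral_of_forall_compl_eq_zero hz]
    calc _ ≤ ∫ v in Metric.closedBall (0:E) 1, B * H ^ k := by
          apply setIntegral_mono_on (hintg k).norm.integrableOn
          · exact integrableOn_const (measure_closedBall_lt_top).ne
          · exact Metric.isClosed_closedBall.measurableSet
          · intro x hx; exact hb k hk x (by simpa using hx)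
      _ = _ := by simp [Measure.real, hvol, mul_comm]
  have hB : 0 ≤ B := by
    have := hb 0 (Nat.zero_le _) 0 (by simp)
    simpa using (norm_nonneg _).trans this
  have h0 : ‖𝓕 f w‖ ≤ B * vol := by
    have h1 := hbi 0 (Nat.zero_le _)
    simp only [norm_iteratedFDeriv_zero, pow_zero, mul_one] at h1
    refine le_trans ?_ h1
    rw [fourier_eq]
    refine (norm_integral_le_integral_norm _).trans (le_of_eq ?_)
    congr 1; ext v; rw [norm_mul, norm_ee, one_mul]
  have h2 : ‖w‖ ^ n * ‖𝓕 f w‖ ≤ 2 ^ n * ((n+1) * vol) * B * H ^ n := by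
    have := Real.pow_mul_norm_iteratedFDeriv_fourier_le (f := f) (K := 0) (N := ⊤) (k := 0) (n := n)
      (by exact_mod_cast hf)
      (by
        intro k j hk _
        have hk' : k = 0 := by simpa using hk
        subst hk'
        simpa using (hintg j).norm) le_rfl le_top w
    simp only [norm_iteratedFDeriv_zero] at this
    refine this.trans ?_
    rw [Finset.sum_product]
    simp only [pow_zero, Nat.cast_zero, mul_zero, zero_add, one_mul, Finset.range_one, Finset.sum_singleton]
    have : ∑ x ∈ Finset.range (n+1), ∫ v, ‖iteratedFDeriv ℝ x f v‖ ≤ ∑ x ∈ Finset.range (n+1), B * H ^ n * vol := by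
      apply Finset.sum_le_sum
      intro k hk
      have hk' : k ≤ n := by simpa [Nat.lt_succ_iff] using hk
      refine (hbi k hk').trans ?_
      gcongr
    rw [Finset.sum_const, Finset.card_range, nsmul_eq_mul] at this
    push_cast at this
    calc _ ≤ 2 ^ n * (((n:ℝ)+1) * (B * H ^ n * vol)) := by gcongr
      _ = _ := by ring
  have h3 : (‖w‖ / H) ^ n * ‖𝓕 f w‖ ≤ 2 ^ n * ((n+1) * vol) * B := by
    rw [div_pow, div_mul_eq_mul_div, div_le_iff₀ (by positivity)]
    exact h2
  have h4 := add_pow_le (zero_le_one (α := ℝ)) (show 0 ≤ ‖w‖ / H by positivity) n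
  calc _ ≤ 2 ^ (n-1) * (1 ^ n + (‖w‖ / H) ^ n) * ‖𝓕 f w‖ := by gcongr
    _ = 2 ^ (n-1) * (‖𝓕 f w‖ + (‖w‖ / H) ^ n * ‖𝓕 f w‖) := by ring
    _ ≤ 2 ^ (n-1) * (B * vol + 2 ^ n * ((n+1) * vol) * B) := by gcongr
    _ = _ := by ring

/-- short-time Fourier transform (window not conjugated) -/
def VV (F W : E → ℂ) (x ξ : E) : ℂ := ∫ y, ee (-⟪ξ, y⟫) * F y * W (y - x)

lemma measurable_VV {F W : E → ℂ} (hF : Measurable F) (hW : Measurable W) :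
    Measurable (fun q : E × E => VV F W q.1 q.2) := by
  unfold VV
  have : StronglyMeasurable (fun r : (E × E) × E => ee (-⟪r.1.2, r.2⟫) * F r.2 * W (r.2 - r.1.1)) := by
    apply Measurable.stronglyMeasurable
    refine ((continuous_ee.measurable.comp ?_).mul (hF.comp measurable_snd)).mul (hW.comp ?_)
    · fun_prop
    · fun_prop
  exact this.integral_prod_right.measurable

/-- superposition lemma -/
lemma superpos {F W χ : E → ℂ} (hF : Measurable F) (hF1 : ∀ y, ‖F y‖ = 1)
    (hχm : Measurable χ) (hχ : Integrable χ)
    {Ω : Type} [MeasurableSpace Ω] (ν : Measure Ω) [SFinite ν] (κ : Ω → ℂ) (hκ : Integrable κ ν)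
    (u ζ : Ω → E) (hu : Measurable u) (hζ : Measurable ζ)
    (hW : ∀ z, W z = ∫ τ, κ τ * ee (⟪ζ τ, z⟫) * χ (z - u τ) ∂ν)
    (M : ℝ≥0∞) (hM : ∀ ξ, ∫⁻ x, ‖VV F χ x ξ‖ₑ ≤ M) (ξ : E) :
    ∫⁻ x, ‖VV F W x ξ‖ₑ ≤ (∫⁻ τ, ‖κ τ‖ₑ ∂ν) * M := by
  have key : ∀ x, VV F W x ξ = ∫ τ, κ τ * ee (-⟪ζ τ, x⟫) * VV F χ (x + u τ) (ξ - ζ τ) ∂ν := by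
    intro x
    have h1 : VV F W x ξ = ∫ y, ∫ τ, ee (-⟪ξ, y⟫) * F y * (κ τ * ee (⟪ζ τ, y - x⟫) * χ (y - x - u τ)) ∂ν := by
      unfold VV
      congr 1; ext y
      rw [hW, integral_const_mul]
    rw [h1, integral_integral_swap]
    · congr 1; ext τ
      unfold VV
      rw [← integral_const_mul]
      congr 1; ext y
      rw [show y - (x + u τ) = y - x - u τ by abel]
      have : ee (⟪ζ τ, y - x⟫) * ee (-⟪ξ, y⟫) = ee (-⟪ζ τ, x⟫) * ee (-⟪ξ - ζ τ, y⟫) := by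
        rw [← ee_add, ← ee_add]; congr 1; rw [inner_sub_right, inner_sub_left]; ring
      linear_combination (F y * κ τ * χ (y - x - u τ)) * this
    · rw [integrable_prod_iff']
      · constructor
        · refine Filter.Eventually.of_forall fun τ => ?_
          have hi : Integrable (fun y => χ (y - x - u τ)) := by
            simpa [sub_sub] using hχ.comp_sub_right (x + u τ)
          refine Integrable.mono' (hi.norm.const_mul ‖κ τ‖) ?_ ?_
          · apply Measurable.aestronglyMeasurable
            have : Measurable fun y => ee (-⟪ξ, y⟫) := continuous_ee.measurable.comp (by fun_prop)
            have h2 : Measurable fun y => ee (⟪ζ τ, y - x⟫) := continuous_ee.measurable.comp (by fun_prop)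
            have h3 : Measurable fun y => χ (y - x - u τ) := hχm.comp (by fun_prop)
            exact (this.mul hF).mul (((measurable_const (a := κ τ)).mul h2).mul h3)
          · refine Filter.Eventually.of_forall fun y => ?_
            simp [norm_ee, hF1]
        · refine (hκ.norm.mul_const (∫ y, ‖χ y‖)).congr ?_
          refine Filter.Eventually.of_forall fun τ => ?_
          simp only [Function.uncurry, norm_mul, norm_ee, hF1, mul_one, one_mul]
          rw [integral_const_mul]
          congr 1
          simp only [sub_sub]
          exact (integral_sub_right_eq_self (fun y => ‖χ y‖) (x + u τ)).symm
      · have h0 : AEStronglyMeasurable (fun q : E × Ω => κ q.2) (volume.prod ν) :=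
          hκ.aestronglyMeasurable.comp_snd
        have h1 : Measurable fun q : E × Ω => ee (-⟪ξ, q.1⟫) := continuous_ee.measurable.comp (by fun_prop)
        have h2 : Measurable fun q : E × Ω => ee (⟪ζ q.2, q.1 - x⟫) := continuous_ee.measurable.comp (by fun_prop)
        have h3 : Measurable fun q : E × Ω => χ (q.1 - x - u q.2) := hχm.comp (by fun_prop)
        exact (h1.mul (hF.comp measurable_fst)).aestronglyMeasurable.mul
          ((h0.mul h2.aestronglyMeasurable).mul h3.aestronglyMeasurable)
  calc ∫⁻ x, ‖VV F W x ξ‖ₑ ≤ ∫⁻ x, ∫⁻ τ, ‖κ τ‖ₑ * ‖VV F χ (x + u τ) (ξ - ζ τ)‖ₑ ∂ν := by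
        apply lintegral_mono; intro x
        dsimp only
        rw [key x]
        refine (enorm_integral_le_lintegral_enorm _).trans (le_of_eq ?_)
        congr 1; ext τ
        have : ‖ee (-⟪ζ τ, x⟫)‖ₑ = 1 := by rw [← ofReal_norm, norm_ee]; simp
        rw [enorm_mul, enorm_mul, this, mul_one]
    _ = ∫⁻ τ, (∫⁻ x, ‖κ τ‖ₑ * ‖VV F χ (x + u τ) (ξ - ζ τ)‖ₑ) ∂ν := by
        rw [lintegral_lintegral_swap]
        have h0 : AEStronglyMeasurable (fun q : E × Ω => κ q.2) (volume.prod ν) :=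
          hκ.aestronglyMeasurable.comp_snd
        have h1 : Measurable fun q : E × Ω => VV F χ (q.1 + u q.2) (ξ - ζ q.2) :=
          (measurable_VV hF hχm).comp (g := fun q : E × E => VV F χ q.1 q.2)
            (f := fun q : E × Ω => (q.1 + u q.2, ξ - ζ q.2)) (by fun_prop)
        exact h0.enorm.mul h1.enorm.aemeasurable
    _ ≤ ∫⁻ τ, ‖κ τ‖ₑ * M ∂ν := by
        apply lintegral_mono; intro τ
        dsimp only
        rw [lintegral_const_mul' _ _ enorm_ne_top]
        gcongr
        rw [lintegral_add_right_eq_self (fun x => ‖VV F χ x (ξ - ζ τ)‖ₑ)]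
        exact hM _
    _ = _ := by
        rw [lintegral_mul_const'' _ hκ.aestronglyMeasurable.enorm]
end Fresnel

namespace Fresnel
open scoped FourierTransform ContDiff Nat
open Module

variable {E : Type} [NormedAddCommGroup E] [InnerProductSpace ℝ E] [FiniteDimensional ℝ E]
  [MeasurableSpace E] [BorelSpace E]

lemma isOpen_ne0 : IsOpen {x : E | x ≠ 0} := isOpen_compl_singleton

lemma hom_fderiv {G : Type} [NormedAddCommGroup G] [NormedSpace ℝ G] {f : E → G} {a : ℝ}
    (hf : ContDiffOn ℝ ∞ f {x | x ≠ 0})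
    (hh : ∀ c : ℝ, 0 < c → ∀ x : E, x ≠ 0 → f (c • x) = c ^ a • f x) :
    ContDiffOn ℝ ∞ (fderiv ℝ f) {x | x ≠ 0} ∧
    ∀ c : ℝ, 0 < c → ∀ x : E, x ≠ 0 → fderiv ℝ f (c • x) = c ^ (a - 1) • fderiv ℝ f x := by
  refine ⟨hf.fderiv_of_isOpen isOpen_ne0 (by simp), ?_⟩
  intro c hc x hx
  have hd : ∀ y : E, y ≠ 0 → DifferentiableAt ℝ f y := fun y hy =>
    ((hf.contDiffAt (isOpen_ne0.mem_nhds hy)).differentiableAt (by simp))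
  have hcx : c • x ≠ 0 := smul_ne_zero hc.ne' hx
  have h1 : HasFDerivAt (fun y => f (c • y)) ((fderiv ℝ f (c • x)).comp (c • ContinuousLinearMap.id ℝ E)) x :=
    HasFDerivAt.comp x (hd _ hcx).hasFDerivAt ((hasFDerivAt_id x).const_smul c)
  have h2 : HasFDerivAt (fun y => f (c • y)) (c ^ a • fderiv ℝ f x) x := by
    refine ((hd x hx).hasFDerivAt.const_smul (c ^ a)).congr_of_eventuallyEq ?_
    filter_upwards [isOpen_ne0.mem_nhds hx] with y hy
    exact hh c hc y hy
  have h3 := h1.unique h2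
  have h4 : c • fderiv ℝ f (c • x) = c ^ a • fderiv ℝ f x := by
    rw [← h3]; ext v; simp
  rw [Real.rpow_sub_one hc.ne', div_eq_inv_mul, mul_smul, ← h4, smul_smul, inv_mul_cancel₀ hc.ne', one_smul]

lemma hom_bound (k : ℕ) : ∀ {G : Type} [NormedAddCommGroup G] [NormedSpace ℝ G] {f : E → G} {a : ℝ}
    (_ : ContDiffOn ℝ ∞ f {x | x ≠ 0})
    (_ : ∀ c : ℝ, 0 < c → ∀ x : E, x ≠ 0 → f (c • x) = c ^ a • f x),
    ∃ C : ℝ, 0 ≤ C ∧ ∀ x : E, x ≠ 0 → ‖iteratedFDeriv ℝ k f x‖ ≤ C * ‖x‖ ^ (a - k) := by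
  induction k with
  | zero =>
    intro G _ _ f a hf hh
    have hcont : ContinuousOn f (Metric.sphere (0:E) 1) := hf.continuousOn.mono (by
      intro x hx h0
      simp [h0] at hx)
    obtain ⟨C, hC⟩ := (isCompact_sphere (0:E) 1).exists_bound_of_continuousOn hcont
    refine ⟨max C 0, le_max_right _ _, ?_⟩
    intro x hx
    have hn : 0 < ‖x‖ := norm_pos_iff.2 hx
    have h1 := hh ‖x‖ hn (‖x‖⁻¹ • x) (smul_ne_zero (inv_ne_zero hn.ne') hx)
    rw [smul_smul, mul_inv_cancel₀ hn.ne', one_smul] at h1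
    rw [norm_iteratedFDeriv_zero, h1, norm_smul, Real.norm_of_nonneg (by positivity)]
    have h2 := hC (‖x‖⁻¹ • x) (by simp [norm_smul, hn.ne'])
    simp only [Nat.cast_zero, sub_zero]
    rw [mul_comm]
    gcongr
    exact h2.trans (le_max_left _ _)
  | succ k ih =>
    intro G _ _ f a hf hh
    obtain ⟨h1, h2⟩ := hom_fderiv hf hh
    obtain ⟨C, hC, h⟩ := ih h1 h2
    refine ⟨C, hC, fun x hx => ?_⟩
    rw [← norm_iteratedFDeriv_fderiv]
    refine (h x hx).trans (le_of_eq ?_)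
    push_cast; congr 2; ring

lemma local_antilip {G : Type} [NormedAddCommGroup G] [NormedSpace ℝ G] {Φ : E → G} {m : ℝ} (hm : 2 ≤ m)
    (hf : ContDiffOn ℝ ∞ Φ {x | x ≠ 0})
    (hh : ∀ c : ℝ, 0 < c → ∀ x : E, x ≠ 0 → Φ (c • x) = c ^ (m - 1) • Φ x)
    (θ₀ : E) (hθ₀ : ‖θ₀‖ = 1) (hinj : Function.Injective (fderiv ℝ Φ θ₀)) :
    ∃ U ∈ nhds θ₀, ∃ c : ℝ, 0 < c ∧ ∀ θ ∈ U, ∀ θ' ∈ U, ‖θ‖ = 1 → ‖θ'‖ = 1 → ∀ ρ : ℝ, 0 < ρ → ρ ≤ 1 →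
      c * ‖θ - ρ • θ'‖ ≤ ‖Φ θ - Φ (ρ • θ')‖ := by
  have h0 : θ₀ ≠ 0 := by intro h; simp [h] at hθ₀
  set A := fderiv ℝ Φ θ₀ with hA
  obtain ⟨K, hK, hanti⟩ := (A : E →ₗ[ℝ] G).exists_antilipschitzWith (LinearMap.ker_eq_bot.2 hinj)
  have hK' : (0:ℝ) < K := hK
  set c0 : ℝ := (K:ℝ)⁻¹ with hc0
  have hc0p : 0 < c0 := inv_pos.2 hK'
  have hlow : ∀ v, c0 * ‖v‖ ≤ ‖A v‖ := by
    intro v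
    have := hanti.le_mul_dist v 0
    simp only [map_zero, dist_zero_right] at this
    rw [hc0, inv_mul_le_iff₀ hK']; exact this
  have hstrict : HasStrictFDerivAt Φ A θ₀ :=
    (hf.contDiffAt (isOpen_ne0.mem_nhds h0)).hasStrictFDerivAt (by simp)
  have h1 := hstrict.isLittleO.def (c := c0 / 2) (by positivity)
  rw [nhds_prod_eq, Filter.eventually_prod_self_iff'] at h1
  obtain ⟨s, hs, h1⟩ := h1
  obtain ⟨δ, hδ, hball⟩ := Metric.mem_nhds_iff.1 hs
  have hnear : ∀ a ∈ Metric.ball θ₀ δ, ∀ b ∈ Metric.ball θ₀ δ, c0 / 2 * ‖a - b‖ ≤ ‖Φ a - Φ b‖ := by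
    intro a ha b hb
    have h2 := h1 a (hball ha) b (hball hb)
    have h3 := hlow (a - b)
    have h4 : ‖A (a - b)‖ ≤ ‖Φ a - Φ b - A (a - b)‖ + ‖Φ a - Φ b‖ := by
      have := norm_sub_le (Φ a - Φ b) (Φ a - Φ b - A (a - b))
      rw [sub_sub_cancel] at this
      linarith
    simp only at h2
    linarith
  have hΦ0 : Φ θ₀ ≠ 0 := by
    intro hz
    have hb : (1 + δ / 2) • θ₀ ∈ Metric.ball θ₀ δ := by
      rw [mem_ball_iff_norm, add_smul, one_smul, add_sub_cancel_left, norm_smul, hθ₀,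
        Real.norm_of_nonneg (by positivity)]
      linarith
    have := hnear _ hb θ₀ (Metric.mem_ball_self hδ)
    rw [hh _ (by positivity) _ h0, hz, smul_zero, sub_zero, norm_zero, add_smul, one_smul,
      add_sub_cancel_left, norm_smul, hθ₀, Real.norm_of_nonneg (by positivity)] at this
    have : 0 < c0 / 2 * (δ / 2 * 1) := by positivity
    linarith
  set b := ‖Φ θ₀‖ with hb
  have hbp : 0 < b := norm_pos_iff.2 hΦ0
  have hcont : ContinuousAt Φ θ₀ := hstrict.hasFDerivAt.continuousAt
  have hη := Metric.continuousAt_iff'.1 hcont (b * δ / 8) (by positivity)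
  refine ⟨_, Filter.inter_mem (Metric.ball_mem_nhds θ₀ (half_pos hδ)) hη, min (c0 / 2) (b * δ / 8), by positivity, ?_⟩
  rintro θ ⟨hθ1, hθ2⟩ θ' ⟨hθ1', hθ2'⟩ hn hn' ρ hρ hρ1
  simp only [Set.mem_ofPred_eq] at hθ2 hθ2'
  by_cases hcase : 1 - δ / 2 < ρ
  · have ha : θ ∈ Metric.ball θ₀ δ := Metric.ball_subset_ball (by linarith) hθ1
    have hb' : ρ • θ' ∈ Metric.ball θ₀ δ := by
      rw [mem_ball_iff_norm] at hθ1' ⊢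
      have : ρ • θ' - θ₀ = (θ' - θ₀) - (1 - ρ) • θ' := by rw [sub_smul, one_smul]; abel
      rw [this]
      refine (norm_sub_le _ _).trans_lt ?_
      rw [norm_smul, hn', Real.norm_of_nonneg (by linarith)]
      linarith
    refine le_trans ?_ (hnear _ ha _ hb')
    gcongr
    exact min_le_left _ _
  · push Not at hcase
    have h0' : θ' ≠ 0 := by intro h; simp [h] at hn'
    rw [hh ρ hρ θ' h0']
    have e1 : ‖θ - ρ • θ'‖ ≤ 2 := by
      refine (norm_sub_le _ _).trans ?_
      rw [norm_smul, hn, hn', Real.norm_of_nonneg hρ.le]; linarith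
    have e2 : ρ ^ (m - 1) ≤ ρ := by
      calc ρ ^ (m-1) ≤ ρ ^ (1:ℝ) := Real.rpow_le_rpow_of_exponent_ge hρ hρ1 (by linarith)
        _ = ρ := Real.rpow_one ρ
    have e3 : ‖Φ θ‖ - ‖ρ ^ (m-1) • Φ θ'‖ ≤ ‖Φ θ - ρ ^ (m-1) • Φ θ'‖ := norm_sub_norm_le _ _
    rw [norm_smul, Real.norm_of_nonneg (by positivity)] at e3
    have e4 : ρ ^ (m-1) * ‖Φ θ'‖ ≤ (1 - δ/2) * ‖Φ θ'‖ := by gcongr; linarith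
    rw [dist_eq_norm] at hθ2 hθ2'
    have e5 : ‖Φ θ₀‖ - ‖Φ θ‖ ≤ ‖Φ θ - Φ θ₀‖ := by rw [norm_sub_rev]; exact norm_sub_norm_le _ _
    have e6 : ‖Φ θ'‖ - ‖Φ θ₀‖ ≤ ‖Φ θ' - Φ θ₀‖ := norm_sub_norm_le _ _
    have e7 : (1 - δ/2) * ‖Φ θ'‖ ≤ (1 - δ/2) * (b + b * δ / 8) := by
      have : 0 ≤ 1 - δ / 2 := by linarith
      gcongr; linarith
    have e8 : min (c0 / 2) (b * δ / 8) * ‖θ - ρ • θ'‖ ≤ b * δ / 8 * 2 := by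
      gcongr; exact min_le_right _ _
    nlinarith [mul_pos hbp hδ, mul_pos (mul_pos hbp hδ) hδ]

lemma cone_est {G : Type} [NormedAddCommGroup G] [NormedSpace ℝ G] {Φ : E → G} {m : ℝ} (hm : 2 ≤ m)
    (hh : ∀ c : ℝ, 0 < c → ∀ x : E, x ≠ 0 → Φ (c • x) = c ^ (m - 1) • Φ x)
    (U : Set E) (c : ℝ)
    (hU : ∀ θ ∈ U, ∀ θ' ∈ U, ‖θ‖ = 1 → ‖θ'‖ = 1 → ∀ ρ : ℝ, 0 < ρ → ρ ≤ 1 →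
      c * ‖θ - ρ • θ'‖ ≤ ‖Φ θ - Φ (ρ • θ')‖) (ξ : G)
    (x x' : E) (hx : x ≠ 0) (hx' : x' ≠ 0) (hxU : ‖x‖⁻¹ • x ∈ U) (hxU' : ‖x'‖⁻¹ • x' ∈ U) :
    c * ‖x - x'‖ ≤ ‖Φ x - ξ‖ / ‖x‖ ^ (m - 2) + ‖Φ x' - ξ‖ / ‖x'‖ ^ (m - 2) := by
  wlog hle : ‖x'‖ ≤ ‖x‖ generalizing x x'
  · rw [norm_sub_rev, add_comm]
    exact this x' x hx' hx hxU' hxU (le_of_not_ge hle)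
  set R := ‖x‖ with hR
  have hRp : 0 < R := norm_pos_iff.2 hx
  have hRp' : 0 < ‖x'‖ := norm_pos_iff.2 hx'
  have h1 := hU _ hxU _ hxU' (by rw [norm_smul, norm_inv, norm_norm, inv_mul_cancel₀ hRp.ne'])
    (by rw [norm_smul, norm_inv, norm_norm, inv_mul_cancel₀ hRp'.ne']) (‖x'‖ / R) (by positivity)
    ((div_le_one hRp).2 hle)
  have h2 : (‖x'‖ / R) • ‖x'‖⁻¹ • x' = R⁻¹ • x' := by
    rw [smul_smul]; congr 1; field_simp
  rw [h2, ← smul_sub, norm_smul, hh _ (by positivity) _ hx, hh _ (by positivity) _ hx', ← smul_sub, norm_smul,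
    Real.norm_of_nonneg (by positivity), Real.norm_of_nonneg (by positivity), Real.inv_rpow hRp.le] at h1
  have h3 : R ^ (m - 1) = R ^ (m-2) * R := by
    rw [← Real.rpow_add_one hRp.ne']; congr 1; ring
  have hRm : 0 < R ^ (m-2) := by positivity
  rw [h3] at h1
  have h4 : c * ‖x - x'‖ ≤ ‖Φ x - Φ x'‖ / R ^ (m-2) := by
    calc c * ‖x - x'‖ = R * (c * (R⁻¹ * ‖x - x'‖)) := by field_simp
      _ ≤ R * ((R ^ (m - 2) * R)⁻¹ * ‖Φ x - Φ x'‖) := by gcongr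
      _ = _ := by field_simp
  refine h4.trans ?_
  have h5 : ‖Φ x - Φ x'‖ ≤ ‖Φ x - ξ‖ + ‖Φ x' - ξ‖ := by
    rw [norm_sub_rev (Φ x') ξ]; exact norm_sub_le_norm_sub_add_norm_sub _ _ _
  calc _ ≤ (‖Φ x - ξ‖ + ‖Φ x' - ξ‖) / R ^ (m-2) := by gcongr
    _ = ‖Φ x - ξ‖ / R ^ (m-2) + ‖Φ x' - ξ‖ / R ^ (m-2) := by ring
    _ ≤ _ := by
      gcongr

lemma geo {G : Type} [NormedAddCommGroup G] [NormedSpace ℝ G] {Φ : E → G} {m : ℝ} (hm : 2 ≤ m)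
    (hf : ContDiffOn ℝ ∞ Φ {x | x ≠ 0})
    (hh : ∀ c : ℝ, 0 < c → ∀ x : E, x ≠ 0 → Φ (c • x) = c ^ (m - 1) • Φ x)
    (hinj : ∀ x : E, ‖x‖ = 1 → Function.Injective (fderiv ℝ Φ x)) (N : ℕ) :
    ∃ (t : Finset E) (K : E → ℝ), (∀ j, 0 ≤ K j) ∧ ∀ ξ : G, ∃ X : E → E, ∀ x : E, 2 ≤ ‖x‖ →
      ((1 + ‖Φ x - ξ‖ / ‖x‖ ^ (m - 2)) ^ N)⁻¹ ≤ ∑ j ∈ t, K j * ((1 + ‖x - X j‖) ^ N)⁻¹ := by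
  have hloc : ∀ θ₀ : E, ∃ U : Set E, ∃ c : ℝ, 0 < c ∧ (‖θ₀‖ = 1 → U ∈ nhds θ₀) ∧ 
      ∀ θ ∈ U, ∀ θ' ∈ U, ‖θ‖ = 1 → ‖θ'‖ = 1 → ∀ ρ : ℝ, 0 < ρ → ρ ≤ 1 →
      c * ‖θ - ρ • θ'‖ ≤ ‖Φ θ - Φ (ρ • θ')‖ := by
    intro θ₀
    by_cases h : ‖θ₀‖ = 1
    · obtain ⟨U, hU, c, hc, h'⟩ := local_antilip hm hf hh θ₀ h (hinj θ₀ h)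
      exact ⟨U, c, hc, fun _ => hU, h'⟩
    · exact ⟨∅, 1, one_pos, fun h' => absurd h' h, by simp⟩
  choose U c hc hU hUc using hloc
  obtain ⟨t, -, ht⟩ := (isCompact_sphere (0:E) 1).elim_nhds_subcover U (fun x hx => hU x (by simpa using hx))
  refine ⟨t, fun j => (1 + 2 / c j) ^ N, fun j => by have := hc j; positivity, ?_⟩
  intro ξ
  set q : E → ℝ := fun x => ‖Φ x - ξ‖ / ‖x‖ ^ (m - 2) with hq
  have hq0 : ∀ x, 0 ≤ q x := fun x => by positivity
  have hX : ∀ j : E, ∃ X : E, ∀ x : E, 2 ≤ ‖x‖ → ‖x‖⁻¹ • x ∈ U j → c j * ‖x - X‖ ≤ 2 * q x + 1 := by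
    intro j
    set S := {x : E | 2 ≤ ‖x‖ ∧ ‖x‖⁻¹ • x ∈ U j} with hS
    by_cases hne : S.Nonempty
    · have hne' : (q '' S).Nonempty := hne.image q
      have hbdd : BddBelow (q '' S) := ⟨0, by rintro _ ⟨x, -, rfl⟩; exact hq0 x⟩
      obtain ⟨_, ⟨X, hXS, rfl⟩, hlt⟩ := exists_lt_of_csInf_lt hne' (lt_add_one (sInf (q '' S)))
      refine ⟨X, fun x hx hxU => ?_⟩
      have h1 : sInf (q '' S) ≤ q x := csInf_le hbdd ⟨x, ⟨hx, hxU⟩, rfl⟩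
      have hx0 : x ≠ 0 := by intro h; simp [h] at hx; linarith
      have hX0 : X ≠ 0 := by intro h; have := hXS.1; simp [h] at this; linarith
      have := cone_est hm hh (U j) (c j) (hUc j) ξ x X hx0 hX0 hxU hXS.2
      change _ ≤ q x + q X at this
      linarith
    · refine ⟨0, fun x hx hxU => ?_⟩
      exact absurd ⟨x, hx, hxU⟩ hne
  choose X hX using hX
  refine ⟨X, fun x hx => ?_⟩
  have hn : 0 < ‖x‖ := by linarith
  have hmem : ‖x‖⁻¹ • x ∈ Metric.sphere (0:E) 1 := by
    simp [norm_smul, hn.ne']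
  obtain ⟨j, hj, hxj⟩ := Set.mem_iUnion₂.1 (ht hmem)
  have h1 := hX j x hx hxj
  have hcj := hc j
  have h2 : 1 + ‖x - X j‖ ≤ (1 + 2 / c j) * (1 + q x) := by
    have : ‖x - X j‖ ≤ (2 * q x + 1) / c j := by rw [le_div_iff₀ hcj]; linarith
    have h3 : (1 + 2 / c j) * (1 + q x) = 1 + q x + (2 * q x + 1) / c j + 1 / c j := by field_simp; ring
    have := hq0 x
    have : 0 < 1 / c j := by positivity
    linarith
  have hterm : ((1 + q x) ^ N)⁻¹ ≤ (1 + 2 / c j) ^ N * ((1 + ‖x - X j‖) ^ N)⁻¹ := by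
    have hq1 : 0 < 1 + q x := by have := hq0 x; linarith
    rw [← div_eq_mul_inv, le_div_iff₀ (by positivity), inv_mul_le_iff₀ (by positivity), mul_comm, ← mul_pow]
    gcongr
  refine hterm.trans ?_
  exact Finset.single_le_sum (f := fun j => (1 + 2 / c j) ^ N * ((1 + ‖x - X j‖) ^ N)⁻¹)
    (fun i _ => by have := hc i; positivity) hj

end Fresnel

namespace Fresnel
open scoped FourierTransform ContDiff Nat
open Module

variable {E : Type} [NormedAddCommGroup E] [InnerProductSpace ℝ E] [FiniteDimensional ℝ E]
  [MeasurableSpace E] [BorelSpace E]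

lemma iteratedDeriv_ee (k : ℕ) : iteratedDeriv k ee = fun x => ((2 * Real.pi : ℝ) * Complex.I) ^ k * ee x := by
  induction k with
  | zero => ext x; simp
  | succ k ih =>
    rw [iteratedDeriv_succ, ih]
    ext x
    have h : HasDerivAt ee (((2 * Real.pi : ℝ) * Complex.I) * ee x) x := by
      unfold ee
      have h1 : HasDerivAt (fun x : ℝ => (((2 * Real.pi * x : ℝ) : ℂ)) * Complex.I) (((2 * Real.pi : ℝ) : ℂ) * Complex.I) x := by
        have h2 : HasDerivAt (fun x : ℝ => 2 * Real.pi * x) (2 * Real.pi) x := by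
          simpa using (hasDerivAt_id x).const_mul (2 * Real.pi)
        exact h2.ofReal_comp.mul_const _
      rw [mul_comm (((2 * Real.pi : ℝ) : ℂ) * Complex.I)]
      exact h1.cexp
    rw [(h.const_mul _).deriv, pow_succ]; ring

lemma norm_iteratedFDeriv_ee (k : ℕ) (x : ℝ) : ‖iteratedFDeriv ℝ k ee x‖ = (2 * Real.pi) ^ k := by
  rw [norm_iteratedFDeriv_eq_norm_iteratedDeriv, iteratedDeriv_ee, norm_mul, norm_ee, mul_one, norm_pow, norm_mul,
    Complex.norm_real, Complex.norm_I, mul_one, Real.norm_of_nonneg (by positivity)]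

lemma exists_ext {μ : E → ℝ} (hf : ContDiffOn ℝ ∞ μ {x | x ≠ 0}) :
    ∃ ν : E → ℝ, ContDiff ℝ ∞ ν ∧ ∀ y : E, 1 / 2 < ‖y‖ → ν y = μ y := by
  let b : ContDiffBump (0:E) := ⟨1/4, 1/2, by norm_num, by norm_num⟩
  refine ⟨fun y => (1 - b y) * μ y, ?_, ?_⟩
  · rw [contDiff_iff_contDiffAt]
    intro y
    by_cases hy : y = 0
    · subst hy
      refine (contDiffAt_const (c := (0:ℝ))).congr_of_eventuallyEq ?_
      filter_upwards [b.eventuallyEq_one] with z hz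
      rw [hz]; simp
    · exact (contDiffAt_const.sub b.contDiff.contDiffAt).mul (hf.contDiffAt (isOpen_ne0.mem_nhds hy))
  · intro y hy
    have : b y = 0 := b.zero_of_le_dist (by rw [dist_zero_right]; exact hy.le)
    simp [this]

/-- Taylor remainder of order one -/
def rem (ν : E → ℝ) (x y : E) : ℝ := ν (x + y) - ν x - fderiv ℝ ν x y

lemma contDiff_rem {ν : E → ℝ} (hν : ContDiff ℝ ∞ ν) (x : E) : ContDiff ℝ ∞ (rem ν x) := by
  unfold rem
  exact ((hν.comp (contDiff_const.add contDiff_id)).sub contDiff_const).sub (fderiv ℝ ν x).contDiff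

lemma fderiv_rem {ν : E → ℝ} (hν : ContDiff ℝ ∞ ν) (x : E) :
    fderiv ℝ (rem ν x) = fun y => fderiv ℝ ν (x + y) - fderiv ℝ ν x := by
  ext1 y
  have h1 : HasFDerivAt (fun y => ν (x + y)) (fderiv ℝ ν (x + y)) y := by
    have := ((hν.differentiable (by simp)) (x + y)).hasFDerivAt
    have h2 : HasFDerivAt (fun y => x + y) (ContinuousLinearMap.id ℝ E) y := (hasFDerivAt_id y).const_add x
    have h3 := this.comp y h2
    rw [ContinuousLinearMap.comp_id] at h3
    exact h3
  exact ((h1.sub_const (ν x)).sub (fderiv ℝ ν x).hasFDerivAt).fderiv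

lemma ext_bound {μ ν : E → ℝ} {m : ℝ} (hm : 2 ≤ m) (hf : ContDiffOn ℝ ∞ μ {x | x ≠ 0})
    (hh : ∀ c : ℝ, 0 < c → ∀ x : E, x ≠ 0 → μ (c • x) = c ^ m • μ x)
    (hνμ : ∀ y : E, 1 / 2 < ‖y‖ → ν y = μ y) (k : ℕ) (hk : 2 ≤ k) :
    ∃ C : ℝ, 0 ≤ C ∧ ∀ x y : E, 2 ≤ ‖x‖ → ‖y‖ ≤ 1 →
      ‖iteratedFDeriv ℝ k ν (x + y)‖ ≤ C * ‖x‖ ^ (m - 2) := by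
  obtain ⟨C, hC, h⟩ := hom_bound k hf hh
  refine ⟨C * 2 ^ (m - 2), by positivity, ?_⟩
  intro x y hx hy
  have h1 : 1 ≤ ‖x + y‖ := by
    have := norm_sub_le (x + y) y
    rw [add_sub_cancel_right] at this; linarith
  have h2 : ‖x + y‖ ≤ 2 * ‖x‖ := (norm_add_le _ _).trans (by linarith)
  have h0 : x + y ≠ 0 := by intro h; simp [h] at h1; linarith
  have he : ν =ᶠ[nhds (x + y)] μ := by
    have : {z : E | 1 / 2 < ‖z‖} ∈ nhds (x + y) :=
      (isOpen_lt continuous_const continuous_norm).mem_nhds (by simp only [Set.mem_ofPred_eq]; linarith)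
    filter_upwards [this] with z hz using hνμ z hz
  rw [(he.iteratedFDeriv ℝ k).eq_of_nhds]
  refine (h _ h0).trans ?_
  rw [mul_assoc, ← Real.mul_rpow (by norm_num) (norm_nonneg _)]
  gcongr
  calc ‖x + y‖ ^ (m - k) ≤ ‖x + y‖ ^ (m - 2) := Real.rpow_le_rpow_of_exponent_le h1 (by
        have : (2:ℝ) ≤ k := by exact_mod_cast hk
        linarith)
    _ ≤ _ := by gcongr

lemma rem_bound {μ ν : E → ℝ} {m : ℝ} (hm : 2 ≤ m) (hf : ContDiffOn ℝ ∞ μ {x | x ≠ 0})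
    (hh : ∀ c : ℝ, 0 < c → ∀ x : E, x ≠ 0 → μ (c • x) = c ^ m • μ x)
    (hν : ContDiff ℝ ∞ ν)
    (hνμ : ∀ y : E, 1 / 2 < ‖y‖ → ν y = μ y) (k : ℕ) (hk : 1 ≤ k) :
    ∃ C : ℝ, 0 ≤ C ∧ ∀ x y : E, 2 ≤ ‖x‖ → ‖y‖ ≤ 1 →
      ‖iteratedFDeriv ℝ k (rem ν x) y‖ ≤ C * ‖x‖ ^ (m - 2) := by
  obtain ⟨j, rfl⟩ : ∃ j, k = j + 1 := ⟨k - 1, by omega⟩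
  rcases j with _ | j
  · obtain ⟨C, hC, h⟩ := ext_bound hm hf hh hνμ 2 le_rfl
    refine ⟨C, hC, fun x y hx hy => ?_⟩
    rw [zero_add, norm_iteratedFDeriv_one, fderiv_rem hν]
    have hd : ContDiff ℝ ∞ (fderiv ℝ ν) := hν.fderiv_right (by simp)
    have := (convex_closedBall x 1).norm_image_sub_le_of_norm_fderiv_le (𝕜 := ℝ) (f := fderiv ℝ ν)
      (C := C * ‖x‖ ^ (m - 2)) (x := x) (y := x + y)
      (fun z _ => hd.differentiable (by simp) z)
      (fun z hz => by
        have := h x (z - x) hx (mem_closedBall_iff_norm.1 hz)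
        rw [add_sub_cancel] at this
        rwa [← norm_iteratedFDeriv_fderiv, norm_iteratedFDeriv_one] at this)
      (by simp) (by simpa using hy)
    refine this.trans ?_
    rw [add_sub_cancel_left]
    have : 0 ≤ C * ‖x‖ ^ (m - 2) := by positivity
    nlinarith
  · obtain ⟨C, hC, h⟩ := ext_bound hm hf hh hνμ (j + 2) (by omega)
    refine ⟨C, hC, fun x y hx hy => ?_⟩
    refine le_trans (le_of_eq ?_) (h x y hx hy)
    have hd : ContDiff ℝ ∞ (fderiv ℝ ν) := hν.fderiv_right (by simp)
    have e : fderiv ℝ (fderiv ℝ (rem ν x)) = fun y => fderiv ℝ (fderiv ℝ ν) (x + y) := by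
      rw [fderiv_rem hν]
      ext1 y
      rw [fderiv_sub_const]
      exact fderiv_comp_add_left x
    rw [← norm_iteratedFDeriv_fderiv, ← norm_iteratedFDeriv_fderiv, e, iteratedFDeriv_comp_add_left,
      norm_iteratedFDeriv_fderiv, norm_iteratedFDeriv_fderiv]

lemma chi_bound {χ : E → ℂ} (hχ : ContDiff ℝ ∞ χ) (hs : tsupport χ ⊆ Metric.closedBall 0 1) (n : ℕ) :
    ∃ C : ℝ, 0 ≤ C ∧ ∀ k ≤ n, ∀ y, ‖iteratedFDeriv ℝ k χ y‖ ≤ C := by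
  have hcs : HasCompactSupport χ :=
    HasCompactSupport.of_support_subset_isCompact (isCompact_closedBall (0:E) 1)
      ((subset_tsupport χ).trans hs)
  have : ∀ k : ℕ, ∃ C : ℝ, ∀ y, ‖iteratedFDeriv ℝ k χ y‖ ≤ C := fun k =>
    (hcs.iteratedFDeriv k).exists_bound_of_continuous (hχ.continuous_iteratedFDeriv (by exact_mod_cast le_top))
  choose C hC using this
  have hC0 : ∀ k, 0 ≤ C k := fun k => (norm_nonneg _).trans (hC k 0)
  refine ⟨∑ k ∈ Finset.range (n+1), C k, Finset.sum_nonneg fun i _ => hC0 i, fun k hk y => ?_⟩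
  refine (hC k y).trans ?_
  exact Finset.single_le_sum (fun i _ => hC0 i) (Finset.mem_range.2 (by omega))

lemma mod_bound {μ ν : E → ℝ} {m : ℝ} (hm : 2 ≤ m) (hf : ContDiffOn ℝ ∞ μ {x | x ≠ 0})
    (hh : ∀ c : ℝ, 0 < c → ∀ x : E, x ≠ 0 → μ (c • x) = c ^ m • μ x)
    (hν : ContDiff ℝ ∞ ν)
    (hνμ : ∀ y : E, 1 / 2 < ‖y‖ → ν y = μ y)
    {χ : E → ℂ} (hχ : ContDiff ℝ ∞ χ) (hs : tsupport χ ⊆ Metric.closedBall 0 1) (n : ℕ) :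
    ∃ B : ℝ, 0 ≤ B ∧ ∀ k ≤ n, ∀ x y : E, 2 ≤ ‖x‖ → ‖y‖ ≤ 1 →
      ‖iteratedFDeriv ℝ k (fun y => ee (rem ν x y) * χ y) y‖ ≤ B * (‖x‖ ^ (m - 2)) ^ k := by
  obtain ⟨Cχ, hCχ, hχb⟩ := chi_bound hχ hs n
  have hr : ∀ k : ℕ, ∃ C : ℝ, 0 ≤ C ∧ (1 ≤ k → ∀ x y : E, 2 ≤ ‖x‖ → ‖y‖ ≤ 1 →
      ‖iteratedFDeriv ℝ k (rem ν x) y‖ ≤ C * ‖x‖ ^ (m - 2)) := by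
    intro k
    by_cases hk : 1 ≤ k
    · obtain ⟨C, hC, h⟩ := rem_bound hm hf hh hν hνμ k hk
      exact ⟨C, hC, fun _ => h⟩
    · exact ⟨0, le_rfl, fun h => absurd h hk⟩
  choose C hC0 hC using hr
  set D : ℝ := 1 + ∑ k ∈ Finset.range (n+1), C k with hD
  have hD1 : 1 ≤ D := by
    have := Finset.sum_nonneg (s := Finset.range (n+1)) fun i _ => hC0 i
    linarith
  set P : ℝ := (1 + 2 * Real.pi) ^ n with hP
  have hP0 : 0 ≤ P := by positivity
  refine ⟨∑ k ∈ Finset.range (n+1), ∑ i ∈ Finset.range (k+1), (k.choose i : ℝ) * (i ! * P * D ^ i) * Cχ, by positivity, ?_⟩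
  intro k hk x y hx hy
  set H := ‖x‖ ^ (m - 2) with hH
  have hH1 : 1 ≤ H := Real.one_le_rpow (by linarith) (by linarith)
  have hcr := contDiff_rem hν x
  have hbase : ∀ i ≤ n, ‖iteratedFDeriv ℝ i (fun y => ee (rem ν x y)) y‖ ≤ i ! * P * (D * H) ^ i := by
    intro i hi
    apply norm_iteratedFDeriv_comp_le (N := ∞) contDiff_ee hcr (by exact_mod_cast le_top) y
    · intro l hl
      rw [norm_iteratedFDeriv_ee]
      calc (2 * Real.pi) ^ l ≤ (1 + 2 * Real.pi) ^ l := by gcongr; linarith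
        _ ≤ _ := by
          apply pow_le_pow_right₀ _ (hl.trans hi)
          have := Real.pi_pos; linarith
    · intro l hl hl'
      refine (hC l hl x y hx hy).trans ?_
      have h1 : C l ≤ D := by
        have := Finset.single_le_sum (f := C) (fun i _ => hC0 i) (Finset.mem_range.2 (show l < n + 1 by omega))
        linarith
      calc C l * H ≤ D * H := by gcongr
        _ ≤ (D * H) ^ l := le_self_pow₀ (one_le_mul_of_one_le_of_one_le hD1 hH1) (by omega)
  refine (norm_iteratedFDeriv_mul_le (N := ∞) (contDiff_ee.comp hcr) hχ y (by exact_mod_cast le_top)).trans ?_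
  calc _ ≤ ∑ i ∈ Finset.range (k+1), (k.choose i : ℝ) * (i ! * P * D ^ i) * Cχ * H ^ k := by
        apply Finset.sum_le_sum
        intro i hi
        have hik : i ≤ k := by have := Finset.mem_range.1 hi; omega
        calc _ ≤ (k.choose i : ℝ) * (i ! * P * (D * H) ^ i) * Cχ := by
              gcongr
              · exact hbase i (hik.trans hk)
              · exact hχb _ (by omega) _
          _ = (k.choose i : ℝ) * (i ! * P * D ^ i) * Cχ * H ^ i := by rw [mul_pow]; ring
          _ ≤ _ := by gcongr
    _ = (∑ i ∈ Finset.range (k+1), (k.choose i : ℝ) * (i ! * P * D ^ i) * Cχ) * H ^ k := by rw [Finset.sum_mul]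
    _ ≤ _ := by
      gcongr
      exact Finset.single_le_sum (f := fun k => ∑ i ∈ Finset.range (k+1), (k.choose i : ℝ) * (i ! * P * D ^ i) * Cχ)
        (fun i _ => by positivity) (Finset.mem_range.2 (by omega))

end Fresnel

namespace Fresnel
open scoped FourierTransform ContDiff Nat
open Module

variable {E : Type} [NormedAddCommGroup E] [InnerProductSpace ℝ E] [FiniteDimensional ℝ E]
  [MeasurableSpace E] [BorelSpace E]

lemma VV_trivial {F χ : E → ℂ} (hF1 : ∀ y, ‖F y‖ = 1) (x ξ : E) :
    ‖VV F χ x ξ‖ ≤ ∫ y, ‖χ y‖ := by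
  unfold VV
  refine (norm_integral_le_integral_norm _).trans (le_of_eq ?_)
  rw [← integral_sub_right_eq_self (fun y => ‖χ y‖) x]
  congr 1; ext y
  rw [norm_mul, norm_mul, norm_ee, hF1, one_mul, one_mul]

lemma VV_eq_fourier {μ ν : E → ℝ} {F : E → ℂ} (hFμ : ∀ y, y ≠ 0 → F y = ee (μ y))
    (hνμ : ∀ y : E, 1 / 2 < ‖y‖ → ν y = μ y)
    {χ : E → ℂ} (hs : tsupport χ ⊆ Metric.closedBall 0 1) (x ξ : E) (hx : 2 ≤ ‖x‖) :
    ‖VV F χ x ξ‖ = ‖𝓕 (fun y => ee (rem ν x y) * χ y)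
      ((InnerProductSpace.toDual ℝ E).symm (InnerProductSpace.toDual ℝ E ξ - fderiv ℝ ν x))‖ := by
  rw [fourier_eq]
  have h : VV F χ x ξ = ee (ν x - ⟪ξ, x⟫) * ∫ z, ee (-⟪z, (InnerProductSpace.toDual ℝ E).symm (InnerProductSpace.toDual ℝ E ξ - fderiv ℝ ν x)⟫) * (ee (rem ν x z) * χ z) := by
    unfold VV
    rw [← integral_add_right_eq_self _ x, ← integral_const_mul]
    congr 1; ext z
    rw [add_sub_cancel_right]
    by_cases hz : χ z = 0
    · simp [hz]
    have hz1 : ‖z‖ ≤ 1 := by simpa using hs (subset_tsupport χ hz)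
    have h1 : 1 ≤ ‖z + x‖ := by
      have := norm_sub_le (z + x) z
      rw [add_sub_cancel_left] at this; linarith
    have h0 : z + x ≠ 0 := by intro h; simp [h] at h1; linarith
    rw [hFμ _ h0, ← hνμ _ (by linarith), real_inner_comm ((InnerProductSpace.toDual ℝ E).symm _) z, InnerProductSpace.toDual_symm_apply,
      ← ee_add, ← mul_assoc, ← mul_assoc, ← ee_add, ← ee_add]
    congr 2
    unfold rem
    rw [sub_apply, InnerProductSpace.toDual_apply_apply, inner_add_right, add_comm z x]
    ring
  rw [h, norm_mul, norm_ee, one_mul]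

lemma base_bound {μ : E → ℝ} {m : ℝ} (hm : 2 ≤ m) (hf : ContDiffOn ℝ ∞ μ {x | x ≠ 0})
    (hh : ∀ c : ℝ, 0 < c → ∀ x : E, x ≠ 0 → μ (c • x) = c ^ m • μ x)
    (hinj : ∀ x : E, ‖x‖ = 1 → Function.Injective (fderiv ℝ (fderiv ℝ μ) x))
    {F : E → ℂ} (hF1 : ∀ y, ‖F y‖ = 1) (hFμ : ∀ y, y ≠ 0 → F y = ee (μ y))
    {χ : E → ℂ} (hχ : ContDiff ℝ ∞ χ) (hs : tsupport χ ⊆ Metric.closedBall 0 1) :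
    ∃ M : ℝ≥0∞, M ≠ ⊤ ∧ ∀ ξ, ∫⁻ x, ‖VV F χ x ξ‖ₑ ≤ M := by
  set N := finrank ℝ E + 1 with hN
  obtain ⟨ν, hν, hνμ⟩ := exists_ext hf
  obtain ⟨B, hB, hmod⟩ := mod_bound hm hf hh hν hνμ hχ hs N
  obtain ⟨C, hC, hft⟩ := ft_decay (E := E) N
  obtain ⟨hf1, hh1⟩ := hom_fderiv hf hh
  obtain ⟨t, K, hK, hgeo⟩ := geo hm hf1 hh1 hinj N
  have hJ : Integrable (fun x : E => ((1 + ‖x‖) ^ N)⁻¹) := by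
    have := integrable_one_add_norm (E := E) (μ := volume) (r := N) (by rw [hN]; push_cast; linarith)
    refine this.congr (Filter.Eventually.of_forall fun x => ?_)
    simp only
    rw [Real.rpow_neg (by positivity), Real.rpow_natCast]
  set J := ∫⁻ x : E, ENNReal.ofReal (((1 + ‖x‖) ^ N)⁻¹) with hJdef
  have hJtop : J ≠ ⊤ := by
    have := hJ.lintegral_lt_top
    exact this.ne
  refine ⟨ENNReal.ofReal (∫ y, ‖χ y‖) * volume (Metric.closedBall (0:E) 2) +
    ∑ j ∈ t, ENNReal.ofReal (C * B * K j) * J, ?_, ?_⟩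
  · refine ENNReal.add_ne_top.2 ⟨ENNReal.mul_ne_top ENNReal.ofReal_ne_top measure_closedBall_lt_top.ne, ?_⟩
    exact ENNReal.sum_ne_top.2 fun j _ => ENNReal.mul_ne_top ENNReal.ofReal_ne_top hJtop
  intro ξ
  obtain ⟨X, hX⟩ := hgeo (InnerProductSpace.toDual ℝ E ξ)
  have hpt : ∀ x, ‖VV F χ x ξ‖ₑ ≤ (Metric.closedBall (0:E) 2).indicator (fun _ => ENNReal.ofReal (∫ y, ‖χ y‖)) x +
      ∑ j ∈ t, ENNReal.ofReal (C * B * K j) * ENNReal.ofReal (((1 + ‖x - X j‖) ^ N)⁻¹) := by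
    intro x
    by_cases hx : x ∈ Metric.closedBall (0:E) 2
    · rw [Set.indicator_of_mem hx]
      refine le_trans ?_ le_self_add
      rw [← ofReal_norm]
      exact ENNReal.ofReal_le_ofReal (VV_trivial hF1 x ξ)
    · refine le_trans ?_ le_add_self
      have hx2 : 2 ≤ ‖x‖ := by
        rw [mem_closedBall_zero_iff] at hx; linarith
      have hH1 : 1 ≤ ‖x‖ ^ (m - 2) := Real.one_le_rpow (by linarith) (by linarith)
      have hmd : fderiv ℝ ν x = fderiv ℝ μ x := by
        apply Filter.EventuallyEq.fderiv_eq
        have : {z : E | 1 / 2 < ‖z‖} ∈ nhds x :=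
          (isOpen_lt continuous_const continuous_norm).mem_nhds (by simp only [Set.mem_ofPred_eq]; linarith)
        filter_upwards [this] with z hz using hνμ z hz
      have h1 := hft (fun y => ee (rem ν x y) * χ y) B (‖x‖ ^ (m - 2)) hH1
        ((contDiff_ee.comp (contDiff_rem hν x)).mul hχ)
        ((closure_mono (Function.support_mul_subset_right _ _)).trans hs)
        (fun k hk y hy => hmod k hk x y hx2 hy)
        ((InnerProductSpace.toDual ℝ E).symm (InnerProductSpace.toDual ℝ E ξ - fderiv ℝ ν x))
      rw [← VV_eq_fourier hFμ hνμ hs x ξ hx2, LinearIsometryEquiv.norm_map, norm_sub_rev, hmd] at h1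
      have h2 := hX x hx2
      have h3 : ‖VV F χ x ξ‖ ≤ ∑ j ∈ t, C * B * K j * ((1 + ‖x - X j‖) ^ N)⁻¹ := by
        rw [← le_div_iff₀' (by positivity), div_eq_mul_inv] at h1
        refine h1.trans ?_
        calc _ ≤ C * B * ∑ j ∈ t, K j * ((1 + ‖x - X j‖) ^ N)⁻¹ := by gcongr
          _ = _ := by rw [Finset.mul_sum]; congr 1; ext j; ring
      rw [← ofReal_norm]
      refine (ENNReal.ofReal_le_ofReal h3).trans ?_
      rw [ENNReal.ofReal_sum_of_nonneg]
      · refine le_of_eq (Finset.sum_congr rfl fun j _ => ?_)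
        rw [ENNReal.ofReal_mul]
        have := hK j
        positivity
      · intro j _
        have := hK j
        positivity
  refine (lintegral_mono hpt).trans ?_
  rw [lintegral_add_left (measurable_const.indicator Metric.isClosed_closedBall.measurableSet)]
  rw [lintegral_indicator Metric.isClosed_closedBall.measurableSet, setLIntegral_const]
  gcongr
  rw [lintegral_finsetSum]
  · refine Finset.sum_le_sum fun j _ => ?_
    rw [lintegral_const_mul' _ _ ENNReal.ofReal_ne_top]
    gcongr
    exact le_of_eq (lintegral_sub_right_eq_self (fun x => ENNReal.ofReal (((1 + ‖x‖) ^ N)⁻¹)) (X j))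
  · intro j _
    fun_prop

end Fresnel

namespace Fresnel
open scoped FourierTransform ContDiff Nat
open Module

variable {E : Type} [NormedAddCommGroup E] [InnerProductSpace ℝ E] [FiniteDimensional ℝ E]
  [MeasurableSpace E] [BorelSpace E]

lemma hasCompactSupport_of {f : E → ℂ} (hs : tsupport f ⊆ Metric.closedBall 0 1) : HasCompactSupport f :=
  HasCompactSupport.of_support_subset_isCompact (isCompact_closedBall (0:E) 1)
      ((subset_tsupport f).trans hs)

lemma inv_repr {f : E → ℂ} (hf : ContDiff ℝ ∞ f) (hs : tsupport f ⊆ Metric.closedBall 0 1) :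
    Integrable (𝓕 f) ∧ ∀ z, f z = ∫ ζ, 𝓕 f ζ * ee ⟪ζ, z⟫ := by
  set S := (hasCompactSupport_of hs).toSchwartzMap hf with hS
  have hc : (S : E → ℂ) = f := rfl
  have h1 : Integrable (𝓕 f) := by
    have := (𝓕 S).integrable (μ := volume)
    rwa [SchwartzMap.fourier_coe, hc] at this
  refine ⟨h1, fun z => ?_⟩
  have h2 := hf.continuous.fourierInv_fourier_eq (hc ▸ S.integrable) h1
  conv_lhs => rw [← h2]
  rw [fourierInv_eq]
  congr 1; ext v; ring

lemma repr_schwartz {χ : E → ℂ} (hχ : ContDiff ℝ ∞ χ) (hs : tsupport χ ⊆ Metric.closedBall 0 1)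
    (ha : ∫ z, χ z * χ z ≠ 0) (g : SchwartzMap E ℂ) :
    ∃ κ : E × E → ℂ, Integrable κ ∧ ∀ z, g z = ∫ q, κ q * ee ⟪q.2, z⟫ * χ (z - q.1) := by
  set a := ∫ z, χ z * χ z with hadef
  set N := finrank ℝ E + 1 with hN
  obtain ⟨C, hC, hft⟩ := ft_decay (E := E) N
  obtain ⟨Cχ, hCχ, hχb⟩ := chi_bound hχ hs N
  set f : E → E → ℂ := fun u z => g (z + u) * χ z with hfdef
  have hf : ∀ u, ContDiff ℝ ∞ (f u) := fun u =>
    ((g.smooth ⊤).comp (contDiff_id.add contDiff_const)).mul hχ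
  have hfs : ∀ u, tsupport (f u) ⊆ Metric.closedBall 0 1 := fun u =>
    (closure_mono (Function.support_mul_subset_right _ _)).trans hs
  set S : ℝ := 2 ^ N * (Finset.Iic (N, N)).sup (fun m => SchwartzMap.seminorm ℝ m.1 m.2) g with hS
  have hS0 : 0 ≤ S := by positivity
  have hgb : ∀ i ≤ N, ∀ x, (1 + ‖x‖) ^ N * ‖iteratedFDeriv ℝ i g x‖ ≤ S := fun i hi x =>
    SchwartzMap.one_add_le_sup_seminorm_apply (𝕜 := ℝ) (m := (N, N)) le_rfl hi g x
  set B0 : ℝ := ∑ k ∈ Finset.range (N+1), ∑ i ∈ Finset.range (k+1), (k.choose i : ℝ) * (2 ^ N * S) * Cχ with hB0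
  have hB00 : 0 ≤ B0 := by positivity
  have hfb : ∀ u, ∀ k ≤ N, ∀ y, ‖y‖ ≤ 1 → ‖iteratedFDeriv ℝ k (f u) y‖ ≤ B0 * ((1 + ‖u‖) ^ N)⁻¹ * 1 ^ k := by
    intro u k hk y hy
    refine (norm_iteratedFDeriv_mul_le (N := ∞) ((g.smooth ⊤).comp (contDiff_id.add contDiff_const)) hχ y (by exact_mod_cast le_top)).trans ?_
    have hu : 1 + ‖u‖ ≤ 2 * (1 + ‖y + u‖) := by
      have := norm_sub_le (y + u) y
      rw [add_sub_cancel_left] at this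
      linarith [norm_nonneg (y + u)]
    have hi : ∀ i ≤ N, ‖iteratedFDeriv ℝ i (fun z => g (z + u)) y‖ ≤ 2 ^ N * S * ((1 + ‖u‖) ^ N)⁻¹ := by
      intro i hi
      rw [iteratedFDeriv_comp_add_right]
      rw [← div_eq_mul_inv, le_div_iff₀ (by positivity)]
      calc _ ≤ ‖iteratedFDeriv ℝ i g (y + u)‖ * (2 * (1 + ‖y + u‖)) ^ N := by gcongr
        _ = 2 ^ N * ((1 + ‖y + u‖) ^ N * ‖iteratedFDeriv ℝ i g (y + u)‖) := by rw [mul_pow]; ring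
        _ ≤ _ := by gcongr; exact hgb i hi _
    calc _ ≤ ∑ i ∈ Finset.range (k+1), (k.choose i : ℝ) * (2 ^ N * S * ((1 + ‖u‖) ^ N)⁻¹) * Cχ := by
          apply Finset.sum_le_sum
          intro i hi'
          have hik : i ≤ k := by have := Finset.mem_range.1 hi'; omega
          gcongr
          · exact hi i (hik.trans hk)
          · exact hχb _ (by omega) _
      _ = (∑ i ∈ Finset.range (k+1), (k.choose i : ℝ) * (2 ^ N * S) * Cχ) * ((1 + ‖u‖) ^ N)⁻¹ := by
          rw [Finset.sum_mul]; congr 1; ext i; ring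
      _ ≤ _ := by
        rw [one_pow, mul_one]
        gcongr
        exact Finset.single_le_sum (f := fun k => ∑ i ∈ Finset.range (k+1), (k.choose i : ℝ) * (2 ^ N * S) * Cχ)
          (fun i _ => by positivity) (Finset.mem_range.2 (by omega))
  have hFb : ∀ u ζ, ‖𝓕 (f u) ζ‖ ≤ C * B0 * (((1 + ‖u‖) ^ N)⁻¹ * ((1 + ‖ζ‖) ^ N)⁻¹) := by
    intro u ζ
    have := hft (f u) _ 1 le_rfl (hf u) (hfs u) (hfb u) ζ
    rw [div_one, ← le_div_iff₀' (by positivity)] at this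
    refine this.trans (le_of_eq ?_)
    rw [div_eq_mul_inv]; ring
  have hJ : Integrable (fun x : E => ((1 + ‖x‖) ^ N)⁻¹) := by
    have := integrable_one_add_norm (E := E) (μ := volume) (r := N) (by rw [hN]; push_cast; linarith)
    refine this.congr (Filter.Eventually.of_forall fun x => ?_)
    simp only
    rw [Real.rpow_neg (by positivity), Real.rpow_natCast]
  have hmeas : Measurable (fun q : E × E => 𝓕 (f q.1) q.2) := by
    simp only [fourier_eq]
    have : StronglyMeasurable (fun r : (E × E) × E => ee (-⟪r.2, r.1.2⟫) * f r.1.1 r.2) := by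
      apply Continuous.stronglyMeasurable
      have h1 := g.continuous
      have h2 := hχ.continuous
      have h3 := continuous_ee
      simp only [hfdef]
      fun_prop
    exact this.integral_prod_right.measurable
  have heem : Measurable (fun q : E × E => ee (-⟪q.1, q.2⟫)) := continuous_ee.measurable.comp (by fun_prop)
  have hκ : Integrable (fun q : E × E => a⁻¹ * (𝓕 (f q.1) q.2 * ee (-⟪q.1, q.2⟫))) := by
    apply Integrable.const_mul
    refine Integrable.mono' ((hJ.mul_prod hJ).const_mul (C * B0)) (hmeas.mul heem).aestronglyMeasurable ?_
    refine Filter.Eventually.of_forall fun q => ?_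
    rw [norm_mul, norm_ee, mul_one]
    exact hFb q.1 q.2
  refine ⟨_, hκ, fun z => ?_⟩
  have hintg : Integrable (fun q : E × E => a⁻¹ * (𝓕 (f q.1) q.2 * ee (-⟪q.1, q.2⟫)) * ee ⟪q.2, z⟫ * χ (z - q.1)) := by
    refine Integrable.mono' (hκ.norm.mul_const Cχ) ?_ ?_
    · have h2 : Measurable (fun q : E × E => ee ⟪q.2, z⟫) := continuous_ee.measurable.comp (by fun_prop)
      have h3 : Measurable (fun q : E × E => χ (z - q.1)) := hχ.continuous.measurable.comp (by fun_prop)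
      exact (hκ.aestronglyMeasurable.mul h2.aestronglyMeasurable).mul h3.aestronglyMeasurable
    · refine Filter.Eventually.of_forall fun q => ?_
      rw [norm_mul, norm_mul, norm_ee, mul_one]
      gcongr
      simpa using hχb 0 (Nat.zero_le _) (z - q.1)
  rw [show (volume : Measure (E × E)) = volume.prod volume from rfl] at hintg ⊢
  rw [integral_prod _ hintg]
  have hin : ∀ u, ∫ ζ, a⁻¹ * (𝓕 (f u) ζ * ee (-⟪u, ζ⟫)) * ee ⟪ζ, z⟫ * χ (z - u) = a⁻¹ * g z * (χ (z - u) * χ (z - u)) := by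
    intro u
    have h1 := (inv_repr (hf u) (hfs u)).2 (z - u)
    have h2 : f u (z - u) = g z * χ (z - u) := by simp [hfdef]
    rw [h2] at h1
    rw [show a⁻¹ * g z * (χ (z - u) * χ (z - u)) = a⁻¹ * χ (z - u) * (g z * χ (z - u)) by ring, h1,
      ← integral_const_mul]
    congr 1; ext ζ
    have : ee ⟪ζ, z - u⟫ = ee (-⟪u, ζ⟫) * ee ⟪ζ, z⟫ := by
      rw [← ee_add, inner_sub_right, real_inner_comm u ζ]; congr 1; ring
    rw [this]; ring
  simp only [hin]
  rw [integral_const_mul, integral_sub_left_eq_self (fun y => χ y * χ y) volume z, ← hadef]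
  field_simp

/-- The two bump functions. -/
def bX : ContDiffBump (0:E) := ⟨1/2, 1, by norm_num, by norm_num⟩
def bY : ContDiffBump (0:E) := ⟨1/4, 1/2, by norm_num, by norm_num⟩

def cX (z : E) : ℂ := ((bX (E := E) z : ℝ) : ℂ)
def cY (z : E) : ℂ := ((bY (E := E) z : ℝ) : ℂ)

lemma contDiff_cX : ContDiff ℝ ∞ (cX (E := E)) := Complex.ofRealCLM.contDiff.comp bX.contDiff
lemma contDiff_cY : ContDiff ℝ ∞ (cY (E := E)) := Complex.ofRealCLM.contDiff.comp bY.contDiff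

lemma cX_supp {z : E} (h : cX z ≠ 0) : ‖z‖ ≤ 1 := by
  by_contra h'
  push Not at h'
  apply h
  have : bX (E := E) z = 0 := bX.zero_of_le_dist (by rw [dist_zero_right]; exact h'.le)
  simp [cX, this]

lemma cY_supp {z : E} (h : cY z ≠ 0) : ‖z‖ ≤ 1 / 2 := by
  by_contra h'
  push Not at h'
  apply h
  have : bY (E := E) z = 0 := bY.zero_of_le_dist (by rw [dist_zero_right]; exact h'.le)
  simp [cY, this]

lemma cX_one {z : E} (h : ‖z‖ ≤ 1 / 2) : cX z = 1 := by
  have : bX (E := E) z = 1 := bX.one_of_mem_closedBall (by rw [mem_closedBall_zero_iff]; exact h)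
  simp [cX, this]

lemma tsupport_cX : tsupport (cX (E := E)) ⊆ Metric.closedBall 0 1 :=
  closure_minimal (fun z hz => by simpa using cX_supp hz) Metric.isClosed_closedBall

lemma tsupport_cY : tsupport (cY (E := E)) ⊆ Metric.closedBall 0 1 :=
  closure_minimal (fun z hz => by
    rw [mem_closedBall_zero_iff]; have := cY_supp hz; linarith) Metric.isClosed_closedBall

lemma int_cX : ∫ z : E, cX z ≠ 0 := by
  unfold cX
  rw [integral_complex_ofReal]
  exact_mod_cast (bX.integral_pos (μ := volume)).ne'

lemma int_cY : ∫ z : E, cY z * cY z ≠ 0 := by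
  unfold cY
  simp only [← Complex.ofReal_mul]
  rw [integral_complex_ofReal]
  have hc : Continuous (fun z : E => bY (E := E) z * bY (E := E) z) := bY.continuous.mul bY.continuous
  have : 0 < ∫ z : E, bY (E := E) z * bY (E := E) z := by
    refine hc.integral_pos_of_hasCompactSupport_nonneg_nonzero ?_ ?_ (x := 0) ?_
    · exact bY.hasCompactSupport.mul_right
    · intro z; exact mul_self_nonneg _
    · have : bY (E := E) 0 = 1 := bY.one_of_mem_closedBall (by simp [bY])
      simp [this]
  exact_mod_cast this.ne'

lemma integrable_cX : Integrable (cX (E := E)) :=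
  contDiff_cX.continuous.integrable_of_hasCompactSupport (hasCompactSupport_of tsupport_cX)

lemma integrable_cY : Integrable (cY (E := E)) :=
  contDiff_cY.continuous.integrable_of_hasCompactSupport (hasCompactSupport_of tsupport_cY)

lemma dilate_bound {F : E → ℂ} (hF : Measurable F) (hF1 : ∀ y, ‖F y‖ = 1)
    (M : ℝ≥0∞) (hMtop : M ≠ ⊤) (hM : ∀ ξ, ∫⁻ x, ‖VV F cX x ξ‖ₑ ≤ M) :
    ∃ C : ℝ, 0 ≤ C ∧ ∀ l : ℝ, 0 < l → ∀ ξ, ∫⁻ x, ‖VV F (fun z => cY (l⁻¹ • z)) x ξ‖ₑ ≤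
      ENNReal.ofReal (C * max 1 (l ^ finrank ℝ E)) := by
  obtain ⟨hi, hrep⟩ := inv_repr (contDiff_cY (E := E)) tsupport_cY
  have hXm : Measurable (cX (E := E)) := contDiff_cX.continuous.measurable
  set A : ℝ≥0∞ := ∫⁻ ζ : E, ‖𝓕 (cY (E := E)) ζ‖ₑ with hA
  have hAtop : A ≠ ⊤ := hi.2.ne
  set a := ∫ z : E, cX z with ha
  have ha0 : a ≠ 0 := int_cX
  set vol := volume (Metric.closedBall (0:E) 1) with hvol
  have hvoltop : vol ≠ ⊤ := measure_closedBall_lt_top.ne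
  set Q : ℝ≥0∞ := A * M + (‖a⁻¹‖ₑ * ENNReal.ofReal (2 ^ finrank ℝ E) * vol * A) * M with hQ
  have hQtop : Q ≠ ⊤ := by
    refine ENNReal.add_ne_top.2 ⟨ENNReal.mul_ne_top hAtop hMtop, ENNReal.mul_ne_top (ENNReal.mul_ne_top
      (ENNReal.mul_ne_top (ENNReal.mul_ne_top enorm_ne_top ENNReal.ofReal_ne_top) hvoltop) hAtop) hMtop⟩
  refine ⟨Q.toReal, ENNReal.toReal_nonneg, fun l hl ξ => ?_⟩
  rw [ENNReal.ofReal_mul ENNReal.toReal_nonneg, ENNReal.ofReal_toReal hQtop]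
  rcases le_total l 1 with hl1 | hl1
  · have := superpos hF hF1 hXm integrable_cX (W := fun z => cY (l⁻¹ • z)) volume (𝓕 (cY (E := E))) hi
      (fun _ => 0) (fun ζ => l⁻¹ • ζ) measurable_const (by fun_prop) (by
        intro z
        simp only [sub_zero]
        rw [integral_mul_const]
        have h1 := hrep (l⁻¹ • z)
        by_cases hz : cY (l⁻¹ • z) = 0
        · rw [hz] at h1
          simp only [inner_smul_left, inner_smul_right] at h1 ⊢
          simp only [conj_trivial]
          rw [← h1, hz, zero_mul]
        · have h2 := cY_supp hz
          rw [norm_smul, norm_inv, Real.norm_of_nonneg hl.le, inv_mul_le_iff₀ hl] at h2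
          rw [cX_one (by nlinarith), mul_one, h1]
          simp only [inner_smul_left, inner_smul_right, conj_trivial]) M hM ξ
    refine this.trans ?_
    calc A * M ≤ Q := le_self_add
      _ = Q * 1 := (mul_one _).symm
      _ ≤ _ := by
        gcongr
        rw [ENNReal.one_le_ofReal]
        exact le_max_left _ _
  · set ball := Metric.closedBall (0:E) (2 * l) with hball
    have hballtop : volume ball ≠ ⊤ := measure_closedBall_lt_top.ne
    have : IsFiniteMeasure (volume.restrict ball) := ⟨by simpa using hballtop.lt_top⟩
    have hκ : Integrable (fun q : E × E => a⁻¹ * 𝓕 (cY (E := E)) q.2) ((volume.restrict ball).prod volume) :=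
      (integrable_const (a⁻¹)).mul_prod hi
    have hsup := superpos hF hF1 hXm integrable_cX (W := fun z => cY (l⁻¹ • z)) ((volume.restrict ball).prod volume)
      (fun q : E × E => a⁻¹ * 𝓕 (cY (E := E)) q.2) hκ
      (fun q => q.1) (fun q => l⁻¹ • q.2) measurable_fst (by fun_prop) (by
        intro z
        have e1 : (fun q : E × E => a⁻¹ * 𝓕 (cY (E := E)) q.2 * ee ⟪l⁻¹ • q.2, z⟫ * cX (z - q.1)) =
            fun q => (a⁻¹ * cX (z - q.1)) * (𝓕 (cY (E := E)) q.2 * ee ⟪q.2, l⁻¹ • z⟫) := by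
          ext q
          rw [inner_smul_left, inner_smul_right, conj_trivial]; ring
        rw [e1, integral_prod_mul (fun u => a⁻¹ * cX (z - u)) (fun ζ => 𝓕 (cY (E := E)) ζ * ee ⟪ζ, l⁻¹ • z⟫),
          ← hrep]
        by_cases hz : cY (l⁻¹ • z) = 0
        · rw [hz, mul_zero]
        · have h2 := cY_supp hz
          rw [norm_smul, norm_inv, Real.norm_of_nonneg hl.le, inv_mul_le_iff₀ hl] at h2
          rw [setIntegral_eq_integral_of_forall_compl_eq_zero, integral_const_mul,
            integral_sub_left_eq_self (fun y => cX y) volume z, ← ha, inv_mul_cancel₀ ha0, one_mul]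
          intro u hu
          by_contra hne
          have h3 := cX_supp (right_ne_zero_of_mul hne)
          apply hu
          rw [hball, mem_closedBall_zero_iff]
          have := norm_sub_le z (z - u)
          rw [sub_sub_cancel] at this
          linarith) M hM ξ
    refine hsup.trans ?_
    have e2 : ∫⁻ q : E × E, ‖a⁻¹ * 𝓕 (cY (E := E)) q.2‖ₑ ∂((volume.restrict ball).prod volume) =
        ‖a⁻¹‖ₑ * volume ball * A := by
      simp only [enorm_mul]
      rw [lintegral_prod_mul (f := fun _ : E => ‖a⁻¹‖ₑ) (g := fun ζ => ‖𝓕 (cY (E := E)) ζ‖ₑ) aemeasurable_const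
        hi.aestronglyMeasurable.enorm, lintegral_const, Measure.restrict_apply_univ]
    rw [e2, hball, Measure.addHaar_closedBall' volume 0 (by positivity), mul_pow, ENNReal.ofReal_mul (by positivity),
      max_eq_right (one_le_pow₀ hl1)]
    calc _ = ((‖a⁻¹‖ₑ * ENNReal.ofReal (2 ^ finrank ℝ E) * vol * A) * M) * ENNReal.ofReal (l ^ finrank ℝ E) := by ring
      _ ≤ _ := by gcongr; exact le_add_self

lemma VV_scale {F G : E → ℂ} {l : ℝ} (hl : 0 < l) (hFG : ∀ y, F (l⁻¹ • y) = G y) (W : E → ℂ) (ξ : E) :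
    ∫⁻ x, ‖VV F W x ξ‖ₑ = ENNReal.ofReal ((l ^ finrank ℝ E)⁻¹ * (l ^ finrank ℝ E)⁻¹) *
      ∫⁻ x, ‖VV G (fun z => W (l⁻¹ • z)) x (l⁻¹ • ξ)‖ₑ := by
  have h1 : ∀ x, VV F W x ξ = ((l ^ finrank ℝ E)⁻¹ : ℝ) • VV G (fun z => W (l⁻¹ • z)) (l • x) (l⁻¹ • ξ) := by
    intro x
    unfold VV
    have := Measure.integral_comp_smul (volume : Measure E)
      (fun y => ee (-⟪l⁻¹ • ξ, y⟫) * G y * W (l⁻¹ • (y - l • x))) l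
    rw [abs_of_pos (by positivity)] at this
    rw [← this]
    congr 1; ext y
    rw [← hFG, ← smul_sub, smul_smul, smul_smul, inv_mul_cancel₀ hl.ne', one_smul, one_smul,
      inner_smul_left, inner_smul_right, conj_trivial, inv_mul_cancel_left₀ hl.ne']
  simp only [h1, enorm_smul]
  rw [lintegral_const_mul' _ _ enorm_ne_top, ENNReal.ofReal_mul (by positivity), mul_assoc,
    Real.enorm_of_nonneg (by positivity)]
  congr 1
  set Φ : E → ℝ≥0∞ := fun x => ‖VV G (fun z => W (l⁻¹ • z)) x (l⁻¹ • ξ)‖ₑ with hΦ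
  change ∫⁻ x, Φ (l • x) = ENNReal.ofReal _ * ∫⁻ x, Φ x
  have h2 := lintegral_map_equiv (μ := volume) Φ (Homeomorph.smulOfNeZero l hl.ne' : E ≃ₜ E).toMeasurableEquiv
  have h3 : ((Homeomorph.smulOfNeZero l hl.ne' : E ≃ₜ E).toMeasurableEquiv : E → E) = fun x => l • x := rfl
  rw [h3] at h2
  rw [← h2, show Measure.map (fun x : E => l • x) volume = _ from Measure.map_addHaar_smul volume hl.ne', lintegral_smul_measure,
    abs_of_pos (by positivity), smul_eq_mul]

end Fresnel

namespace Fresnel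
open scoped FourierTransform ContDiff Nat
open Module

variable {E : Type} [NormedAddCommGroup E] [InnerProductSpace ℝ E] [FiniteDimensional ℝ E]
  [MeasurableSpace E] [BorelSpace E]

lemma conj_repr (g : SchwartzMap E ℂ) :
    ∃ κ : E × E → ℂ, Integrable κ ∧ ∀ z, (starRingEnd ℂ) (g z) =
      ∫ q, κ q * ee ⟪-q.2, z⟫ * cY (z - q.1) := by
  obtain ⟨κ, hκ, hr⟩ := repr_schwartz (contDiff_cY (E := E)) tsupport_cY int_cY g
  refine ⟨fun q => (starRingEnd ℂ) (κ q), ?_, fun z => ?_⟩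
  · exact (Complex.conjCLE.toContinuousLinearMap).integrable_comp hκ
  · rw [hr, ← integral_conj]
    congr 1; ext q
    rw [map_mul, map_mul, conj_ee, inner_neg_left]
    congr 1
    exact Complex.conj_ofReal _

lemma L1_bound {μ : E → ℝ} {m : ℝ} (hm : 2 ≤ m) (hf : ContDiffOn ℝ ∞ μ {x | x ≠ 0})
    (hh : ∀ c : ℝ, 0 < c → ∀ x, x ≠ 0 → μ (c • x) = c ^ m * μ x)
    (hinj : ∀ x, ‖x‖ = 1 → Function.Injective (fderiv ℝ (fderiv ℝ μ) x))
    (Ft : ℝ → E → ℂ) (hFt : ∀ t y, y ≠ 0 → Ft t y = ee (t * μ y)) (hF0 : ∀ t, Ft t 0 = 1)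
    (hF1 : ∀ t y, ‖Ft t y‖ = 1) (hFm : ∀ t, Measurable (Ft t)) (g : SchwartzMap E ℂ) :
    ∃ K : ℝ, 0 ≤ K ∧ ∀ t : ℝ, 0 < t → ∀ ξ,
      ∫⁻ x, ‖VV (Ft t) (fun z => (starRingEnd ℂ) (g z)) x ξ‖ₑ ≤
        ENNReal.ofReal (K * max (t ^ (-((finrank ℝ E : ℝ) / m))) (t ^ (-(2 * (finrank ℝ E : ℝ) / m)))) := by
  obtain ⟨M, hMtop, hM⟩ := base_bound (F := Ft 1) (χ := cX (E := E)) hm hf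
    (fun c hc x hx => by rw [hh c hc x hx, smul_eq_mul]) hinj
    (hF1 1) (fun y hy => by rw [hFt 1 y hy, one_mul]) contDiff_cX tsupport_cX
  obtain ⟨C, hC, hCb⟩ := dilate_bound (hFm 1) (hF1 1) M hMtop hM
  obtain ⟨κ, hκ, hr⟩ := conj_repr g
  set A : ℝ≥0∞ := ∫⁻ q, ‖κ q‖ₑ with hA
  have hAtop : A ≠ ⊤ := hκ.2.ne
  refine ⟨A.toReal * C, by positivity, fun t ht ξ => ?_⟩
  set l : ℝ := t ^ (1 / m) with hl
  have hl0 : 0 < l := by positivity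
  have hm0 : m ≠ 0 := by linarith
  have hlm : l ^ m = t := by rw [hl, ← Real.rpow_mul ht.le, one_div_mul_cancel hm0, Real.rpow_one]
  have hFG : ∀ y, Ft t (l⁻¹ • y) = Ft 1 y := by
    intro y
    by_cases hy : y = 0
    · simp [hy, hF0]
    · rw [hFt t _ (smul_ne_zero (inv_ne_zero hl0.ne') hy), hFt 1 y hy, hh _ (inv_pos.2 hl0) y hy,
        Real.inv_rpow hl0.le, hlm, mul_inv_cancel_left₀ ht.ne', one_mul]
  have hld : l ^ finrank ℝ E = t ^ ((finrank ℝ E : ℝ) / m) := by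
    rw [hl, ← Real.rpow_natCast, ← Real.rpow_mul ht.le]; congr 1; ring
  set L := l ^ finrank ℝ E with hL
  have hL0 : 0 < L := by positivity
  have e1 : t ^ (-((finrank ℝ E : ℝ) / m)) = L⁻¹ := by rw [Real.rpow_neg ht.le, hld]
  have e2 : t ^ (-(2 * (finrank ℝ E : ℝ) / m)) = L⁻¹ * L⁻¹ := by
    rw [← e1, ← Real.rpow_add ht]; congr 1; ring
  have hY : ∀ ξ, ∫⁻ x, ‖VV (Ft t) cY x ξ‖ₑ ≤ ENNReal.ofReal (C * max L⁻¹ (L⁻¹ * L⁻¹)) := by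
    intro ξ
    rw [VV_scale hl0 hFG]
    refine (mul_le_mul_right (hCb l hl0 (l⁻¹ • ξ)) _).trans ?_
    rw [← ENNReal.ofReal_mul (by positivity)]
    apply ENNReal.ofReal_le_ofReal
    apply le_of_eq
    rw [mul_left_comm, mul_max_of_nonneg _ _ (by positivity), mul_one, ← hL,
      inv_mul_cancel_right₀ hL0.ne', max_comm]
  have := superpos (hFm t) (hF1 t) (contDiff_cY (E := E)).continuous.measurable integrable_cY
    (W := fun z => (starRingEnd ℂ) (g z)) volume κ hκ (fun q => q.1) (fun q => -q.2) measurable_fst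
    measurable_snd.neg hr _ hY ξ
  refine this.trans (le_of_eq ?_)
  rw [e1, e2, mul_assoc, ENNReal.ofReal_mul ENNReal.toReal_nonneg, ENNReal.ofReal_toReal hAtop]

lemma Lp_of_L1 {Φ : E → ℂ} {A B p : ℝ} (hA : 0 ≤ A) (hB : 0 ≤ B) (hp : 1 ≤ p)
    (h1 : ∀ x, ‖Φ x‖ ≤ A) (h2 : ∫⁻ x, ‖Φ x‖ₑ ≤ ENNReal.ofReal B) :
    (∫⁻ x, ‖Φ x‖ₑ ^ p) ^ (1 / p) ≤ ENNReal.ofReal ((A ^ (p - 1) * B) ^ (1 / p)) := by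
  rw [← ENNReal.ofReal_rpow_of_nonneg (by positivity) (by positivity)]
  apply ENNReal.rpow_le_rpow _ (by positivity)
  calc ∫⁻ x, ‖Φ x‖ₑ ^ p ≤ ∫⁻ x, ENNReal.ofReal (A ^ (p - 1)) * ‖Φ x‖ₑ := by
        apply lintegral_mono; intro x
        have : ‖Φ x‖ₑ ^ p = ‖Φ x‖ₑ ^ (p - 1) * ‖Φ x‖ₑ := by
          conv_lhs => rw [show p = (p - 1) + 1 by ring, ENNReal.rpow_add_of_nonneg _ _ (by linarith) zero_le_one,
            ENNReal.rpow_one]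
        dsimp only
        rw [this]
        gcongr
        rw [← ENNReal.ofReal_rpow_of_nonneg hA (by linarith), ← ofReal_norm_eq_enorm]
        exact ENNReal.rpow_le_rpow (ENNReal.ofReal_le_ofReal (h1 x)) (by linarith)
    _ = ENNReal.ofReal (A ^ (p - 1)) * ∫⁻ x, ‖Φ x‖ₑ := lintegral_const_mul' _ _ ENNReal.ofReal_ne_top
    _ ≤ ENNReal.ofReal (A ^ (p - 1)) * ENNReal.ofReal B := by gcongr
    _ = _ := (ENNReal.ofReal_mul (by positivity)).symm

end Fresnel

/-- Under hypotheses (H), for `1 ≤ p < ∞` one has the `M^{p,∞}` bound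
`sup_ξ (∫ |V_g F_{tμ}(x,ξ)|^p dx)^{1/p} ≤ C max{t^{-d/(mp)}, t^{-2d/(mp)}}` for all `t > 0`,
where `F_{tμ}(y) = e^{2πitμ(y)}` (and `F_{tμ}(0) = 1`). -/
theorem fresnel_Mpinf_bound (d : ℕ) (hd : 1 ≤ d) (m : ℝ) (hm : 2 ≤ m)
    (μ : EuclideanSpace ℝ (Fin d) → ℝ)
    (hsmooth : ContDiffOn ℝ (⊤ : ℕ∞) μ {x | x ≠ 0})
    (hhom : ∀ c : ℝ, 0 < c → ∀ x : EuclideanSpace ℝ (Fin d), x ≠ 0 →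
      μ (c • x) = c ^ m * μ x)
    (hhess : ∀ x : EuclideanSpace ℝ (Fin d), ‖x‖ = 1 →
      Function.Bijective ⇑(fderiv ℝ (fderiv ℝ μ) x))
    (Ftμ : ℝ → EuclideanSpace ℝ (Fin d) → ℂ)
    (hFtμ : ∀ t : ℝ, ∀ y : EuclideanSpace ℝ (Fin d), y ≠ 0 →
      Ftμ t y = Complex.exp (((2 * Real.pi * (t * μ y) : ℝ) : ℂ) * Complex.I))
    (hFtμ0 : ∀ t : ℝ, Ftμ t 0 = 1)
    (g : SchwartzMap (EuclideanSpace ℝ (Fin d)) ℂ) (hg : g ≠ 0)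
    (p : ℝ) (hp : 1 ≤ p) :
    ∃ C : ℝ, 0 < C ∧ ∀ t : ℝ, 0 < t → ∀ ξ : EuclideanSpace ℝ (Fin d),
      (∫⁻ x : EuclideanSpace ℝ (Fin d),
        (‖∫ (y : EuclideanSpace ℝ (Fin d)),
            Complex.exp (-(((2 * Real.pi * ⟪ξ, y⟫ : ℝ) : ℂ) * Complex.I)) * Ftμ t y *
              (starRingEnd ℂ) (g (y - x))‖₊ : ℝ≥0∞) ^ p ∂volume) ^ (1 / p) ≤
      ENNReal.ofReal
        (C * max (t ^ (-((d : ℝ) / (m * p)))) (t ^ (-(2 * (d : ℝ) / (m * p))))) := by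
  have hFt : ∀ t y, y ≠ 0 → Ftμ t y = Fresnel.ee (t * μ y) := fun t y hy => hFtμ t y hy
  have hF1 : ∀ t y, ‖Ftμ t y‖ = 1 := by
    intro t y
    by_cases hy : y = 0
    · rw [hy, hFtμ0, norm_one]
    · rw [hFt t y hy, Fresnel.norm_ee]
  have hFm : ∀ t, Measurable (Ftμ t) := by
    intro t
    apply measurable_of_continuousOn_compl_singleton 0
    have : ContinuousOn (fun y => Fresnel.ee (t * μ y)) {0}ᶜ :=
      Fresnel.continuous_ee.comp_continuousOn (continuousOn_const.mul hsmooth.continuousOn)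
    exact this.congr (fun y hy => hFt t y hy)
  obtain ⟨K, hK, hKb⟩ := Fresnel.L1_bound hm hsmooth hhom (fun x hx => (hhess x hx).1) Ftμ hFt hFtμ0 hF1 hFm g
  rw [finrank_euclideanSpace_fin] at hKb
  set A : ℝ := ∫ y, ‖(starRingEnd ℂ) (g y)‖ with hA
  have hA0 : 0 ≤ A := integral_nonneg fun _ => norm_nonneg _
  have hp0 : p ≠ 0 := by linarith
  have hm0 : m ≠ 0 := by linarith
  refine ⟨(A ^ (p - 1) * K) ^ (1 / p) + 1, by positivity, fun t ht ξ => ?_⟩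
  set B := max (t ^ (-((d : ℝ) / m))) (t ^ (-(2 * (d : ℝ) / m))) with hB
  have hB0 : 0 ≤ B := le_max_of_le_left (by positivity)
  have h := Fresnel.Lp_of_L1 (Φ := fun x => Fresnel.VV (Ftμ t) (fun z => (starRingEnd ℂ) (g z)) x ξ)
    hA0 (mul_nonneg hK hB0) hp (fun x => Fresnel.VV_trivial (hF1 t) x ξ) (hKb t ht ξ)
  have hBp : B ^ (1 / p) = max (t ^ (-((d : ℝ) / (m * p)))) (t ^ (-(2 * (d : ℝ) / (m * p)))) := by
    have hmono : MonotoneOn (fun x : ℝ => x ^ (1 / p)) (Set.Ici 0) := fun a ha b _ hab =>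
      Real.rpow_le_rpow ha hab (by positivity)
    have := hmono.map_max (a := t ^ (-((d : ℝ) / m))) (b := t ^ (-(2 * (d : ℝ) / m)))
      (Set.mem_Ici.2 (by positivity)) (Set.mem_Ici.2 (by positivity))
    rw [hB]
    refine this.trans ?_
    rw [← Real.rpow_mul ht.le, ← Real.rpow_mul ht.le]
    congr 2 <;> field_simp
  calc _ = (∫⁻ x, ‖Fresnel.VV (Ftμ t) (fun z => (starRingEnd ℂ) (g z)) x ξ‖ₑ ^ p) ^ (1 / p) := by
        congr 2; ext x
        rw [enorm_eq_nnnorm]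
        congr 3
        unfold Fresnel.VV
        congr 1; ext y
        unfold Fresnel.ee
        congr 3
        push_cast; ring
    _ ≤ _ := h
    _ ≤ _ := by
        apply ENNReal.ofReal_le_ofReal
        rw [← mul_assoc, Real.mul_rpow (by positivity) hB0, hBp]
        gcongr
        linarith
end
end

section
/- Assume (H) and let g : ℝ^d → ℂ be a nonzero Schwartz function. Then there exists a constant C > 0 such that for every t > 0 and every Schwartz function h : ℝ^d → ℂ, sup_{ξ∈ℝ^d} ∫_{ℝ^d} |V_g(F_{tμ}·h)(x,ξ)| dx ≤ C · max{t^{-d/m}, t^{-2d/m}} · ∫_{ℝ^d} sup_{x∈ℝ^d} |V_g h(x,ξ)| dξ, where V_g(F_{tμ}·h)(x,ξ) = ∫_{ℝ^d} e^{-2πi ξ·y} e^{2πi t μ(y)} h(y) conj(g(y−x)) dy. (This is the dispersive estimate ‖e^{2πitμ(D)} f‖_{W^{1,∞}} ≤ C max{t^{-d/m}, t^{-2d/m}} ‖f‖_{W^{∞,1}} of the paper, written on the Fourier-transform side for Schwartz densities h.) -/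
open MeasureTheory Real Complex
open scoped ENNReal RealInnerProductSpace

noncomputable section


set_option linter.unusedSectionVars false
set_option linter.style.longLine false

section aux1
variable {E : Type*} [NormedAddCommGroup E] [InnerProductSpace ℝ E] [FiniteDimensional ℝ E]

theorem aux_hom_iter (m : ℝ) (μ : E → ℝ)
    (hsmooth : ContDiffOn ℝ (⊤ : ℕ∞) μ {x | x ≠ 0})
    (hhom : ∀ c : ℝ, 0 < c → ∀ x : E, x ≠ 0 → μ (c • x) = c ^ m * μ x) (j : ℕ) :
    ∃ C : ℝ, 0 < C ∧ ∀ y : E, y ≠ 0 → ‖iteratedFDeriv ℝ j μ y‖ ≤ C * ‖y‖ ^ (m - j) := by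
  have hO : IsOpen {x : E | x ≠ 0} := isOpen_ne
  have hcont : ContinuousOn (fun y => ‖iteratedFDeriv ℝ j μ y‖) (Metric.sphere (0 : E) 1) := by
    have h1 : ContinuousOn (iteratedFDerivWithin ℝ j μ {x : E | x ≠ 0}) {x : E | x ≠ 0} :=
      hsmooth.continuousOn_iteratedFDerivWithin (by exact_mod_cast le_top) hO.uniqueDiffOn
    have h2 : ContinuousOn (iteratedFDeriv ℝ j μ) {x : E | x ≠ 0} :=
      h1.congr (fun x hx => (iteratedFDerivWithin_of_isOpen j hO hx).symm)
    refine (h2.mono ?_).norm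
    intro x hx hx0
    simp [hx0] at hx
  obtain ⟨C, hC⟩ := (isCompact_sphere (0 : E) 1).bddAbove_image hcont
  refine ⟨max C 1, by positivity, fun y hy => ?_⟩
  have hc : 0 < ‖y‖ := norm_pos_iff.2 hy
  set c := ‖y‖ with hcdef
  have hci : 0 < c⁻¹ := inv_pos.2 hc
  set ω := c⁻¹ • y with hω
  have hω1 : ω ∈ Metric.sphere (0 : E) 1 := by
    simp [hω, norm_smul, ← hcdef, hc.ne', abs_of_pos hc]
  have hω0 : ω ≠ 0 := by
    intro h0; simp [h0] at hω1
  have hb : ‖iteratedFDeriv ℝ j μ ω‖ ≤ C := hC ⟨ω, hω1, rfl⟩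
  let e : E ≃L[ℝ] E := ContinuousLinearEquiv.smulLeft (Units.mk0 c⁻¹ hci.ne')
  have he : ∀ z, e z = c⁻¹ • z := fun z => rfl
  have hpre : e ⁻¹' {x : E | x ≠ 0} = {x : E | x ≠ 0} := by
    ext z; simp [he, hc.ne']
  have heq : μ =ᶠ[nhds y] (c ^ m) • (μ ∘ e) := by
    filter_upwards [hO.mem_nhds hy] with z hz
    have := hhom c hc (c⁻¹ • z) (by simpa [hc.ne'] using hz)
    rw [smul_smul, mul_inv_cancel₀ hc.ne', one_smul] at this
    simpa [he] using this
  have hE : iteratedFDeriv ℝ j (μ ∘ e) y =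
      (iteratedFDeriv ℝ j μ ω).compContinuousLinearMap fun _ => (e : E →L[ℝ] E) := by
    have h3 := e.iteratedFDerivWithin_comp_right (f := μ) (s := {x : E | x ≠ 0}) hO.uniqueDiffOn
      (x := y) (show e y ≠ 0 from hω0) j
    rw [hpre, iteratedFDerivWithin_of_isOpen j hO hy,
      iteratedFDerivWithin_of_isOpen j hO (by exact hω0)] at h3
    exact h3
  have hsm : ContDiffAt ℝ j (μ ∘ e) y := by
    have : ContDiffAt ℝ j μ (e y) :=
      (hsmooth.contDiffAt (hO.mem_nhds hω0)).of_le (by exact_mod_cast le_top)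
    exact this.comp y e.contDiff.contDiffAt
  rw [heq.iteratedFDeriv ℝ j |>.eq_of_nhds, iteratedFDeriv_const_smul_apply hsm, hE, norm_smul]
  have hen : ‖(e : E →L[ℝ] E)‖ ≤ c⁻¹ := by
    refine ContinuousLinearMap.opNorm_le_bound _ hci.le fun z => ?_
    simp [he, norm_smul, abs_of_pos hc]
  calc ‖c ^ m‖ * ‖(iteratedFDeriv ℝ j μ ω).compContinuousLinearMap fun _ => (e : E →L[ℝ] E)‖
      ≤ c ^ m * (max C 1 * (c⁻¹) ^ j) := by
        rw [Real.norm_of_nonneg (by positivity)]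
        gcongr
        refine (ContinuousMultilinearMap.norm_compContinuousLinearMap_le _ _).trans ?_
        simp only [Finset.prod_const, Finset.card_univ, Fintype.card_fin]
        gcongr
        exact hb.trans (le_max_left _ _)
    _ = max C 1 * c ^ (m - j) := by
        rw [Real.rpow_sub hc, Real.rpow_natCast, inv_pow]; ring

theorem aux_hom_fderiv {F : Type*} [NormedAddCommGroup F] [NormedSpace ℝ F] (p : ℝ) (f : E → F)
    (hhom : ∀ c : ℝ, 0 < c → ∀ x : E, x ≠ 0 → f (c • x) = c ^ p • f x)
    (c : ℝ) (hc : 0 < c) (x : E) (hx : x ≠ 0) :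
    fderiv ℝ f (c • x) = c ^ (p - 1) • fderiv ℝ f x := by
  have heq : (fun z => f (c • z)) =ᶠ[nhds x] (c ^ p) • f := by
    filter_upwards [isOpen_ne.mem_nhds hx] with z hz
    exact hhom c hc z hz
  have h1 := heq.fderiv_eq (𝕜 := ℝ)
  rw [fderiv_comp_smul, fderiv_const_smul_field, Pi.smul_apply] at h1
  rw [Real.rpow_sub_one hc.ne', div_eq_inv_mul, mul_smul, ← h1, smul_smul,
    inv_mul_cancel₀ hc.ne', one_smul]

theorem aux_norm_smul {F : Type*} [NormedAddCommGroup F] [NormedSpace ℝ F] (c : ℝ)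
    (L : E →L[ℝ] F) : ‖c • L‖ = ‖c‖ * ‖L‖ := norm_smul c L

theorem aux_norm_dist {F : Type*} [NormedAddCommGroup F] [NormedSpace ℝ F]
    (L L' : E →L[ℝ] F) : dist L L' = ‖L - L'‖ := dist_eq_norm L L'

set_option maxHeartbeats 1000000 in
theorem aux_cone (m : ℝ) (hm : 2 ≤ m) (μ : E → ℝ)
    (hsmooth : ContDiffOn ℝ (⊤ : ℕ∞) μ {x | x ≠ 0})
    (hhom : ∀ c : ℝ, 0 < c → ∀ x : E, x ≠ 0 → μ (c • x) = c ^ m * μ x)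
    (ω : E) (hω : ‖ω‖ = 1)
    (hhess : Function.Bijective ⇑(fderiv ℝ (fderiv ℝ μ) ω)) :
    ∃ δ > 0, ∃ c > 0, ∀ x y : E, x ≠ 0 → y ≠ 0 → ‖x - ‖x‖ • ω‖ < δ * ‖x‖ →
      ‖y - ‖y‖ • ω‖ < δ * ‖y‖ →
      c * ‖x‖ ^ (m - 2) * ‖x - y‖ ≤ ‖fderiv ℝ μ x - fderiv ℝ μ y‖ := by
  have hO : IsOpen {x : E | x ≠ 0} := isOpen_ne
  have hω0 : ω ≠ 0 := by intro h; simp [h] at hω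
  set D := fderiv ℝ μ with hD
  set H := fderiv ℝ D with hH
  have hDs : ContDiffOn ℝ (⊤ : ℕ∞) D {x | x ≠ 0} :=
    hsmooth.fderiv_of_isOpen hO (by simp)
  have hHs : ContDiffOn ℝ (⊤ : ℕ∞) H {x | x ≠ 0} :=
    hDs.fderiv_of_isOpen hO (by simp)
  have hDhom : ∀ c : ℝ, 0 < c → ∀ x : E, x ≠ 0 → D (c • x) = c ^ (m - 1) • D x :=
    aux_hom_fderiv m μ (by simpa using hhom)
  have hHhom : ∀ c : ℝ, 0 < c → ∀ x : E, x ≠ 0 → H (c • x) = c ^ (m - 1 - 1) • H x :=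
    aux_hom_fderiv (m - 1) D hDhom
  obtain ⟨K, hK0, hK⟩ := (H ω).exists_antilipschitzWith (LinearMap.ker_eq_bot.2 hhess.1)
  have hKb : ∀ v, ‖v‖ ≤ K * ‖H ω v‖ := fun v => by
    simpa using hK.le_mul_dist v 0
  have hK0' : (0 : ℝ) < K := hK0
  set a : ℝ := (2 * K)⁻¹ with ha
  have ha0 : 0 < a := by positivity
  have hAb : ∀ v, 2 * a * ‖v‖ ≤ ‖H ω v‖ := fun v => by
    have := hKb v
    rw [ha]
    have h2 : 2 * (2 * (K : ℝ))⁻¹ = (K : ℝ)⁻¹ := by field_simp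
    rw [h2, inv_mul_le_iff₀ hK0']
    exact this
  have hHc : ContinuousAt H ω := (hHs.continuousOn).continuousAt (hO.mem_nhds hω0)
  obtain ⟨δ, hδ0, hδ⟩ := (Metric.continuousAt_iff (f := H) (a := ω)).1 hHc a ha0
  refine ⟨min δ (1/2), by positivity, (2:ℝ)⁻¹ * ((2:ℝ)⁻¹) ^ (m-2) * a, by positivity, ?_⟩
  intro x y hx hy hxc hyc
  have hx0 : 0 < ‖x‖ := norm_pos_iff.2 hx
  have hy0 : 0 < ‖y‖ := norm_pos_iff.2 hy
  set δ' := min δ (1/2) with hδ'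
  let z : ℝ → E := fun τ => y + τ • (x - y)
  let r : ℝ → ℝ := fun τ => ‖y‖ + τ * (‖x‖ - ‖y‖)
  have hr : ∀ τ, 0 ≤ τ → τ ≤ 1 → 0 < r τ := fun τ h0 h1 => by
    have e : r τ = (1 - τ) * ‖y‖ + τ * ‖x‖ := by simp only [r]; ring
    rw [e]
    rcases h0.eq_or_lt with h | h
    · subst h; simpa using hy0
    · have := mul_pos h hx0
      have := mul_nonneg (show 0 ≤ 1 - τ by linarith) hy0.le
      linarith
  have hz : ∀ τ, 0 ≤ τ → τ ≤ 1 → ‖z τ - r τ • ω‖ < δ' * r τ := fun τ h0 h1 => by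
    have : z τ - r τ • ω = (1 - τ) • (y - ‖y‖ • ω) + τ • (x - ‖x‖ • ω) := by
      simp only [z, r]; module
    rw [this]
    refine (norm_add_le _ _).trans_lt ?_
    rw [norm_smul, norm_smul, Real.norm_of_nonneg (by linarith), Real.norm_of_nonneg h0]
    have e : δ' * r τ = (1 - τ) * (δ' * ‖y‖) + τ * (δ' * ‖x‖) := by simp only [r]; ring
    rw [e]
    rcases h0.eq_or_lt with h | h
    · subst h; simpa using hyc
    · have := mul_le_mul_of_nonneg_left hyc.le (show 0 ≤ 1 - τ by linarith)
      have := mul_lt_mul_of_pos_left hxc h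
      linarith
  have hzball : ∀ τ, 0 ≤ τ → τ ≤ 1 → ‖(r τ)⁻¹ • z τ - ω‖ < δ' := fun τ h0 h1 => by
    have h2 := hz τ h0 h1
    have h3 := hr τ h0 h1
    have : (r τ)⁻¹ • z τ - ω = (r τ)⁻¹ • (z τ - r τ • ω) := by
      rw [smul_sub, smul_smul, inv_mul_cancel₀ h3.ne', one_smul]
    rw [this, norm_smul, norm_inv, Real.norm_of_nonneg h3.le, inv_mul_lt_iff₀ h3]
    linarith
  have hzb0 : ∀ τ, 0 ≤ τ → τ ≤ 1 → (r τ)⁻¹ • z τ ≠ 0 := fun τ h0 h1 h => by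
    have h2 := hzball τ h0 h1
    rw [h, zero_sub, norm_neg, hω] at h2
    have := min_le_right δ (1/2 : ℝ)
    linarith
  have hz0 : ∀ τ, 0 ≤ τ → τ ≤ 1 → z τ ≠ 0 := fun τ h0 h1 h => by
    apply hzb0 τ h0 h1; rw [h, smul_zero]
  have hHz : ∀ τ, 0 ≤ τ → τ ≤ 1 → ‖H (z τ) - (r τ) ^ (m - 2) • H ω‖ ≤ (r τ) ^ (m - 2) * a :=
    fun τ h0 h1 => by
    have h3 := hr τ h0 h1
    have h4 : H (z τ) = (r τ) ^ (m - 2) • H ((r τ)⁻¹ • z τ) := by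
      have := hHhom (r τ) h3 _ (hzb0 τ h0 h1)
      rw [smul_smul, mul_inv_cancel₀ h3.ne', one_smul] at this
      rw [this]; congr 2; ring
    have h5 : (r τ) ^ (m - 2) • H ((r τ)⁻¹ • z τ) - (r τ) ^ (m - 2) • H ω =
      (r τ) ^ (m - 2) • (H ((r τ)⁻¹ • z τ) - H ω) := (smul_sub _ _ _).symm
    rw [h4, h5, aux_norm_smul, Real.norm_of_nonneg (by positivity)]
    gcongr
    have := hδ (x := (r τ)⁻¹ • z τ) (by
      rw [dist_eq_norm]; exact (hzball τ h0 h1).trans_le (min_le_left _ _))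
    rw [aux_norm_dist] at this
    exact this.le
  set w := (InnerProductSpace.toDual ℝ E).symm (H ω (x - y)) with hw
  have hwn : ‖w‖ = ‖H ω (x - y)‖ := LinearIsometryEquiv.norm_map _ _
  have hww : H ω (x - y) w = ‖w‖ ^ 2 := by
    have := InnerProductSpace.toDual_symm_apply (𝕜 := ℝ) (x := w) (y := H ω (x - y))
    rw [← hw] at this
    rw [← this, real_inner_self_eq_norm_sq]
  have hwb : 2 * a * ‖x - y‖ ≤ ‖w‖ := by rw [hwn]; exact hAb _
  let φ : ℝ → ℝ := fun τ => D (z τ) w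
  have hφ : ∀ τ, 0 ≤ τ → τ ≤ 1 → HasDerivAt φ (H (z τ) (x - y) w) τ := fun τ h0 h1 => by
    have h5 : HasFDerivAt D (H (z τ)) (z τ) :=
      ((hDs.contDiffAt (hO.mem_nhds (hz0 τ h0 h1))).differentiableAt (by simp)).hasFDerivAt
    have h6 : HasDerivAt z (x - y) τ := by
      have := ((hasDerivAt_id τ).smul_const (x - y)).const_add y
      simpa [z] using this
    have h7 := h5.comp_hasDerivAt τ h6
    simpa using h7.clm_apply (hasDerivAt_const τ w)
  have hφ' : ∀ τ, 0 ≤ τ → τ ≤ 1 → (r τ) ^ (m - 2) * (a * ‖x - y‖ * ‖w‖) ≤ H (z τ) (x - y) w :=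
    fun τ h0 h1 => by
    have h3 := hr τ h0 h1
    have h8 : |(H (z τ) - (r τ) ^ (m - 2) • H ω) (x - y) w| ≤
        (r τ) ^ (m - 2) * a * ‖x - y‖ * ‖w‖ := by
      rw [← Real.norm_eq_abs]
      refine (ContinuousLinearMap.le_opNorm _ _).trans ?_
      gcongr
      refine (ContinuousLinearMap.le_opNorm _ _).trans ?_
      gcongr
      exact hHz τ h0 h1
    have h9 : (H (z τ) - (r τ) ^ (m - 2) • H ω) (x - y) w =
        H (z τ) (x - y) w - (r τ) ^ (m - 2) * ‖w‖ ^ 2 := by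
      rw [← hww]; simp only [sub_apply, smul_apply, smul_eq_mul]
    rw [h9] at h8
    have h10 := (abs_le.1 h8).1
    have h11 : 0 < (r τ) ^ (m - 2) := by positivity
    have h12 : 2 * a * ‖x - y‖ * ‖w‖ ≤ ‖w‖ ^ 2 := by
      rw [sq]; gcongr
    have h13 := mul_le_mul_of_nonneg_left h12 h11.le
    nlinarith
  have hmvt : ∀ p q : ℝ, 0 ≤ p → p < q → q ≤ 1 → ∃ τ ∈ Set.Ioo p q,
      H (z τ) (x - y) w = (φ q - φ p) / (q - p) := fun p q hp hpq hq => by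
    refine exists_hasDerivAt_eq_slope φ (fun τ => H (z τ) (x - y) w) hpq ?_ ?_
    · intro τ hτ
      exact (hφ τ (hp.trans hτ.1) (hτ.2.trans hq)).continuousAt.continuousWithinAt
    · intro τ hτ
      exact hφ τ (hp.trans hτ.1.le) (hτ.2.le.trans hq)
  obtain ⟨τ₁, ht₁, e₁⟩ := hmvt 0 (1/2) le_rfl (by norm_num) (by norm_num)
  obtain ⟨τ₂, ht₂, e₂⟩ := hmvt (1/2) 1 (by norm_num) (by norm_num) le_rfl
  have b₁ := hφ' τ₁ ht₁.1.le (ht₁.2.le.trans (by norm_num))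
  have b₂ := hφ' τ₂ (le_trans (by norm_num) ht₂.1.le) ht₂.2.le
  have p₁ : 0 < r τ₁ := hr τ₁ ht₁.1.le (ht₁.2.le.trans (by norm_num))
  have hrb : 2⁻¹ * ‖x‖ ≤ r τ₂ := by
    have := ht₂.1; have := ht₂.2
    simp only [r]; nlinarith [mul_nonneg (show 0 ≤ 1 - τ₂ by linarith) hy0.le, mul_nonneg (show 0 ≤ τ₂ - 1/2 by linarith) hx0.le]
  have hrb2 : ((2:ℝ)⁻¹) ^ (m - 2) * ‖x‖ ^ (m - 2) ≤ r τ₂ ^ (m - 2) := by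
    rw [← Real.mul_rpow (by norm_num) hx0.le]
    exact Real.rpow_le_rpow (by positivity) hrb (by linarith)
  have hφ10 : φ 1 - φ 0 ≤ ‖D x - D y‖ * ‖w‖ := by
    have : φ 1 - φ 0 = (D x - D y) w := by simp [φ, z]
    rw [this]
    exact (Real.le_norm_self _).trans (ContinuousLinearMap.le_opNorm _ _)
  have f₁ : 0 ≤ φ (1/2) - φ 0 := by
    have : 0 ≤ (φ (1/2) - φ 0) / (1/2 - 0) := by rw [← e₁]; exact le_trans (by positivity) b₁
    norm_num at this ⊢; linarith
  have f₂ : 2⁻¹ * (((2:ℝ)⁻¹) ^ (m - 2) * ‖x‖ ^ (m - 2) * (a * ‖x - y‖ * ‖w‖)) ≤ φ 1 - φ (1/2) := by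
    have h1 : ((2:ℝ)⁻¹) ^ (m - 2) * ‖x‖ ^ (m - 2) * (a * ‖x - y‖ * ‖w‖) ≤
        (φ 1 - φ (1/2)) / (1 - 1/2) := by
      rw [← e₂]
      exact (mul_le_mul_of_nonneg_right hrb2 (by positivity)).trans b₂
    norm_num at h1 ⊢; linarith
  rcases (norm_nonneg w).eq_or_lt with h | h
  · have : ‖x - y‖ = 0 := by
      have := norm_nonneg (x - y)
      rw [← h] at hwb
      nlinarith
    rw [this]; simp
  · refine le_of_mul_le_mul_right ?_ h
    refine le_trans ?_ hφ10
    calc _ = 2⁻¹ * (((2:ℝ)⁻¹) ^ (m - 2) * ‖x‖ ^ (m - 2) * (a * ‖x - y‖ * ‖w‖)) := by ring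
      _ ≤ _ := by linarith

end aux1

section aux2
variable {E : Type*} [NormedAddCommGroup E] [InnerProductSpace ℝ E] [FiniteDimensional ℝ E]
  [MeasurableSpace E] [BorelSpace E]

theorem aux_integrable_bracket :
    Integrable (fun v : E => ((1 + ‖v‖) ^ (Module.finrank ℝ E + 1))⁻¹) := by
  have h := integrable_one_add_norm (E := E) (μ := volume) (r := (Module.finrank ℝ E + 1 : ℕ))
    (by push_cast; linarith)
  refine h.congr (Filter.Eventually.of_forall fun v => ?_)
  simp only
  rw [Real.rpow_neg (by positivity), Real.rpow_natCast]

theorem aux_lint_bracket : ∃ K : ℝ, 0 < K ∧ ∀ a : ℝ, 0 < a → ∀ u₀ : E,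
    ∫⁻ u : E, ENNReal.ofReal (((1 + a * ‖u - u₀‖) ^ (Module.finrank ℝ E + 1))⁻¹) ≤
      ENNReal.ofReal (K * (a ^ Module.finrank ℝ E)⁻¹) := by
  set f : E → ℝ := fun v : E => ((1 + ‖v‖) ^ (Module.finrank ℝ E + 1))⁻¹ with hf
  have hfi : Integrable f := aux_integrable_bracket
  refine ⟨max (∫ v, f v) 1, by positivity, fun a ha u₀ => ?_⟩
  have h1 : ∀ u : E, ((1 + a * ‖u - u₀‖) ^ (Module.finrank ℝ E + 1))⁻¹ = f (a • (u - u₀)) := by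
    intro u; simp [hf, norm_smul, abs_of_pos ha]
  simp_rw [h1]
  have h2 : Integrable (fun u => f (a • (u - u₀))) :=
    (hfi.comp_smul ha.ne').comp_sub_right u₀
  rw [← ofReal_integral_eq_lintegral_ofReal h2 (Filter.Eventually.of_forall fun u => by
    simp only [hf]; positivity)]
  apply ENNReal.ofReal_le_ofReal
  rw [integral_sub_right_eq_self (fun u => f (a • u)) u₀, Measure.integral_comp_smul,
    abs_of_nonneg (by positivity), smul_eq_mul, mul_comm]
  gcongr
  exact le_max_left _ _

/-- The majorant of the Gabor transform of the phase. -/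
def auxP (m t s l : ℝ) (D : E → E →L[ℝ] ℝ) (u η : E) : ℝ :=
  if ‖u‖ ≤ 2 / l then 1 else
    ((1 + ‖t • D u - innerSL ℝ η‖ * (s / max 1 (s ^ 2 * (t * ‖u‖ ^ (m - 2))))) ^
      (Module.finrank ℝ E + 1))⁻¹

theorem auxP_nonneg (m t s l : ℝ) (hs : 0 ≤ s) (D : E → E →L[ℝ] ℝ) (u η : E) :
    0 ≤ auxP m t s l D u η := by
  unfold auxP; split_ifs <;> positivity

theorem aux_scale (m t l : ℝ) (hm : 2 ≤ m) (ht : 0 < t) (hl : l = t ^ (1 / m)) (r : ℝ)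
    (hr : 2 / l ≤ r) :
    min l (l ^ 2) ≤ (t * r ^ (m - 2)) * (min 1 l⁻¹ / max 1 ((min 1 l⁻¹) ^ 2 * (t * r ^ (m - 2)))) := by
  have hl0 : 0 < l := by rw [hl]; positivity
  have htl : t = l ^ m := by
    rw [hl, ← Real.rpow_mul ht.le, one_div, inv_mul_cancel₀ (by linarith), Real.rpow_one]
  have hr' : l⁻¹ ≤ r := le_trans (by rw [div_eq_mul_inv]; nlinarith [inv_pos.2 hl0]) hr
  have hρ : l ^ 2 ≤ t * r ^ (m - 2) := by
    calc l ^ 2 = l ^ m * (l⁻¹) ^ (m - 2) := by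
          rw [Real.inv_rpow hl0.le, ← div_eq_mul_inv, ← Real.rpow_sub hl0]
          rw [← Real.rpow_natCast]; congr 1; push_cast; ring
      _ ≤ _ := by
          rw [htl]; gcongr
  set ρ := t * r ^ (m - 2)
  have hρ0 : 0 < ρ := lt_of_lt_of_le (by positivity) hρ
  rcases le_total l 1 with h | h
  · have h1 : (1:ℝ) ≤ l⁻¹ := (one_le_inv₀ hl0).2 h
    rw [min_eq_left h1]
    refine (min_le_right _ _).trans ?_
    rw [one_pow, one_mul, mul_one_div, le_div_iff₀ (by positivity)]
    rcases le_total 1 ρ with h2 | h2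
    · rw [max_eq_right h2]
      have : l ^ 2 ≤ 1 := by nlinarith
      nlinarith
    · rw [max_eq_left h2]; linarith
  · have h1 : l⁻¹ ≤ 1 := inv_le_one_of_one_le₀ h
    rw [min_eq_right h1]
    refine (min_le_left _ _).trans ?_
    have h2 : 1 ≤ (l⁻¹) ^ 2 * ρ := by
      rw [inv_pow, ← div_eq_inv_mul, le_div_iff₀ (by positivity)]; linarith
    rw [max_eq_right h2]
    apply le_of_eq
    field_simp

theorem auxP_lint (m : ℝ) (hm : 2 ≤ m) (μ : E → ℝ)
    (hsmooth : ContDiffOn ℝ (⊤ : ℕ∞) μ {x | x ≠ 0})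
    (hhom : ∀ c : ℝ, 0 < c → ∀ x : E, x ≠ 0 → μ (c • x) = c ^ m * μ x)
    (hhess : ∀ x : E, ‖x‖ = 1 → Function.Bijective ⇑(fderiv ℝ (fderiv ℝ μ) x)) :
    ∃ K : ℝ, 0 < K ∧ ∀ t l : ℝ, 0 < t → l = t ^ (1 / m) → ∀ η : E,
      ∫⁻ u : E, ENNReal.ofReal (auxP m t (min 1 l⁻¹) l (fderiv ℝ μ) u η) ≤
        ENNReal.ofReal (K * ((min l (l ^ 2)) ^ Module.finrank ℝ E)⁻¹) := by
  set n := Module.finrank ℝ E with hn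
  set D := fderiv ℝ μ with hD
  choose! δ hδ0 c hc0 hcone using fun (ω : E) (hω : ‖ω‖ = 1) =>
    aux_cone m hm μ hsmooth hhom ω hω (hhess ω hω)
  obtain ⟨T, hTs, hTc⟩ := (isCompact_sphere (0 : E) 1).elim_nhds_subcover
    (fun ω => Metric.ball ω (δ ω))
    (fun ω hω => Metric.ball_mem_nhds _ (hδ0 ω (by simpa using hω)))
  obtain ⟨K, hK0, hK⟩ := aux_lint_bracket (E := E)
  set B := (volume (Metric.closedBall (0 : E) 1)).toReal with hB
  have hBe : volume (Metric.closedBall (0 : E) 1) = ENNReal.ofReal B :=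
    (ENNReal.ofReal_toReal measure_closedBall_lt_top.ne).symm
  have hB0 : 0 ≤ B := ENNReal.toReal_nonneg
  refine ⟨2 ^ n * B + 1 + ∑ ω ∈ T, 2 ^ (n + 1) * (K * ((c ω) ^ n)⁻¹), ?_, ?_⟩
  · have : 0 ≤ ∑ ω ∈ T, 2 ^ (n + 1) * (K * ((c ω) ^ n)⁻¹) := Finset.sum_nonneg fun ω hω => by
      have := hc0 ω (by simpa using hTs ω hω)
      positivity
    positivity
  intro t l ht hl η
  have hl0 : 0 < l := by rw [hl]; positivity
  set s := min 1 l⁻¹ with hs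
  have hs0 : 0 < s := by positivity
  have hs1 : s ≤ 1 := min_le_left _ _
  set κ := min l (l ^ 2) with hκ
  have hκ0 : 0 < κ := by positivity
  let φ : E → ℝ := fun u => ‖t • D u - innerSL ℝ η‖
  let S : E → Set E := fun ω => {u | u ≠ 0 ∧ ‖u - ‖u‖ • ω‖ < δ ω * ‖u‖}
  have hmin : ∀ ω : E, ∃ u₀ : E, (S ω).Nonempty → u₀ ∈ S ω ∧ ∀ u ∈ S ω, φ u₀ ≤ φ u + 1 := by
    intro ω
    by_cases hne : (S ω).Nonempty
    · have hbdd : BddBelow (Set.image φ (S ω)) := ⟨0, by rintro _ ⟨u, _, rfl⟩; exact norm_nonneg _⟩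
      obtain ⟨_, ⟨u₀, hu₀, rfl⟩, hlt⟩ := Real.lt_sInf_add_pos (hne.image φ) one_pos
      refine ⟨u₀, fun _ => ⟨hu₀, fun u hu => ?_⟩⟩
      have := csInf_le hbdd ⟨u, hu, rfl⟩
      linarith
    · exact ⟨0, fun h => absurd h hne⟩
  choose u₀ hu₀ using hmin
  have hpt : ∀ u : E, auxP m t s l D u η ≤
      Set.indicator (Metric.closedBall (0 : E) (2 / l)) (fun _ => (1:ℝ)) u +
      ∑ ω ∈ T, 2 ^ (n + 1) * (((1 + (c ω * κ) * ‖u - u₀ ω‖) ^ (n + 1))⁻¹) := by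
    intro u
    have hc0' : ∀ ω ∈ T, 0 < c ω := fun ω hω => hc0 ω (by simpa using hTs ω hω)
    have hnn : ∀ ω ∈ T, 0 ≤ 2 ^ (n + 1) * (((1 + (c ω * κ) * ‖u - u₀ ω‖) ^ (n + 1))⁻¹) :=
      fun ω hω => by
        have := hc0' ω hω
        positivity
    unfold auxP
    split_ifs with h
    · rw [Set.indicator_of_mem (by simpa using h)]
      have := Finset.sum_nonneg hnn
      linarith
    · rw [Set.indicator_of_notMem (by simpa using h), zero_add]
      push Not at h
      have hu0 : 0 < ‖u‖ := lt_trans (by positivity) h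
      have hu : u ≠ 0 := norm_pos_iff.1 hu0
      have hsph : ‖u‖⁻¹ • u ∈ Metric.sphere (0 : E) 1 := by
        simp [norm_smul, hu0.ne']
      obtain ⟨ω, hωT, hω⟩ := Set.mem_iUnion₂.1 (hTc hsph)
      have huS : u ∈ S ω := by
        refine ⟨hu, ?_⟩
        have e : u - ‖u‖ • ω = ‖u‖ • (‖u‖⁻¹ • u - ω) := by
          rw [smul_sub, smul_smul, mul_inv_cancel₀ hu0.ne', one_smul]
        rw [e, norm_smul, norm_norm, mul_comm]
        rw [Metric.mem_ball, dist_eq_norm] at hω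
        exact mul_lt_mul_of_pos_right hω hu0
      refine le_trans ?_ (Finset.single_le_sum hnn hωT)
      obtain ⟨hu₀S, hu₀m⟩ := hu₀ ω ⟨u, huS⟩
      have h3 := hcone ω (by simpa using hTs ω hωT) u (u₀ ω) hu hu₀S.1 huS.2 hu₀S.2
      have h4 := hu₀m u huS
      have h5 : t * ‖D u - D (u₀ ω)‖ ≤ φ u + φ (u₀ ω) := by
        have e : t • (D u - D (u₀ ω)) = (t • D u - innerSL ℝ η) - (t • D (u₀ ω) - innerSL ℝ η) := by
          rw [smul_sub]; abel
        have := norm_sub_le (t • D u - innerSL ℝ η) (t • D (u₀ ω) - innerSL ℝ η)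
        rwa [← e, norm_smul, Real.norm_of_nonneg ht.le] at this
      have hcω := hc0' ω hωT
      have h6 : c ω * (t * ‖u‖ ^ (m - 2)) * ‖u - u₀ ω‖ ≤ 2 * φ u + 1 := by
        have := mul_le_mul_of_nonneg_left h3 ht.le
        linarith
      have h7 := aux_scale m t l hm ht hl ‖u‖ h.le
      rw [← hs] at h7
      set q := s / max 1 (s ^ 2 * (t * ‖u‖ ^ (m - 2))) with hq
      have hq0 : 0 ≤ q := by positivity
      have hq1 : q ≤ 1 := by
        rw [hq]; exact div_le_one_of_le₀ (hs1.trans (le_max_left _ _)) (by positivity)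
      have h8 : (c ω * κ) * ‖u - u₀ ω‖ ≤ 2 * (φ u * q) + 1 := by
        calc (c ω * κ) * ‖u - u₀ ω‖ ≤ (c ω * ((t * ‖u‖ ^ (m - 2)) * q)) * ‖u - u₀ ω‖ := by gcongr
          _ = (c ω * (t * ‖u‖ ^ (m - 2)) * ‖u - u₀ ω‖) * q := by ring
          _ ≤ (2 * φ u + 1) * q := by gcongr
          _ ≤ _ := by nlinarith
      have h9 : 0 ≤ (c ω * κ) * ‖u - u₀ ω‖ := by positivity
      have h10 : (1 + (c ω * κ) * ‖u - u₀ ω‖) / 2 ≤ 1 + φ u * q := by linarith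
      calc ((1 + φ u * q) ^ (n + 1))⁻¹ ≤ (((1 + (c ω * κ) * ‖u - u₀ ω‖) / 2) ^ (n + 1))⁻¹ := by
            gcongr
        _ = _ := by rw [div_pow, inv_div, div_eq_mul_inv]
  calc ∫⁻ u : E, ENNReal.ofReal (auxP m t s l D u η)
      ≤ ∫⁻ u : E, (Set.indicator (Metric.closedBall (0 : E) (2 / l)) (fun _ => (1:ℝ≥0∞)) u +
          ∑ ω ∈ T, ENNReal.ofReal (2 ^ (n + 1)) *
            ENNReal.ofReal (((1 + (c ω * κ) * ‖u - u₀ ω‖) ^ (n + 1))⁻¹)) := by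
        refine lintegral_mono fun u => ?_
        refine (ENNReal.ofReal_le_ofReal (hpt u)).trans ?_
        refine ENNReal.ofReal_add_le.trans ?_
        gcongr ?_ + ?_
        · by_cases h : u ∈ Metric.closedBall (0 : E) (2 / l)
          · simp [Set.indicator_of_mem h]
          · simp [Set.indicator_of_notMem h]
        · rw [ENNReal.ofReal_sum_of_nonneg]
          · refine Finset.sum_le_sum fun ω _ => ?_
            rw [ENNReal.ofReal_mul (by positivity)]
          · intro ω hω
            have := hc0 ω (by simpa using hTs ω hω)
            positivity
    _ ≤ ENNReal.ofReal ((2 ^ n * B) * (κ ^ n)⁻¹) + ∑ ω ∈ T, ENNReal.ofReal (2 ^ (n + 1)) *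
          ENNReal.ofReal (K * ((c ω * κ) ^ n)⁻¹) := by
        rw [lintegral_add_left (measurable_const.indicator measurableSet_closedBall),
          lintegral_finsetSum _ (fun ω _ => by fun_prop)]
        gcongr ?_ + ?_
        · rw [lintegral_indicator measurableSet_closedBall, setLIntegral_const, one_mul,
            Measure.addHaar_closedBall' _ _ (by positivity), hBe,
            ← ENNReal.ofReal_mul (by positivity)]
          apply ENNReal.ofReal_le_ofReal
          rw [div_pow, div_eq_mul_inv, mul_assoc, mul_comm _ B, ← mul_assoc]
          gcongr
          exact min_le_left _ _
        · refine Finset.sum_le_sum fun ω hω => ?_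
          rw [lintegral_const_mul _ (by fun_prop)]
          gcongr
          have := hc0 ω (by simpa using hTs ω hω)
          exact hK _ (by positivity) _
    _ ≤ _ := by
        have e : ∀ ω ∈ T, ENNReal.ofReal (2 ^ (n + 1)) *
          ENNReal.ofReal (K * ((c ω * κ) ^ n)⁻¹) =
          ENNReal.ofReal ((2 ^ (n + 1) * (K * ((c ω) ^ n)⁻¹)) * (κ ^ n)⁻¹) := fun ω hω => by
            rw [← ENNReal.ofReal_mul (by positivity)]
            congr 1; rw [mul_pow, mul_inv]; ring
        have hpos : ∀ ω ∈ T, 0 ≤ (2 ^ (n + 1) * (K * ((c ω) ^ n)⁻¹)) * (κ ^ n)⁻¹ := fun ω hω => by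
          have := hc0 ω (by simpa using hTs ω hω)
          positivity
        rw [Finset.sum_congr rfl e, ← ENNReal.ofReal_sum_of_nonneg hpos,
          ← ENNReal.ofReal_add (by positivity) (Finset.sum_nonneg hpos)]
        apply ENNReal.ofReal_le_ofReal
        rw [← Finset.sum_mul, ← add_mul]
        gcongr
        linarith

end aux2

section aux3
variable {E : Type*} [NormedAddCommGroup E] [InnerProductSpace ℝ E] [FiniteDimensional ℝ E]
  [MeasurableSpace E] [BorelSpace E]

theorem aux_mul_bound (N : ℕ) (O : Set E) (hO : IsOpen O) (f g : E → ℂ)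
    (hf : ContDiffOn ℝ (⊤ : ℕ∞) f O) (hg : ContDiffOn ℝ (⊤ : ℕ∞) g O) (y : E) (hy : y ∈ O)
    (A B D : ℝ) (hA : 0 ≤ A) (hB : 0 ≤ B) (hD : 0 ≤ D)
    (hfb : ∀ j ≤ N, ‖iteratedFDeriv ℝ j f y‖ ≤ A * D ^ j)
    (hgb : ∀ j ≤ N, ‖iteratedFDeriv ℝ j g y‖ ≤ B * D ^ j) :
    ∀ j ≤ N, ‖iteratedFDeriv ℝ j (fun z => f z * g z) y‖ ≤ (2 ^ N * A * B) * D ^ j := by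
  intro j hj
  have h := norm_iteratedFDerivWithin_mul_le hf hg hO.uniqueDiffOn hy (n := j)
    (by exact_mod_cast le_top)
  rw [iteratedFDerivWithin_of_isOpen j hO hy] at h
  refine h.trans ?_
  calc _ ≤ ∑ i ∈ Finset.range (j + 1), (j.choose i : ℝ) * (A * B * D ^ j) := by
        refine Finset.sum_le_sum fun i hi => ?_
        have hij : i ≤ j := Nat.lt_succ_iff.1 (Finset.mem_range.1 hi)
        rw [iteratedFDerivWithin_of_isOpen i hO hy, iteratedFDerivWithin_of_isOpen (j - i) hO hy,
          mul_assoc]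
        refine mul_le_mul_of_nonneg_left ?_ (by positivity)
        calc _ ≤ (A * D ^ i) * (B * D ^ (j - i)) := by
              gcongr
              · exact hfb i (hij.trans hj)
              · exact hgb (j - i) ((Nat.sub_le _ _).trans hj)
          _ = A * B * (D ^ i * D ^ (j - i)) := by ring
          _ = _ := by rw [← pow_add, Nat.add_sub_cancel' hij]
    _ = 2 ^ j * (A * B * D ^ j) := by
        rw [← Finset.sum_mul]
        congr 1
        exact_mod_cast Nat.sum_range_choose j
    _ ≤ 2 ^ N * (A * B * D ^ j) := by
        gcongr
        norm_num
    _ = _ := by ring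

theorem aux_exp_deriv (c : ℂ) (n : ℕ) :
    iteratedDeriv n (fun r : ℝ => Complex.exp (c * r)) = fun r : ℝ => c ^ n * Complex.exp (c * r) := by
  induction n with
  | zero => ext; simp
  | succ n ih =>
    rw [iteratedDeriv_succ, ih]
    ext r
    have h1 : HasDerivAt (fun r : ℝ => c * (r : ℂ)) c r := by
      simpa using (Complex.ofRealCLM.hasDerivAt (x := r)).const_mul c
    have := (h1.cexp.const_mul (c ^ n)).deriv
    rw [this]; ring

theorem aux_exp_norm (j : ℕ) (r : ℝ) :
    ‖iteratedFDeriv ℝ j (fun r : ℝ => Complex.exp ((2 * π * I) * r)) r‖ = (2 * π) ^ j := by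
  rw [norm_iteratedFDeriv_eq_norm_iteratedDeriv, aux_exp_deriv]
  simp only [norm_mul, norm_pow]
  have : (2 * (π : ℂ) * I) * (r : ℂ) = ((2 * π * r : ℝ) : ℂ) * I := by push_cast; ring
  rw [this, Complex.norm_exp_ofReal_mul_I]
  simp [abs_of_pos Real.pi_pos]

theorem aux_fourier_bound (N : ℕ) (G : E → ℂ) (hG : ContDiff ℝ (⊤ : ℕ∞) G) (u : E) (s : ℝ)
    (hs : 0 < s) (hsupp : ∀ y, y ∉ Metric.closedBall u s → G y = 0) (A D : ℝ) (hA : 0 ≤ A)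
    (hD : 1 ≤ D) (hb : ∀ y ∈ Metric.closedBall u s, ∀ j ≤ N, ‖iteratedFDeriv ℝ j G y‖ ≤ A * D ^ j)
    (ζ : E) :
    ‖ζ‖ ^ N * ‖FourierTransform.fourier G ζ‖ ≤ 2 ^ N * (N + 1) * (A * D ^ N) *
      ((volume (Metric.closedBall (0 : E) 1)).toReal * s ^ Module.finrank ℝ E) := by
  have hts : tsupport G ⊆ Metric.closedBall u s := by
    refine closure_minimal ?_ Metric.isClosed_closedBall
    intro y hy
    by_contra h
    exact hy (hsupp y h)
  have hcs : HasCompactSupport G :=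
    (isCompact_closedBall u s).of_isClosed_subset (isClosed_tsupport _) hts
  have hinteg : ∀ n : ℕ, Integrable (fun v => ‖iteratedFDeriv ℝ n G v‖) := fun n => by
    have h1 : Continuous (iteratedFDeriv ℝ n G) := hG.continuous_iteratedFDeriv (by exact_mod_cast le_top)
    exact (h1.integrable_of_hasCompactSupport (hcs.iteratedFDeriv n)).norm
  have h := Real.pow_mul_norm_iteratedFDeriv_fourier_le (K := 0) (N := ⊤) (f := G) hG
    (by
      intro k n hk _
      have hk0 : k = 0 := by simpa using hk
      subst hk0
      simpa using hinteg n) (k := 0) (n := N) (by simp) (by exact_mod_cast le_top) ζ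
  rw [norm_iteratedFDeriv_zero] at h
  refine h.trans ?_
  have hvol : volume.real (Metric.closedBall u s) =
      (volume (Metric.closedBall (0 : E) 1)).toReal * s ^ Module.finrank ℝ E := by
    rw [Measure.real, Measure.addHaar_closedBall' _ _ hs.le, ENNReal.toReal_mul,
      ENNReal.toReal_ofReal (by positivity), mul_comm]
  have hI : ∀ j ≤ N, ∫ v, ‖iteratedFDeriv ℝ j G v‖ ≤ (A * D ^ N) *
      ((volume (Metric.closedBall (0 : E) 1)).toReal * s ^ Module.finrank ℝ E) := fun j hj => by
    rw [← setIntegral_eq_integral_of_forall_compl_eq_zero (s := Metric.closedBall u s)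
      (fun v hv => ?_), ← hvol]
    · have := norm_setIntegral_le_of_norm_le_const (μ := volume) (s := Metric.closedBall u s)
        (f := fun v => ‖iteratedFDeriv ℝ j G v‖) (C := A * D ^ N) measure_closedBall_lt_top
        (fun v hv => by
          rw [norm_norm]
          refine (hb v hv j hj).trans ?_
          gcongr)
      exact (Real.le_norm_self _).trans this
    · rw [norm_eq_zero]
      by_contra h0
      exact hv (hts (support_iteratedFDeriv_subset j h0))
  have hsum : ∑ p ∈ Finset.range (0 + 1) ×ˢ Finset.range (N + 1),
        ∫ v, ‖v‖ ^ p.1 * ‖iteratedFDeriv ℝ p.2 G v‖ ≤ (N + 1) * ((A * D ^ N) *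
      ((volume (Metric.closedBall (0 : E) 1)).toReal * s ^ Module.finrank ℝ E)) := by
    rw [Finset.sum_product]
    simp only [zero_add, Finset.range_one, Finset.sum_singleton, pow_zero, one_mul]
    refine (Finset.sum_le_card_nsmul _ _ _ (fun j hj => hI j
      (Nat.lt_succ_iff.1 (Finset.mem_range.1 hj)))).trans ?_
    simp
  calc _ ≤ (2 * π) ^ 0 * (2 * ((0 : ℕ) : ℝ) + 2) ^ N * ((N + 1) * ((A * D ^ N) *
      ((volume (Metric.closedBall (0 : E) 1)).toReal * s ^ Module.finrank ℝ E))) := by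
        gcongr
    _ = _ := by push_cast; ring

theorem aux_phase (m : ℝ) (hm : 2 ≤ m) (μ : E → ℝ)
    (hsmooth : ContDiffOn ℝ (⊤ : ℕ∞) μ {x | x ≠ 0})
    (hhom : ∀ c : ℝ, 0 < c → ∀ x : E, x ≠ 0 → μ (c • x) = c ^ m * μ x) (N : ℕ) :
    ∃ C : ℝ, 1 ≤ C ∧ ∀ t s : ℝ, 0 < t → 0 < s → ∀ u y : E, 2 * s ≤ ‖u‖ → y ∈ Metric.closedBall u s →
      ∀ j, 1 ≤ j → j ≤ N → ‖iteratedFDeriv ℝ j (fun z => t * μ z - t * fderiv ℝ μ u z) y‖ ≤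
        (C * max 1 (s ^ 2 * (t * ‖u‖ ^ (m - 2))) / s) ^ j := by
  have hO : IsOpen {x : E | x ≠ 0} := isOpen_ne
  choose K hK0 hK using fun j => aux_hom_iter m μ hsmooth hhom j
  set Cs := 1 + ∑ j ∈ Finset.range (N + 3), K j with hCs
  have hsum0 : 0 ≤ ∑ j ∈ Finset.range (N + 3), K j := Finset.sum_nonneg fun j _ => (hK0 j).le
  have hKC : ∀ j < N + 3, K j ≤ Cs := fun j hj => by
    have := Finset.single_le_sum (f := K) (fun i _ => (hK0 i).le) (Finset.mem_range.2 hj)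
    linarith
  have hCs1 : 1 ≤ Cs := by linarith
  have h2m : (1:ℝ) ≤ 2 ^ (m - 2) := Real.one_le_rpow (by norm_num) (by linarith)
  have hC1 : 1 ≤ Cs * 2 ^ (m - 2) := one_le_mul_of_one_le_of_one_le hCs1 h2m
  refine ⟨Cs * 2 ^ (m - 2), hC1, ?_⟩
  intro t s ht hs u y hu hy j hj1 hjN
  set D := fderiv ℝ μ with hD
  have hDs : ContDiffOn ℝ (⊤ : ℕ∞) D {x | x ≠ 0} := hsmooth.fderiv_of_isOpen hO (by simp)
  have hnear : ∀ z ∈ Metric.closedBall u s, s ≤ ‖z‖ ∧ ‖z‖ ≤ 2 * ‖u‖ := fun z hz => by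
    rw [Metric.mem_closedBall, dist_eq_norm] at hz
    have h1 := norm_sub_norm_le u z
    have h2 := norm_sub_norm_le z u
    rw [norm_sub_rev] at h1
    constructor <;> linarith
  have hne : ∀ z ∈ Metric.closedBall u s, z ≠ 0 := fun z hz h0 => by
    have := (hnear z hz).1
    rw [h0, norm_zero] at this; linarith
  have hu0 : 0 < ‖u‖ := by linarith
  set ρ := t * ‖u‖ ^ (m - 2) with hρ
  set M := max 1 (s ^ 2 * ρ) with hM
  have hM1 : 1 ≤ M := le_max_left _ _
  set C' := Cs * 2 ^ (m - 2) with hC'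
  have hpow : ∀ z ∈ Metric.closedBall u s, ‖z‖ ^ (m - 2) ≤ 2 ^ (m - 2) * ‖u‖ ^ (m - 2) := fun z hz => by
    rw [← Real.mul_rpow (by norm_num) hu0.le]
    exact Real.rpow_le_rpow (norm_nonneg _) (hnear z hz).2 (by linarith)
  have hψd : ∀ z : E, z ≠ 0 → fderiv ℝ (fun z => t * μ z - t * D u z) z = t • D z - t • D u := by
    intro z hz
    have h1 : HasFDerivAt μ (D z) z :=
      ((hsmooth.contDiffAt (hO.mem_nhds hz)).differentiableAt (by simp)).hasFDerivAt
    exact ((h1.const_mul t).sub ((D u).hasFDerivAt.const_mul t)).fderiv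
  have hμd : ∀ z : E, z ≠ 0 → fderiv ℝ (fun z => t * μ z) z = t • D z := by
    intro z hz
    have h1 : HasFDerivAt μ (D z) z :=
      ((hsmooth.contDiffAt (hO.mem_nhds hz)).differentiableAt (by simp)).hasFDerivAt
    exact (h1.const_mul t).fderiv
  rcases hj1.eq_or_lt with h1 | h1
  · rw [← h1, norm_iteratedFDeriv_one, hψd y (hne y hy), ← smul_sub, norm_smul,
      Real.norm_of_nonneg ht.le, pow_one]
    have hmv : ‖D y - D u‖ ≤ (Cs * (2 ^ (m - 2) * ‖u‖ ^ (m - 2))) * ‖y - u‖ := by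
      refine (convex_closedBall u s).norm_image_sub_le_of_norm_fderiv_le (𝕜 := ℝ) (f := D) ?_ ?_
        (Metric.mem_closedBall_self hs.le) hy
      · intro z hz
        exact (hDs.contDiffAt (hO.mem_nhds (hne z hz))).differentiableAt (by simp)
      · intro z hz
        have h2 := hK 2 z (hne z hz)
        have h3 : ‖iteratedFDeriv ℝ 2 μ z‖ = ‖fderiv ℝ D z‖ := by
          rw [← norm_iteratedFDeriv_one, ← norm_iteratedFDeriv_fderiv]
        rw [h3] at h2
        refine h2.trans ?_
        push_cast
        gcongr
        · exact hKC 2 (by omega)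
        · exact hpow z hz
    rw [Metric.mem_closedBall, dist_eq_norm] at hy
    calc t * ‖D y - D u‖ ≤ t * ((Cs * (2 ^ (m - 2) * ‖u‖ ^ (m - 2))) * s) := by
          gcongr
          exact hmv.trans (by gcongr)
      _ = C' * (s ^ 2 * ρ) / s := by
          rw [hC', hρ]; field_simp
      _ ≤ C' * M / s := by
          gcongr
          exact le_max_right _ _
  · obtain ⟨k, rfl⟩ : ∃ k, j = k + 2 := ⟨j - 2, by omega⟩
    have hev : fderiv ℝ (fderiv ℝ (fun z => t * μ z - t * D u z)) =ᶠ[nhds y]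
        fderiv ℝ (fderiv ℝ (fun z => t * μ z)) := by
      filter_upwards [hO.mem_nhds (hne y hy)] with z hz
      have e1 : fderiv ℝ (fun z => t * μ z - t * D u z) =ᶠ[nhds z]
          fun z => fderiv ℝ (fun z => t * μ z) z - t • D u := by
        filter_upwards [hO.mem_nhds hz] with v hv
        rw [hψd v hv, hμd v hv]
      rw [e1.fderiv_eq, fderiv_sub_const]
    have e2 : ‖iteratedFDeriv ℝ (k + 2) (fun z => t * μ z - t * D u z) y‖ =
        t * ‖iteratedFDeriv ℝ (k + 2) μ y‖ := by
      have hsm' : ∀ j : ℕ, ContDiffAt ℝ j μ y := fun j =>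
        (hsmooth.contDiffAt (hO.mem_nhds (hne y hy))).of_le (by exact_mod_cast le_top)
      have hsm := hsm' (k + 2)
      calc _ = ‖iteratedFDeriv ℝ k (fderiv ℝ (fderiv ℝ (fun z => t * μ z - t * D u z))) y‖ := by
            rw [norm_iteratedFDeriv_fderiv, norm_iteratedFDeriv_fderiv]
        _ = ‖iteratedFDeriv ℝ k (fderiv ℝ (fderiv ℝ (fun z => t * μ z))) y‖ := by
            rw [(hev.iteratedFDeriv ℝ k).eq_of_nhds]
        _ = ‖iteratedFDeriv ℝ (k + 2) (t • μ) y‖ := by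
            rw [norm_iteratedFDeriv_fderiv, norm_iteratedFDeriv_fderiv]; rfl
        _ = _ := by
            rw [iteratedFDeriv_const_smul_apply hsm, norm_smul, Real.norm_of_nonneg ht.le]
    rw [e2]
    have hy0 : 0 < ‖y‖ := norm_pos_iff.2 (hne y hy)
    have e3 : ‖y‖ ^ (m - ((k + 2 : ℕ) : ℝ)) = ‖y‖ ^ (m - 2) * (‖y‖ ^ k)⁻¹ := by
      rw [← Real.rpow_natCast, ← Real.rpow_neg hy0.le, ← Real.rpow_add hy0]
      congr 1; push_cast; ring
    have hCM : 1 ≤ C' * M := one_le_mul_of_one_le_of_one_le hC1 hM1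
    calc t * ‖iteratedFDeriv ℝ (k + 2) μ y‖
        ≤ t * (Cs * ((2 ^ (m - 2) * ‖u‖ ^ (m - 2)) * (s ^ k)⁻¹)) := by
          gcongr
          refine (hK (k + 2) y (hne y hy)).trans ?_
          rw [e3]
          gcongr
          · exact hKC (k + 2) (by omega)
          · exact hpow y hy
          · exact (hnear y hy).1
      _ = C' * (s ^ 2 * ρ) / s ^ (k + 2) := by
          rw [hC', hρ]; field_simp; ring
      _ ≤ C' * M / s ^ (k + 2) := by
          gcongr
          exact le_max_right _ _
      _ ≤ (C' * M) ^ (k + 2) / s ^ (k + 2) := by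
          gcongr
          exact le_self_pow₀ hCM (by omega)
      _ = _ := by rw [← div_pow]

end aux3

section aux4
variable {E : Type*} [NormedAddCommGroup E] [InnerProductSpace ℝ E] [FiniteDimensional ℝ E]
  [MeasurableSpace E] [BorelSpace E]

theorem aux_schwartz (N : ℕ) (g : SchwartzMap E ℂ) :
    ∃ C : ℝ, 0 < C ∧ ∀ x u y : E, ‖y - u‖ ≤ 1 → ∀ j ≤ N,
      ‖iteratedFDeriv ℝ j (fun z => (starRingEnd ℂ) (g (z - x))) y‖ ≤ C * ((1 + ‖x - u‖) ^ N)⁻¹ := by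
  set S := 2 ^ N * (Finset.Iic (N, N)).sup (fun m => SchwartzMap.seminorm ℝ m.1 m.2) g with hS
  have hS0 : 0 ≤ S := by positivity
  refine ⟨2 ^ N * (S + 1), by positivity, ?_⟩
  intro x u y hy j hj
  have h1 : ‖iteratedFDeriv ℝ j (fun z => (starRingEnd ℂ) (g (z - x))) y‖ =
      ‖iteratedFDeriv ℝ j g (y - x)‖ := by
    have := LinearIsometryEquiv.norm_iteratedFDeriv_comp_left (𝕜 := ℝ) Complex.conjLIE
      (fun z => g (z - x)) y j
    rw [iteratedFDeriv_comp_sub] at this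
    exact this
  have h2 := SchwartzMap.one_add_le_sup_seminorm_apply (𝕜 := ℝ) (m := (N, N)) (k := N) (n := j)
    le_rfl hj g (y - x)
  rw [h1, ← div_eq_mul_inv, le_div_iff₀ (by positivity)]
  have h3 : 1 + ‖x - u‖ ≤ 2 * (1 + ‖y - x‖) := by
    have : ‖x - u‖ ≤ ‖y - x‖ + ‖y - u‖ := by
      rw [norm_sub_rev y x]
      have := norm_add_le (x - y) (y - u)
      rwa [sub_add_sub_cancel] at this
    have := norm_nonneg (y - x)
    linarith
  calc _ ≤ ‖iteratedFDeriv ℝ j g (y - x)‖ * (2 * (1 + ‖y - x‖)) ^ N := by gcongr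
    _ = 2 ^ N * ((1 + ‖y - x‖) ^ N * ‖iteratedFDeriv ℝ j g (y - x)‖) := by rw [mul_pow]; ring
    _ ≤ 2 ^ N * (S + 1) := by
      gcongr
      exact h2.trans (by simp [hS])

theorem aux_bump (N : ℕ) (χ : E → ℝ) (hχ : ContDiff ℝ (⊤ : ℕ∞) χ) (hc : HasCompactSupport χ) :
    ∃ C : ℝ, 0 < C ∧ ∀ s : ℝ, 0 < s → ∀ u y : E, ∀ j ≤ N,
      ‖iteratedFDeriv ℝ j (fun z => ((χ (s⁻¹ • (z - u)) : ℝ) : ℂ)) y‖ ≤ C * (s⁻¹) ^ j := by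
  have hb : ∀ j : ℕ, ∃ C : ℝ, ∀ y, ‖iteratedFDeriv ℝ j χ y‖ ≤ C := fun j =>
    (hχ.continuous_iteratedFDeriv (by exact_mod_cast le_top)).bounded_above_of_compact_support
      (hc.iteratedFDeriv j)
  choose K hK using hb
  have hK0 : ∀ j, 0 ≤ K j := fun j => (norm_nonneg _).trans (hK j 0)
  have hsum0 : 0 ≤ ∑ j ∈ Finset.range (N + 1), K j := Finset.sum_nonneg fun j _ => hK0 j
  refine ⟨1 + ∑ j ∈ Finset.range (N + 1), K j, by linarith, ?_⟩
  intro s hs u y j hj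
  have hKC : K j ≤ 1 + ∑ j ∈ Finset.range (N + 1), K j := by
    have := Finset.single_le_sum (f := K) (fun i _ => hK0 i) (Finset.mem_range.2 (Nat.lt_succ_of_le hj))
    linarith
  have hcd : ∀ j : ℕ, ContDiff ℝ j χ := fun j => hχ.of_le (by exact_mod_cast le_top)
  have hcd2 : ContDiff ℝ (⊤ : ℕ∞) (fun z => χ (s⁻¹ • (z - u))) := by fun_prop
  have h1 : ‖iteratedFDeriv ℝ j (fun z => ((χ (s⁻¹ • (z - u)) : ℝ) : ℂ)) y‖ =
      ‖iteratedFDeriv ℝ j (fun z => χ (s⁻¹ • (z - u))) y‖ :=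
    LinearIsometry.norm_iteratedFDeriv_comp_left (𝕜 := ℝ) Complex.ofRealLI
      (f := fun z => χ (s⁻¹ • (z - u))) (x := y) (n := ((⊤ : ℕ∞) : WithTop ℕ∞)) hcd2.contDiffAt (by exact_mod_cast le_top)
  rw [h1, iteratedFDeriv_comp_sub (f := fun z => χ (s⁻¹ • z)), iteratedFDeriv_comp_const_smul _ (hcd j)]
  rw [norm_smul, norm_pow, Real.norm_of_nonneg (inv_nonneg.2 hs.le), mul_comm]
  gcongr
  exact (hK j _).trans hKC

theorem aux_exp_phase (m : ℝ) (hm : 2 ≤ m) (μ : E → ℝ)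
    (hsmooth : ContDiffOn ℝ (⊤ : ℕ∞) μ {x | x ≠ 0})
    (hhom : ∀ c : ℝ, 0 < c → ∀ x : E, x ≠ 0 → μ (c • x) = c ^ m * μ x) (N : ℕ) :
    ∃ A C : ℝ, 0 < A ∧ 1 ≤ C ∧ ∀ t s : ℝ, 0 < t → 0 < s → ∀ u y : E, 2 * s ≤ ‖u‖ →
      y ∈ Metric.closedBall u s → ∀ j ≤ N,
      ‖iteratedFDeriv ℝ j (fun z => Complex.exp ((2 * π * I) * ((t * μ z - t * fderiv ℝ μ u z : ℝ) : ℂ))) y‖ ≤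
        A * (C * max 1 (s ^ 2 * (t * ‖u‖ ^ (m - 2))) / s) ^ j := by
  obtain ⟨C, hC1, hC⟩ := aux_phase m hm μ hsmooth hhom N
  have hpi : 1 ≤ 2 * π := by have := Real.pi_gt_three; linarith
  refine ⟨N.factorial * (2 * π) ^ N, C, by positivity, hC1, ?_⟩
  intro t s ht hs u y hu hy j hj
  have hO : IsOpen {x : E | x ≠ 0} := isOpen_ne
  have hy0 : y ∈ {x : E | x ≠ 0} := by
    intro h0
    rw [h0, mem_closedBall_iff_norm', sub_zero] at hy
    linarith
  have hin : ContDiffOn ℝ (⊤ : ℕ∞) (fun z => t * μ z - t * fderiv ℝ μ u z) {x | x ≠ 0} :=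
    (contDiffOn_const.mul hsmooth).sub (contDiff_const.mul (fderiv ℝ μ u).contDiff).contDiffOn
  have hout : ContDiff ℝ (⊤ : ℕ∞) (fun r : ℝ => Complex.exp ((2 * π * I) * r)) := by
    exact (contDiff_const.mul Complex.ofRealCLM.contDiff).cexp
  have key := norm_iteratedFDerivWithin_comp_le (𝕜 := ℝ) (g := fun r : ℝ => Complex.exp ((2 * π * I) * r))
    (f := fun z => t * μ z - t * fderiv ℝ μ u z) (n := j) (s := {x | x ≠ 0}) (t := Set.univ) (x := y)
    (N := ((⊤ : ℕ∞) : WithTop ℕ∞)) hout.contDiffOn hin (by exact_mod_cast le_top) uniqueDiffOn_univ hO.uniqueDiffOn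
    (Set.mapsTo_univ _ _) hy0 (C := (2 * π) ^ N)
    (D := C * max 1 (s ^ 2 * (t * ‖u‖ ^ (m - 2))) / s) ?_ ?_
  · rw [iteratedFDerivWithin_of_isOpen j hO hy0] at key
    refine key.trans ?_
    gcongr
  · intro i hi
    rw [iteratedFDerivWithin_univ, aux_exp_norm]
    exact pow_le_pow_right₀ hpi (hi.trans hj)
  · intro i hi1 hi
    rw [iteratedFDerivWithin_of_isOpen i hO hy0]
    exact hC t s ht hs u y hu hy i hi1 (hi.trans hj)

end aux4

section aux5
variable {E : Type*} [NormedAddCommGroup E] [InnerProductSpace ℝ E] [FiniteDimensional ℝ E]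
  [MeasurableSpace E] [BorelSpace E]

/-- smooth amplitude with linear part of the phase removed -/
def auxG (t s : ℝ) (μ : E → ℝ) (χ : E → ℝ) (g : SchwartzMap E ℂ) (u x : E) (z : E) : ℂ :=
  Complex.exp ((2 * π * I) * ((t * μ z - t * fderiv ℝ μ u z : ℝ) : ℂ)) *
    ((χ (s⁻¹ • (z - u)) : ℝ) : ℂ) * (starRingEnd ℂ) (g (z - x))

theorem aux_chi_zero (χ : E → ℝ) (hsupp : ∀ y, 1 < ‖y‖ → χ y = 0) (s : ℝ) (hs : 0 < s) (u y : E)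
    (hy : y ∉ Metric.closedBall u s) : χ (s⁻¹ • (y - u)) = 0 := by
  apply hsupp
  rw [mem_closedBall_iff_norm, not_le] at hy
  rw [norm_smul, Real.norm_of_nonneg (inv_nonneg.2 hs.le), inv_mul_eq_div, lt_div_iff₀ hs, one_mul]
  exact hy

theorem aux_conj_contDiff (g : SchwartzMap E ℂ) (x : E) :
    ContDiff ℝ (⊤ : ℕ∞) (fun z => (starRingEnd ℂ) (g (z - x))) := by
  have h1 : ContDiff ℝ (⊤ : ℕ∞) (fun z => g (z - x)) :=
    (g.smooth ⊤).comp (contDiff_id.sub contDiff_const)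
  exact Complex.conjCLE.contDiff.comp h1

theorem aux_decay (m : ℝ) (hm : 2 ≤ m) (μ : E → ℝ)
    (hsmooth : ContDiffOn ℝ (⊤ : ℕ∞) μ {x | x ≠ 0})
    (hhom : ∀ c : ℝ, 0 < c → ∀ x : E, x ≠ 0 → μ (c • x) = c ^ m * μ x)
    (χ : E → ℝ) (hχ : ContDiff ℝ (⊤ : ℕ∞) χ) (hsupp : ∀ y, 1 < ‖y‖ → χ y = 0) (g : SchwartzMap E ℂ) :
    ∃ C : ℝ, 0 < C ∧ ∀ t l s : ℝ, 0 < t → 0 < l → s = min 1 l⁻¹ → ∀ F : E → ℂ,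
      (∀ y, y ≠ 0 → F y = Complex.exp (((2 * π * (t * μ y) : ℝ) : ℂ) * I)) → F 0 = 1 →
      ∀ u x η : E,
      ‖∫ y, Complex.exp (-(((2 * π * ⟪η, y⟫ : ℝ) : ℂ) * I)) *
        (F y * ((χ (s⁻¹ • (y - u)) : ℝ) : ℂ) * (starRingEnd ℂ) (g (y - x)))‖ ≤
      C * s ^ Module.finrank ℝ E * ((1 + ‖x - u‖) ^ (Module.finrank ℝ E + 1))⁻¹ *
        auxP m t s l (fderiv ℝ μ) u η := by
  set n := Module.finrank ℝ E with hn
  have hc : HasCompactSupport χ := HasCompactSupport.intro (isCompact_closedBall (0 : E) 1)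
    (fun y hy => hsupp y (by simpa using hy))
  obtain ⟨A, C1, hA, hC1, hexp⟩ := aux_exp_phase m hm μ hsmooth hhom (n + 1)
  obtain ⟨Cχ, hCχ, hbχ⟩ := aux_bump (n + 1) χ hχ hc
  obtain ⟨Cg, hCg, hbg⟩ := aux_schwartz (n + 1) g
  set V := (volume (Metric.closedBall (0 : E) 1)).toReal with hV
  have hV0 : 0 ≤ V := ENNReal.toReal_nonneg
  set B1 := Cχ * Cg * V with hB1
  set B2 := 2 ^ (n + 1) * (((n + 1 : ℕ) : ℝ) + 1) * (2 ^ (n + 1) * (2 ^ (n + 1) * A * Cχ) * Cg * C1 ^ (n + 1)) * V with hB2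
  have hB10 : 0 ≤ B1 := by positivity
  have hB20 : 0 ≤ B2 := by positivity
  refine ⟨2 ^ (n + 1) * (B1 + B2) + B1 + 1, by positivity, ?_⟩
  intro t l s ht hl hs F hF hF0 u x η
  have hs0 : 0 < s := by rw [hs]; positivity
  have hs1 : s ≤ 1 := by rw [hs]; exact min_le_left _ _
  have hF1 : ∀ y, ‖F y‖ = 1 := fun y => by
    by_cases h : y = 0
    · rw [h, hF0, norm_one]
    · rw [hF y h, Complex.norm_exp_ofReal_mul_I]
  set β := ((1 + ‖x - u‖) ^ (n + 1))⁻¹ with hβ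
  have hβ0 : 0 < β := by positivity
  have hball1 : ∀ y ∈ Metric.closedBall u s, ‖y - u‖ ≤ 1 := fun y hy => by
    rw [mem_closedBall_iff_norm] at hy; linarith
  have hvol : volume.real (Metric.closedBall u s) = V * s ^ n := by
    rw [Measure.real, Measure.addHaar_closedBall' _ _ hs0.le, ENNReal.toReal_mul,
      ENNReal.toReal_ofReal (by positivity), mul_comm]
  set Q := ∫ y, Complex.exp (-(((2 * π * ⟪η, y⟫ : ℝ) : ℂ) * I)) *
        (F y * ((χ (s⁻¹ • (y - u)) : ℝ) : ℂ) * (starRingEnd ℂ) (g (y - x))) with hQ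
  have htriv : ‖Q‖ ≤ B1 * s ^ n * β := by
    rw [hQ, ← setIntegral_eq_integral_of_forall_compl_eq_zero (s := Metric.closedBall u s)
      (fun y hy => by rw [aux_chi_zero χ hsupp s hs0 u y hy]; simp)]
    refine (norm_setIntegral_le_of_norm_le_const (C := Cχ * (Cg * β)) measure_closedBall_lt_top
      (fun y hy => ?_)).trans (le_of_eq ?_)
    · rw [norm_mul, norm_mul, norm_mul, hF1, ← neg_mul, ← Complex.ofReal_neg,
        Complex.norm_exp_ofReal_mul_I, one_mul, one_mul]
      have h1 := hbχ s hs0 u y 0 (by omega)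
      have h2 := hbg x u y (hball1 y hy) 0 (by omega)
      rw [norm_iteratedFDeriv_zero] at h1 h2
      rw [pow_zero, mul_one] at h1
      gcongr
    · rw [hvol]; ring
  unfold auxP
  split_ifs with hu
  · rw [mul_one]
    refine htriv.trans ?_
    gcongr
    have : 0 ≤ 2 ^ (n + 1) * (B1 + B2) := by positivity
    linarith
  · rw [not_le] at hu
    have h2s : 2 * s ≤ ‖u‖ := by
      have : s ≤ l⁻¹ := by rw [hs]; exact min_le_right _ _
      rw [div_eq_mul_inv] at hu
      linarith
    set M := max 1 (s ^ 2 * (t * ‖u‖ ^ (m - 2))) with hM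
    have hM1 : 1 ≤ M := le_max_left _ _
    set W := ‖t • fderiv ℝ μ u - innerSL ℝ η‖ with hW
    have hW0 : 0 ≤ W := norm_nonneg _
    have hO : IsOpen {x : E | x ≠ 0} := isOpen_ne
    have hne : ∀ z ∈ Metric.closedBall u s, z ≠ 0 := fun z hz h0 => by
      rw [h0, mem_closedBall_iff_norm', sub_zero] at hz; linarith
    set D0 := C1 * M / s with hD0
    have hCM : 1 ≤ C1 * M := one_le_mul_of_one_le_of_one_le hC1 hM1
    have hsD : s⁻¹ ≤ D0 := by
      rw [hD0, inv_eq_one_div]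
      gcongr
    have hD1 : 1 ≤ D0 := (one_le_inv₀ hs0 |>.2 hs1).trans hsD
    have hcE : ContDiffOn ℝ (⊤ : ℕ∞) (fun z => Complex.exp ((2 * π * I) *
        ((t * μ z - t * fderiv ℝ μ u z : ℝ) : ℂ))) {x | x ≠ 0} := by
      have hin : ContDiffOn ℝ (⊤ : ℕ∞) (fun z => t * μ z - t * fderiv ℝ μ u z) {x | x ≠ 0} :=
        (contDiffOn_const.mul hsmooth).sub (contDiff_const.mul (fderiv ℝ μ u).contDiff).contDiffOn
      have hout : ContDiff ℝ (⊤ : ℕ∞) (fun r : ℝ => Complex.exp ((2 * π * I) * r)) := by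
        exact (contDiff_const.mul Complex.ofRealCLM.contDiff).cexp
      exact hout.comp_contDiffOn hin
    have hcχ : ContDiff ℝ (⊤ : ℕ∞) (fun z => ((χ (s⁻¹ • (z - u)) : ℝ) : ℂ)) := by
      have h1 : ContDiff ℝ (⊤ : ℕ∞) (fun z => χ (s⁻¹ • (z - u))) := by fun_prop
      exact Complex.ofRealCLM.contDiff.comp h1
    have hcg := aux_conj_contDiff g x
    have hGon : ContDiffOn ℝ (⊤ : ℕ∞) (auxG t s μ χ g u x) {x | x ≠ 0} :=
      (hcE.mul hcχ.contDiffOn).mul hcg.contDiffOn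
    have hG0 : ∀ y, y ∉ Metric.closedBall u s → auxG t s μ χ g u x y = 0 := fun y hy => by
      unfold auxG
      rw [aux_chi_zero χ hsupp s hs0 u y hy]; simp
    have hG : ContDiff ℝ (⊤ : ℕ∞) (auxG t s μ χ g u x) := by
      rw [contDiff_iff_contDiffAt]
      intro y
      by_cases hy : y ∈ Metric.closedBall u s
      · exact hGon.contDiffAt (hO.mem_nhds (hne y hy))
      · have : auxG t s μ χ g u x =ᶠ[nhds y] fun _ => 0 := by
          filter_upwards [Metric.isClosed_closedBall.isOpen_compl.mem_nhds hy] with z hz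
          exact hG0 z hz
        exact contDiffAt_const.congr_of_eventuallyEq this
    have hbG : ∀ y ∈ Metric.closedBall u s, ∀ j ≤ n + 1,
        ‖iteratedFDeriv ℝ j (auxG t s μ χ g u x) y‖ ≤
          (2 ^ (n + 1) * (2 ^ (n + 1) * A * Cχ) * (Cg * β)) * D0 ^ j := by
      intro y hy
      refine aux_mul_bound (n + 1) _ hO _ _ (hcE.mul hcχ.contDiffOn) hcg.contDiffOn y (hne y hy)
        _ _ D0 (by positivity) (by positivity) (by positivity) ?_ ?_
      · refine aux_mul_bound (n + 1) _ hO _ _ hcE hcχ.contDiffOn y (hne y hy)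
          _ _ D0 (by positivity) (by positivity) (by positivity) ?_ ?_
        · exact hexp t s ht hs0 u y h2s hy
        · intro j hj
          refine (hbχ s hs0 u y j hj).trans ?_
          gcongr
      · intro j hj
        refine (hbg x u y (hball1 y hy) j hj).trans ?_
        exact le_mul_of_one_le_right (by positivity) (one_le_pow₀ hD1)
    set ζ : E := η - t • (InnerProductSpace.toDual ℝ E).symm (fderiv ℝ μ u) with hζ
    have hζn : ‖ζ‖ = W := by
      rw [hW, norm_sub_rev (t • fderiv ℝ μ u), ← (InnerProductSpace.toDual ℝ E).norm_map ζ, hζ,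
        map_sub, map_smulₛₗ, LinearIsometryEquiv.apply_symm_apply]
      rfl
    have hQF : Q = FourierTransform.fourier (auxG t s μ χ g u x) ζ := by
      rw [Real.fourier_eq', hQ]
      congr 1
      ext y
      by_cases hy : y ∈ Metric.closedBall u s
      · have hin : ⟪y, ζ⟫ = ⟪η, y⟫ - t * fderiv ℝ μ u y := by
          rw [hζ, inner_sub_right, inner_smul_right, real_inner_comm,
            real_inner_comm _ y, InnerProductSpace.toDual_symm_apply]
        rw [hF y (hne y hy), hin, smul_eq_mul, auxG]
        have e : ∀ a b c d p q : ℂ, a + b = c + d → Complex.exp a * (Complex.exp b * p * q) =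
            Complex.exp c * (Complex.exp d * p * q) := fun a b c d p q h => by
          calc _ = Complex.exp (a + b) * p * q := by rw [Complex.exp_add]; ring
            _ = _ := by rw [h, Complex.exp_add]; ring
        apply e
        push_cast
        ring
      · rw [hG0 y hy, aux_chi_zero χ hsupp s hs0 u y hy]; simp
    have hfb := aux_fourier_bound (n + 1) _ hG u s hs0 hG0 _ D0 (by positivity) hD1 hbG ζ
    rw [← hQF, hζn] at hfb
    set X := W * (s / M) with hX
    have hX0 : 0 ≤ X := by positivity
    have h1 : X ^ (n + 1) * ‖Q‖ ≤ B2 * s ^ n * β := by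
      have e : X ^ (n + 1) * ‖Q‖ = (s / M) ^ (n + 1) * (W ^ (n + 1) * ‖Q‖) := by
        rw [hX, mul_pow]; ring
      rw [e]
      refine (mul_le_mul_of_nonneg_left hfb (by positivity)).trans (le_of_eq ?_)
      rw [hD0, hB2, div_pow, div_pow, mul_pow]
      have : M ≠ 0 := by positivity
      field_simp
      rfl
    have h2 : (1 + X) ^ (n + 1) ≤ 2 ^ (n + 1) * (1 + X ^ (n + 1)) := by
      have := add_pow_le (zero_le_one (α := ℝ)) hX0 (n + 1)
      rw [one_pow] at this
      refine this.trans ?_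
      gcongr
      · norm_num
      · omega
    rw [← div_eq_mul_inv, le_div_iff₀ (by positivity)]
    calc ‖Q‖ * (1 + X) ^ (n + 1) ≤ ‖Q‖ * (2 ^ (n + 1) * (1 + X ^ (n + 1))) := by gcongr
      _ = 2 ^ (n + 1) * (‖Q‖ + X ^ (n + 1) * ‖Q‖) := by ring
      _ ≤ 2 ^ (n + 1) * (B1 * s ^ n * β + B2 * s ^ n * β) := by gcongr
      _ = (2 ^ (n + 1) * (B1 + B2)) * s ^ n * β := by ring
      _ ≤ _ := by
        gcongr
        linarith

end aux5

section aux6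
variable {E : Type*} [NormedAddCommGroup E] [InnerProductSpace ℝ E] [FiniteDimensional ℝ E]
  [MeasurableSpace E] [BorelSpace E]

/-- the character -/
def auxe (ξ y : E) : ℂ := Complex.exp (-(((2 * π * ⟪ξ, y⟫ : ℝ) : ℂ) * I))

theorem auxe_norm (ξ y : E) : ‖auxe ξ y‖ = 1 := by
  rw [auxe, ← neg_mul, ← Complex.ofReal_neg, Complex.norm_exp_ofReal_mul_I]

theorem auxe_cont : Continuous (fun p : E × E => auxe p.1 p.2) := by
  unfold auxe
  have : Continuous (fun p : E × E => ⟪p.1, p.2⟫) := continuous_fst.inner continuous_snd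
  fun_prop

theorem auxe_sub (ξ ξ' y : E) : auxe (ξ - ξ') y = auxe ξ y * Complex.exp (((2 * π * ⟪ξ', y⟫ : ℝ) : ℂ) * I) := by
  rw [auxe, auxe, ← Complex.exp_add, inner_sub_left]
  congr 1; push_cast; ring

theorem aux_four (f : E → ℂ) (ξ : E) : FourierTransform.fourier f ξ = ∫ y, auxe ξ y * f y := by
  rw [Real.fourier_eq']
  congr 1
  ext y
  rw [smul_eq_mul, auxe, real_inner_comm]
  congr 2; push_cast; ring

theorem aux_four_cont (f : E → ℂ) (hf : Integrable f) : Continuous (FourierTransform.fourier f) :=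
  VectorFourier.fourierIntegral_continuous Real.continuous_fourierChar continuous_inner hf

theorem aux_R1 (f w : E → ℂ) (hfc : Continuous f) (hfi : Integrable f)
    (hff : Integrable (FourierTransform.fourier f)) (hw : Integrable w) (ξ : E) :
    ‖∫ y, auxe ξ y * (f y * w y)‖ₑ ≤
      ∫⁻ ξ', ‖FourierTransform.fourier f ξ'‖ₑ * ‖∫ y, auxe (ξ - ξ') y * w y‖ₑ := by
  have hinv := hfc.fourierInv_fourier_eq hfi hff
  set Φ := FourierTransform.fourier f with hΦ
  have h1 : ∀ y, auxe ξ y * (f y * w y) = ∫ ξ', auxe (ξ - ξ') y * (w y * Φ ξ') := fun y => by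
    have := congrFun hinv y
    rw [Real.fourierInv_eq'] at this
    rw [← this, mul_comm _ (w y), ← mul_assoc, ← integral_const_mul]
    congr 1
    ext ξ'
    rw [auxe_sub, smul_eq_mul]
    ring
  simp_rw [h1]
  rw [integral_integral_swap]
  · refine (enorm_integral_le_lintegral_enorm _).trans (le_of_eq ?_)
    refine lintegral_congr fun ξ' => ?_
    rw [← enorm_mul, ← integral_const_mul]
    congr 2
    ext y
    ring
  · have := (hw.mul_prod hff).bdd_mul (c := 1)
      (f := fun p : E × E => auxe (ξ - p.2) p.1) ?_ ?_
    · exact this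
    · have h2 : Continuous (fun p : E × E => auxe (ξ - p.2) p.1) :=
        auxe_cont.comp ((continuous_const.sub continuous_snd).prodMk continuous_fst)
      exact h2.aestronglyMeasurable
    · exact Filter.Eventually.of_forall fun p => (auxe_norm _ _).le

theorem aux_R2 (a k : E → ℂ) (ha : Integrable a) (hk : Integrable k) :
    ‖∫ v, k v‖ₑ * ‖∫ y, a y‖ₑ ≤ ∫⁻ u, ‖∫ y, a y * k (y - u)‖ₑ := by
  have h := integral_convolution (μ := volume) (ν := volume) (ContinuousLinearMap.mul ℂ ℂ) ha hk.comp_neg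
  rw [integral_neg_eq_self] at h
  simp only [ContinuousLinearMap.mul_apply'] at h
  rw [mul_comm, ← enorm_mul, ← h]
  refine (enorm_integral_le_lintegral_enorm _).trans (le_of_eq ?_)
  refine lintegral_congr fun u => ?_
  rw [convolution_def]
  simp

theorem aux_F_meas (t : ℝ) (μ : E → ℝ)
    (hsmooth : ContDiffOn ℝ (⊤ : ℕ∞) μ {x | x ≠ 0}) (F : E → ℂ)
    (hF : ∀ y, y ≠ 0 → F y = Complex.exp (((2 * π * (t * μ y) : ℝ) : ℂ) * I)) : Measurable F := by
  apply measurable_of_measurable_on_compl_singleton 0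
  apply Continuous.measurable
  have hμ := hsmooth.continuousOn
  have h1 : ContinuousOn (fun y => Complex.exp (((2 * π * (t * μ y) : ℝ) : ℂ) * I)) {x : E | x ≠ 0} := by
    fun_prop
  have h2 : ContinuousOn F {x : E | x ≠ 0} := h1.congr fun y hy => hF y hy
  exact continuousOn_iff_continuous_restrict.1 h2

theorem auxP_meas (m t s l : ℝ) (μ : E → ℝ) :
    Measurable (fun p : E × E => auxP m t s l (fderiv ℝ μ) p.1 p.2) := by
  unfold auxP
  have hD : Measurable (fun p : E × E => fderiv ℝ μ p.1) := (measurable_fderiv ℝ μ).comp measurable_fst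
  have hI : Measurable (fun p : E × E => innerSL ℝ p.2) :=
    ((innerSL ℝ).continuous.comp continuous_snd).measurable
  refine Measurable.ite (measurableSet_le (by fun_prop) measurable_const) measurable_const ?_
  have h1 : Measurable (fun p : E × E => ‖t • fderiv ℝ μ p.1 - innerSL ℝ p.2‖) :=
    ((hD.const_smul t).sub hI).norm
  fun_prop

theorem aux_I_lower (g : SchwartzMap E ℂ) (hg : g ≠ 0) :
    ∃ (y0 : E) (χ : E → ℝ) (c : ℝ), 0 < c ∧ ContDiff ℝ (⊤ : ℕ∞) χ ∧ (∀ y, 1 < ‖y‖ → χ y = 0) ∧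
      ∀ s : ℝ, 0 < s → s ≤ 1 → c * s ^ Module.finrank ℝ E ≤
        ‖∫ v, (starRingEnd ℂ) (g (v + y0)) * ((χ (s⁻¹ • v) : ℝ) : ℂ)‖ := by
  obtain ⟨y0, hy0⟩ : ∃ y0, g y0 ≠ 0 := by
    by_contra h
    push Not at h
    exact hg (by ext y; simp [h y])
  have hpos : 0 < ‖g y0‖ := norm_pos_iff.2 hy0
  obtain ⟨r, hr, hrb⟩ := Metric.continuousAt_iff.1 (g.continuous.continuousAt (x := y0))
    (‖g y0‖ / 2) (half_pos hpos)
  have hR : 0 < min 1 (r / 2) := by positivity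
  let χ : ContDiffBump (0 : E) := ⟨min 1 (r / 2) / 2, min 1 (r / 2), by positivity, by linarith⟩
  have hχ0 : ∀ y, min 1 (r / 2) ≤ ‖y‖ → χ y = 0 := fun y hy =>
    χ.zero_of_le_dist (by rw [dist_zero_right]; exact hy)
  have hinteg : 0 < ∫ v, χ v := χ.integral_pos
  refine ⟨y0, χ, ‖g y0‖ / 2 * ∫ v, χ v, by positivity, χ.contDiff,
    fun y hy => hχ0 y ((min_le_left _ _).trans hy.le), ?_⟩
  intro s hs hs1
  have hχi : Integrable (fun v => χ (s⁻¹ • v)) :=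
    (integrable_comp_smul_iff volume χ (inv_ne_zero hs.ne')).2 χ.integrable
  have hI : ∫ v, χ (s⁻¹ • v) = s ^ Module.finrank ℝ E * ∫ v, χ v := by
    rw [Measure.integral_comp_inv_smul, abs_of_pos (by positivity), smul_eq_mul]
  have hIC : ∫ v, (starRingEnd ℂ) (g y0) * ((χ (s⁻¹ • v) : ℝ) : ℂ) =
      (starRingEnd ℂ) (g y0) * ((s ^ Module.finrank ℝ E * ∫ v, χ v : ℝ) : ℂ) := by
    rw [integral_const_mul, integral_complex_ofReal, hI]
  have hbd : ∀ v, ‖(starRingEnd ℂ) (g (v + y0)) * ((χ (s⁻¹ • v) : ℝ) : ℂ) -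
      (starRingEnd ℂ) (g y0) * ((χ (s⁻¹ • v) : ℝ) : ℂ)‖ ≤ ‖g y0‖ / 2 * χ (s⁻¹ • v) := fun v => by
    rw [← sub_mul, ← map_sub, norm_mul, RCLike.norm_conj, Complex.norm_real,
      Real.norm_of_nonneg χ.nonneg]
    by_cases hv : ‖v‖ < r
    · have := hrb (x := v + y0) (by simpa using hv)
      rw [dist_eq_norm] at this
      exact mul_le_mul_of_nonneg_right this.le χ.nonneg
    · rw [hχ0 (s⁻¹ • v)]
      · simp
      · rw [norm_smul, Real.norm_of_nonneg (inv_nonneg.2 hs.le)]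
        rw [not_lt] at hv
        have h1 : 1 ≤ s⁻¹ := (one_le_inv₀ hs).2 hs1
        have h2 := min_le_right 1 (r / 2)
        nlinarith
  have hi2 : Integrable (fun v => (starRingEnd ℂ) (g y0) * ((χ (s⁻¹ • v) : ℝ) : ℂ)) :=
    hχi.ofReal.const_mul _
  have hcont : Continuous (fun v => (starRingEnd ℂ) (g (v + y0)) * ((χ (s⁻¹ • v) : ℝ) : ℂ)) := by
    have := χ.continuous
    have := g.continuous
    fun_prop
  have hi3 : Integrable (fun v => (starRingEnd ℂ) (g (v + y0)) * ((χ (s⁻¹ • v) : ℝ) : ℂ) -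
      (starRingEnd ℂ) (g y0) * ((χ (s⁻¹ • v) : ℝ) : ℂ)) :=
    (hχi.const_mul (‖g y0‖ / 2)).mono' (hcont.aestronglyMeasurable.sub hi2.aestronglyMeasurable)
      (Filter.Eventually.of_forall hbd)
  have hi1 : Integrable (fun v => (starRingEnd ℂ) (g (v + y0)) * ((χ (s⁻¹ • v) : ℝ) : ℂ)) := by
    have := hi3.add hi2
    refine this.congr (Filter.Eventually.of_forall fun v => ?_)
    simp
  have h5 := norm_integral_le_of_norm_le (hχi.const_mul (‖g y0‖ / 2)) (Filter.Eventually.of_forall hbd)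
  rw [integral_sub hi1 hi2, hIC, integral_const_mul, hI] at h5
  have h6 : ‖(starRingEnd ℂ) (g y0) * ((s ^ Module.finrank ℝ E * ∫ v, χ v : ℝ) : ℂ)‖ =
      ‖g y0‖ * (s ^ Module.finrank ℝ E * ∫ v, χ v) := by
    rw [norm_mul, RCLike.norm_conj, Complex.norm_real, Real.norm_of_nonneg (by positivity)]
  have h7 := norm_sub_norm_le ((starRingEnd ℂ) (g y0) * ((s ^ Module.finrank ℝ E * ∫ v, χ v : ℝ) : ℂ))
    (∫ v, (starRingEnd ℂ) (g (v + y0)) * ((χ (s⁻¹ • v) : ℝ) : ℂ))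
  rw [norm_sub_rev, h6] at h7
  linarith

end aux6

section aux7
variable {E : Type*} [NormedAddCommGroup E] [InnerProductSpace ℝ E] [FiniteDimensional ℝ E]
  [MeasurableSpace E] [BorelSpace E]

theorem aux_hg_int (h g : SchwartzMap E ℂ) (z : E) :
    Integrable (fun y => h y * (starRingEnd ℂ) (g (y - z))) := by
  obtain ⟨C, _, hC⟩ := aux_schwartz 0 g
  have h1 := h.integrable (μ := volume)
  have hc : Continuous (fun y => (starRingEnd ℂ) (g (y - z))) := (aux_conj_contDiff g z).continuous
  have := h1.bdd_mul (c := C) hc.aestronglyMeasurable (Filter.Eventually.of_forall fun y => by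
    have := hC z y y (by simp) 0 le_rfl
    simpa using this)
  refine this.congr (Filter.Eventually.of_forall fun y => ?_)
  simp only []
  ring

theorem aux_main (m : ℝ) (hm : 2 ≤ m) (μ : E → ℝ)
    (hsmooth : ContDiffOn ℝ (⊤ : ℕ∞) μ {x | x ≠ 0})
    (hhom : ∀ c : ℝ, 0 < c → ∀ x : E, x ≠ 0 → μ (c • x) = c ^ m * μ x)
    (hhess : ∀ x : E, ‖x‖ = 1 → Function.Bijective ⇑(fderiv ℝ (fderiv ℝ μ) x))
    (g : SchwartzMap E ℂ) (hg : g ≠ 0) :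
    ∃ C : ℝ, 0 < C ∧ ∀ t l : ℝ, 0 < t → l = t ^ (1 / m) → ∀ F : E → ℂ,
      (∀ y, y ≠ 0 → F y = Complex.exp (((2 * π * (t * μ y) : ℝ) : ℂ) * I)) → F 0 = 1 →
      ∀ h : SchwartzMap E ℂ, ∀ ξ : E,
      ∫⁻ x, ‖∫ y, auxe ξ y * (F y * h y) * (starRingEnd ℂ) (g (y - x))‖ₑ ≤
        ENNReal.ofReal (C * (min l (l ^ 2) ^ Module.finrank ℝ E)⁻¹) *
          ∫⁻ ξ', ⨆ z, ‖∫ y, auxe ξ' y * h y * (starRingEnd ℂ) (g (y - z))‖ₑ := by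
  obtain ⟨y0, χ, c, hc, hχ, hsupp, hI⟩ := aux_I_lower g hg
  obtain ⟨C, hC, hdecay⟩ := aux_decay m hm μ hsmooth hhom χ hχ hsupp g
  obtain ⟨K, hK, hP⟩ := auxP_lint m hm μ hsmooth hhom hhess
  obtain ⟨B, hB, hb⟩ := aux_lint_bracket (E := E)
  set n := Module.finrank ℝ E with hn
  refine ⟨c⁻¹ * (C * B * K), by positivity, ?_⟩
  intro t l ht hl F hF hF0 h ξ
  have hl0 : 0 < l := by rw [hl]; positivity
  set s := min 1 l⁻¹ with hs
  have hs0 : 0 < s := by positivity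
  have hs1 : s ≤ 1 := min_le_left _ _
  have hF1 : ∀ y, ‖F y‖ = 1 := fun y => by
    by_cases h : y = 0
    · rw [h, hF0, norm_one]
    · rw [hF y h, Complex.norm_exp_ofReal_mul_I]
  have hFm : Measurable F := aux_F_meas t μ hsmooth F hF
  set L := (min l (l ^ 2) ^ n)⁻¹ with hL
  have hL0 : 0 < L := by positivity
  set f : E → E → ℂ := fun z y => h y * (starRingEnd ℂ) (g (y - z)) with hf
  have hfi : ∀ z, Integrable (f z) := fun z => aux_hg_int h g z
  have hfc : ∀ z, Continuous (f z) := fun z =>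
    h.continuous.mul (aux_conj_contDiff g z).continuous
  have hV : ∀ z ξ', ∫ y, auxe ξ' y * h y * (starRingEnd ℂ) (g (y - z)) =
      FourierTransform.fourier (f z) ξ' := fun z ξ' => by
    rw [aux_four]; simp only [hf, mul_assoc]
  simp_rw [hV]
  set H : E → ℝ≥0∞ := fun ξ' => ⨆ z, ‖FourierTransform.fourier (f z) ξ'‖ₑ with hH
  have hHm : Measurable H := by
    apply LowerSemicontinuous.measurable
    apply lowerSemicontinuous_iSup
    intro z
    exact (aux_four_cont _ (hfi z)).enorm.lowerSemicontinuous
  by_cases htop : ∫⁻ ξ', H ξ' = ∞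
  · rw [htop, ENNReal.mul_top]
    · exact le_top
    · simp only [ne_eq, ENNReal.ofReal_eq_zero, not_le]; positivity
  have hVi : ∀ z, Integrable (FourierTransform.fourier (f z)) := fun z => by
    refine ⟨(aux_four_cont _ (hfi z)).aestronglyMeasurable, ?_⟩
    refine lt_of_le_of_lt (lintegral_mono fun ξ' => ?_) (lt_top_iff_ne_top.2 htop)
    exact le_iSup (fun z => ‖FourierTransform.fourier (f z) ξ'‖ₑ) z
  have hχc : Continuous χ := hχ.continuous
  have hcs : HasCompactSupport χ := HasCompactSupport.intro (isCompact_closedBall (0 : E) 1)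
    (fun y hy => hsupp y (by simpa using hy))
  -- the window weight
  have hχi : Integrable (fun v => ((χ (s⁻¹ • v) : ℝ) : ℂ)) :=
    ((integrable_comp_smul_iff volume χ (inv_ne_zero hs0.ne')).2
      (hχc.integrable_of_hasCompactSupport hcs)).ofReal
  obtain ⟨Cg, _, hCg⟩ := aux_schwartz 0 g
  have hgb : ∀ y, ‖(starRingEnd ℂ) (g y)‖ ≤ Cg := fun y => by
    have := hCg 0 y y (by simp) 0 le_rfl
    simpa using this
  have hgcont := g.continuous
  set k : E → ℂ := fun v => (starRingEnd ℂ) (g (v + y0)) * ((χ (s⁻¹ • v) : ℝ) : ℂ) with hk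
  have hki : Integrable k := hχi.bdd_mul (c := Cg)
    (Continuous.aestronglyMeasurable (by fun_prop)) (Filter.Eventually.of_forall fun y => hgb _)
  set w : E → E → E → ℂ := fun u x y => F y * ((χ (s⁻¹ • (y - u)) : ℝ) : ℂ) * (starRingEnd ℂ) (g (y - x))
    with hw
  have hwi : ∀ u x, Integrable (w u x) := fun u x => by
    have h1 := ((hχi.comp_sub_right u).bdd_mul (c := 1) hFm.aestronglyMeasurable
      (Filter.Eventually.of_forall fun y => (hF1 y).le))
    have h2 := h1.mul_bdd (c := Cg) (g := fun y => (starRingEnd ℂ) (g (y - x)))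
      (Continuous.aestronglyMeasurable (by fun_prop)) (Filter.Eventually.of_forall fun y => hgb _)
    exact h2
  set a : E → E → ℂ := fun x y => auxe ξ y * (F y * h y) * (starRingEnd ℂ) (g (y - x)) with ha
  have hai : ∀ x, Integrable (a x) := fun x => by
    have h1 := (hfi x).bdd_mul (c := 1) (f := fun y => auxe ξ y * F y)
      (AEStronglyMeasurable.mul (Continuous.aestronglyMeasurable
        (auxe_cont.comp (continuous_const.prodMk continuous_id))) hFm.aestronglyMeasurable)
      (Filter.Eventually.of_forall fun y => by rw [norm_mul, auxe_norm, hF1, one_mul])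
    refine h1.congr (Filter.Eventually.of_forall fun y => ?_)
    simp only [hf, ha]; ring
  set b : E → ℝ≥0∞ := fun v => ENNReal.ofReal ((1 + ‖v‖) ^ (n + 1))⁻¹ with hbdef
  have hbm : Measurable b := by
    have : Measurable (fun v : E => ((1 + ‖v‖) ^ (n + 1))⁻¹) := by fun_prop
    exact this.ennreal_ofReal
  set P : E → E → ℝ≥0∞ := fun u η => ENNReal.ofReal (auxP m t s l (fderiv ℝ μ) u η) with hPdef
  have hPm : Measurable (fun p : E × E => P p.1 p.2) := (auxP_meas m t s l μ).ennreal_ofReal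
  set κ := ENNReal.ofReal (C * s ^ n) with hκ
  -- pointwise bound
  have hpt : ∀ x, ‖∫ v, k v‖ₑ * ‖∫ y, a x y‖ₑ ≤ ∫⁻ u, b (x - u) * (κ * ∫⁻ ξ', H ξ' * P u (ξ - ξ')) := by
    intro x
    refine (aux_R2 (a x) k (hai x) hki).trans (lintegral_mono fun u => ?_)
    have e1 : ∫ y, a x y * k (y - u) = ∫ y, auxe ξ y * (f (u - y0) y * w u x y) := by
      congr 1; ext y
      have : y - u + y0 = y - (u - y0) := by abel
      simp only [ha, hk, hf, hw, this]
      ring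
    rw [e1]
    refine (aux_R1 _ _ (hfc _) (hfi _) (hVi _) (hwi u x) ξ).trans ?_
    have hm1 : Measurable (fun ξ' => P u (ξ - ξ')) :=
      hPm.comp (measurable_const.prodMk (measurable_const.sub measurable_id))
    have hm2 : Measurable (fun ξ' => H ξ' * P u (ξ - ξ')) := hHm.mul hm1
    rw [← mul_assoc, ← lintegral_const_mul _ hm2]
    refine lintegral_mono fun ξ' => ?_
    have hq : ‖∫ y, auxe (ξ - ξ') y * w u x y‖ₑ ≤ κ * b (x - u) * P u (ξ - ξ') := by
      rw [hκ, hbdef, hPdef, ← ENNReal.ofReal_mul (by positivity), ← ENNReal.ofReal_mul (by positivity),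
        ← ofReal_norm_eq_enorm]
      exact ENNReal.ofReal_le_ofReal (hdecay t l s ht hl0 hs F hF hF0 u x (ξ - ξ'))
    calc _ ≤ H ξ' * (κ * b (x - u) * P u (ξ - ξ')) := by
          refine mul_le_mul' ?_ hq
          exact le_iSup (fun z => ‖FourierTransform.fourier (f z) ξ'‖ₑ) (u - y0)
      _ = _ := by ring
  have hb1 : ∀ u, ∫⁻ x, b (x - u) ≤ ENNReal.ofReal B := fun u => by
    have := hb 1 one_pos u
    simpa [hbdef] using this
  have hHP : Measurable (fun p : E × E => H p.2 * P p.1 (ξ - p.2)) :=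
    (hHm.comp measurable_snd).mul
      (hPm.comp (measurable_fst.prodMk (measurable_const.sub measurable_snd)))
  set R : E → ℝ≥0∞ := fun u => ∫⁻ ξ', H ξ' * P u (ξ - ξ') with hR
  have hRm : Measurable R := hHP.lintegral_prod_right'
  have hRI : ∫⁻ u, R u ≤ ENNReal.ofReal (K * L) * ∫⁻ ξ', H ξ' := by
    rw [hR, lintegral_lintegral_swap hHP.aemeasurable, ← lintegral_const_mul _ hHm]
    refine lintegral_mono fun ξ' => ?_
    have hm1 : Measurable (fun u => P u (ξ - ξ')) :=
      hPm.comp (measurable_id.prodMk measurable_const)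
    simp only []
    rw [lintegral_const_mul _ hm1, mul_comm]
    gcongr
    exact hP t l ht hl (ξ - ξ')
  have htot : ‖∫ v, k v‖ₑ * ∫⁻ x, ‖∫ y, a x y‖ₑ ≤
      ENNReal.ofReal B * (κ * (ENNReal.ofReal (K * L) * ∫⁻ ξ', H ξ')) := by
    rw [← lintegral_const_mul' _ _ (by finiteness)]
    refine (lintegral_mono hpt).trans ?_
    rw [lintegral_lintegral_swap]
    · calc _ ≤ ∫⁻ u, ENNReal.ofReal B * (κ * R u) := by
            refine lintegral_mono fun u => ?_
            have hm1 : Measurable (fun x => b (x - u)) := hbm.comp (measurable_id.sub measurable_const)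
            simp only []
            rw [lintegral_mul_const _ hm1]
            gcongr
            exact hb1 u
        _ = ENNReal.ofReal B * (κ * ∫⁻ u, R u) := by
            rw [lintegral_const_mul _ (hRm.const_mul _), lintegral_const_mul _ hRm]
        _ ≤ _ := by gcongr
    · apply Measurable.aemeasurable
      exact (hbm.comp (measurable_fst.sub measurable_snd)).mul
        ((hRm.comp measurable_snd).const_mul κ)
  have hIs : ENNReal.ofReal (c * s ^ n) ≤ ‖∫ v, k v‖ₑ := by
    rw [← ofReal_norm_eq_enorm]
    exact ENNReal.ofReal_le_ofReal (hI s hs0 hs1)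
  have hcs0 : 0 < c * s ^ n := by positivity
  calc ∫⁻ x, ‖∫ y, a x y‖ₑ
      = ENNReal.ofReal ((c * s ^ n)⁻¹) * (ENNReal.ofReal (c * s ^ n) * ∫⁻ x, ‖∫ y, a x y‖ₑ) := by
        rw [← mul_assoc, ← ENNReal.ofReal_mul (by positivity), inv_mul_cancel₀ hcs0.ne',
          ENNReal.ofReal_one, one_mul]
    _ ≤ ENNReal.ofReal ((c * s ^ n)⁻¹) *
        (ENNReal.ofReal B * (κ * (ENNReal.ofReal (K * L) * ∫⁻ ξ', H ξ'))) := by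
        exact mul_le_mul' le_rfl ((mul_le_mul' hIs le_rfl).trans htot)
    _ = _ := by
        rw [hκ, ← mul_assoc, ← mul_assoc, ← mul_assoc, ← ENNReal.ofReal_mul (by positivity),
          ← ENNReal.ofReal_mul (by positivity), ← ENNReal.ofReal_mul (by positivity)]
        congr 2
        field_simp

theorem aux_exponents (d : ℕ) (m t : ℝ) (ht : 0 < t) :
    (min (t ^ (1 / m)) ((t ^ (1 / m)) ^ 2) ^ d)⁻¹ ≤
      max (t ^ (-((d : ℝ) / m))) (t ^ (-(2 * (d : ℝ) / m))) := by
  have e1 : ((t ^ (1 / m)) ^ d)⁻¹ = t ^ (-((d : ℝ) / m)) := by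
    rw [← Real.rpow_natCast, ← Real.rpow_mul ht.le, ← Real.rpow_neg ht.le]
    congr 1; ring
  have e2 : (((t ^ (1 / m)) ^ 2) ^ d)⁻¹ = t ^ (-(2 * (d : ℝ) / m)) := by
    rw [← pow_mul, ← Real.rpow_natCast, ← Real.rpow_mul ht.le, ← Real.rpow_neg ht.le]
    congr 1; push_cast; ring
  rcases min_choice (t ^ (1 / m)) ((t ^ (1 / m)) ^ 2) with h | h
  · rw [h, e1]; exact le_max_left _ _
  · rw [h, e2]; exact le_max_right _ _

end aux7

/-- Under hypotheses (H), the dispersive estimate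
`‖e^{2πitμ(D)} f‖_{W^{1,∞}} ≤ C max{t^{-d/m}, t^{-2d/m}} ‖f‖_{W^{∞,1}}`, written on the
Fourier-transform side: for all `t > 0`, Schwartz `h` and all `ξ`,
`∫ |V_g(F_{tμ}·h)(x,ξ)| dx ≤ C max{t^{-d/m}, t^{-2d/m}} ∫ sup_x |V_g h(x,ξ')| dξ'`. -/
theorem dispersive_estimate_W1inf (d : ℕ) (hd : 1 ≤ d) (m : ℝ) (hm : 2 ≤ m)
    (μ : EuclideanSpace ℝ (Fin d) → ℝ)
    (hsmooth : ContDiffOn ℝ (⊤ : ℕ∞) μ {x | x ≠ 0})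
    (hhom : ∀ c : ℝ, 0 < c → ∀ x : EuclideanSpace ℝ (Fin d), x ≠ 0 →
      μ (c • x) = c ^ m * μ x)
    (hhess : ∀ x : EuclideanSpace ℝ (Fin d), ‖x‖ = 1 →
      Function.Bijective ⇑(fderiv ℝ (fderiv ℝ μ) x))
    (Ftμ : ℝ → EuclideanSpace ℝ (Fin d) → ℂ)
    (hFtμ : ∀ t : ℝ, ∀ y : EuclideanSpace ℝ (Fin d), y ≠ 0 →
      Ftμ t y = Complex.exp (((2 * Real.pi * (t * μ y) : ℝ) : ℂ) * Complex.I))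
    (hFtμ0 : ∀ t : ℝ, Ftμ t 0 = 1)
    (g : SchwartzMap (EuclideanSpace ℝ (Fin d)) ℂ) (hg : g ≠ 0) :
    ∃ C : ℝ, 0 < C ∧ ∀ t : ℝ, 0 < t →
      ∀ h : SchwartzMap (EuclideanSpace ℝ (Fin d)) ℂ, ∀ ξ : EuclideanSpace ℝ (Fin d),
        (∫⁻ x : EuclideanSpace ℝ (Fin d),
          (‖∫ (y : EuclideanSpace ℝ (Fin d)),
              Complex.exp (-(((2 * Real.pi * ⟪ξ, y⟫ : ℝ) : ℂ) * Complex.I)) *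
                (Ftμ t y * h y) * (starRingEnd ℂ) (g (y - x))‖₊ : ℝ≥0∞) ∂volume) ≤
        ENNReal.ofReal (C * max (t ^ (-((d : ℝ) / m))) (t ^ (-(2 * (d : ℝ) / m)))) *
          ∫⁻ ξ' : EuclideanSpace ℝ (Fin d),
            ⨆ x : EuclideanSpace ℝ (Fin d),
              (‖∫ (y : EuclideanSpace ℝ (Fin d)),
                  Complex.exp (-(((2 * Real.pi * ⟪ξ', y⟫ : ℝ) : ℂ) * Complex.I)) * h y *
                    (starRingEnd ℂ) (g (y - x))‖₊ : ℝ≥0∞) ∂volume := by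
  obtain ⟨C, hC, hmain⟩ := aux_main m hm μ hsmooth hhom hhess g hg
  refine ⟨C, hC, fun t ht h ξ => ?_⟩
  have key := hmain t (t ^ (1 / m)) ht rfl (Ftμ t) (fun y hy => hFtμ t y hy) (hFtμ0 t) h ξ
  refine le_trans key ?_
  refine mul_le_mul' (ENNReal.ofReal_le_ofReal ?_) le_rfl
  have := aux_exponents d m t ht
  rw [finrank_euclideanSpace_fin]
  exact mul_le_mul_of_nonneg_left this hC.le
end
end
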